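/- arXiv:1403.2322 — 5 statements merged into one kernel-verified Lean document; each statement's English description precedes it below -/
import Mathlib

section
/- Let Γ be a finite vertex-transitive graph (possibly disconnected) on vertex set V and let 2 ≤ n ≤ |V| − 1. Assume h_{n+1}(Γ) > 2(n+1)·h_n(Γ). Then for every partition V = A_1 ⊔ ⋯ ⊔ A_n into n non-empty sets achieving h_n(Γ) (i.e., with max_{1≤i≤n} |∂A_i|/|A_i| = h_n(Γ)), there exists a partition V = V_1 ⊔ ⋯ ⊔ V_n into n non-empty sets such that: (a) (V_1,…,V_n) is a system of imprimitivity of size n for the action of Aut(Γ) on V, and (c) for every 1 ≤ i ≤ n, |V_i △ A_i| ≤ (4·h_n(Γ)/h_{n+1}(Γ))·|V|. -/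
open scoped Pointwise

namespace Multiway

variable {V : Type*}

/-- The edge boundary `∂A`: the set of edges with one endpoint in `A` and the other in `Vᶜ∖A`. -/
def edgeBdry (G : SimpleGraph V) (A : Set V) : Set (Sym2 V) :=
  {e | e ∈ G.edgeSet ∧ ∃ u v, e = s(u, v) ∧ u ∈ A ∧ v ∉ A}

/-- The symmetric vertex boundary `δA`: vertices incident to an edge crossing `A`. -/
def vertBdry (G : SimpleGraph V) (A : Set V) : Set V :=
  {x | ∃ y, G.Adj x y ∧ ¬ (x ∈ A ↔ y ∈ A)}

/-- A partition of the vertex set into `n` non-empty pairwise disjoint sets. -/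
def IsNPartition (n : ℕ) (A : Fin n → Set V) : Prop :=
  (∀ i, (A i).Nonempty) ∧ (∀ i j, i ≠ j → Disjoint (A i) (A j)) ∧ (⋃ i, A i) = Set.univ

/-- `max_i |∂A_i| / |A_i|`. -/
noncomputable def edgeRatioMax (G : SimpleGraph V) {n : ℕ} (A : Fin n → Set V) : ℝ :=
  ⨆ i, ((edgeBdry G (A i)).ncard : ℝ) / ((A i).ncard : ℝ)

/-- `max_i |δA_i| / |A_i|`. -/
noncomputable def vertRatioMax (G : SimpleGraph V) {n : ℕ} (A : Fin n → Set V) : ℝ :=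
  ⨆ i, ((vertBdry G (A i)).ncard : ℝ) / ((A i).ncard : ℝ)

/-- The `n`-way isoperimetric constant `h_n(Γ)`. -/
noncomputable def multiH (G : SimpleGraph V) (n : ℕ) : ℝ :=
  sInf {r | ∃ A : Fin n → Set V, IsNPartition n A ∧ r = edgeRatioMax G A}

/-- The `n`-way symmetric vertex isoperimetric constant `ι_n(Γ)`. -/
noncomputable def multiIota (G : SimpleGraph V) (n : ℕ) : ℝ :=
  sInf {r | ∃ A : Fin n → Set V, IsNPartition n A ∧ r = vertRatioMax G A}

/-- A graph is vertex-transitive if its automorphism group acts transitively on vertices. -/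
def VertexTransitive (G : SimpleGraph V) : Prop :=
  ∀ u v : V, ∃ φ : G ≃g G, φ u = v


section core

open Classical Finset

noncomputable def ind (p : Prop) : ℝ := if p then 1 else 0

theorem ind_nonneg (p : Prop) : 0 ≤ ind p := by
  unfold ind; split_ifs <;> norm_num

noncomputable def sz {V α : Type*} [Fintype V] (c : V → α) (i : α) : ℝ := ∑ x, ind (c x = i)

noncomputable def bd {V α : Type*} [Fintype V] (G : SimpleGraph V) (c : V → α) (i : α) : ℝ :=
  ∑ u, ∑ v, ind (G.Adj u v ∧ c u = i ∧ c v ≠ i)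

noncomputable def SS {V α : Type*} [Fintype V] {G : SimpleGraph V} (c : V → α) (g : G ≃g G)
    (i j : α) : ℝ := ∑ x, ind (c x = i ∧ c (g x) = j)

noncomputable def RR {V α : Type*} [Fintype V] {G : SimpleGraph V} (c : V → α) (g : G ≃g G)
    (i j : α) : ℝ := ∑ x, ind (c x = i ∧ c (g x) ≠ j)

noncomputable def EE {V α : Type*} [Fintype V] {G : SimpleGraph V} (c : V → α) (g : G ≃g G)
    (i j : α) : ℝ :=
  ∑ u, ∑ v, ind (G.Adj u v ∧ c u = i ∧ c v = i ∧ c (g u) = j ∧ c (g v) ≠ j)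

noncomputable def WW {V α : Type*} [Fintype V] {G : SimpleGraph V} (c : V → α) (g : G ≃g G)
    (i : α) : ℝ :=
  ∑ u, ∑ v, ind (G.Adj u v ∧ c u = i ∧ c v = i ∧ c (g u) ≠ c (g v))

variable {V : Type*} [Fintype V] {G : SimpleGraph V}

theorem SS_add_RR {α : Type*} (c : V → α) (g : G ≃g G) (i j : α) :
    SS c g i j + RR c g i j = sz c i := by
  unfold SS RR sz
  rw [← sum_add_distrib]
  refine sum_congr rfl fun x _ => ?_
  unfold ind; split_ifs <;> grind

theorem RR_nonneg {α : Type*} (c : V → α) (g : G ≃g G) (i j : α) : 0 ≤ RR c g i j :=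
  sum_nonneg fun _ _ => ind_nonneg _

theorem SS_nonneg {α : Type*} (c : V → α) (g : G ≃g G) (i j : α) : 0 ≤ SS c g i j :=
  sum_nonneg fun _ _ => ind_nonneg _

theorem EE_nonneg {α : Type*} (c : V → α) (g : G ≃g G) (i j : α) : 0 ≤ EE c g i j :=
  sum_nonneg fun _ _ => sum_nonneg fun _ _ => ind_nonneg _

theorem bd_nonneg {α : Type*} (c : V → α) (i : α) : 0 ≤ bd G c i :=
  sum_nonneg fun _ _ => sum_nonneg fun _ _ => ind_nonneg _

theorem sz_pos {α : Type*} (c : V → α) (i : α) (h : ∃ x, c x = i) : 0 < sz c i := by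
  obtain ⟨x, hx⟩ := h
  refine sum_pos' (fun _ _ => ind_nonneg _) ⟨x, mem_univ _, ?_⟩
  simp [ind, hx]

theorem EE_swap {α : Type*} (c : V → α) (g : G ≃g G) (i j : α) :
    EE c g i j = ∑ u, ∑ v, ind (G.Adj u v ∧ c u = i ∧ c v = i ∧ c (g u) ≠ j ∧ c (g v) = j) := by
  unfold EE
  rw [sum_comm]
  refine sum_congr rfl fun x _ => sum_congr rfl fun y _ => ?_
  have := G.adj_comm x y
  congr 1
  grind

theorem two_EE_le {α : Type*} (c : V → α) (g : G ≃g G) (i j : α) :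
    2 * EE c g i j ≤ WW c g i := by
  have h : 2 * EE c g i j = EE c g i j +
      ∑ u, ∑ v, ind (G.Adj u v ∧ c u = i ∧ c v = i ∧ c (g u) ≠ j ∧ c (g v) = j) := by
    rw [← EE_swap]; ring
  rw [h]
  unfold EE WW
  rw [← sum_add_distrib]
  refine sum_le_sum fun x _ => ?_
  rw [← sum_add_distrib]
  refine sum_le_sum fun y _ => ?_
  unfold ind; split_ifs <;> grind

theorem sum_sz {n : ℕ} (c : V → Fin n) : ∑ i, sz c i = Fintype.card V := by
  unfold sz
  rw [sum_comm]
  have : ∀ y, ∑ i, ind (c y = i) = 1 := fun y => by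
    rw [Finset.sum_eq_single (c y)]
    · simp [ind]
    · intro b _ hb
      simp [ind, Ne.symm hb]
    · simp
  simp [this]

theorem sum_SS {n : ℕ} (c : V → Fin n) (g : G ≃g G) (j : Fin n) :
    ∑ i, SS c g i j = sz c j := by
  unfold SS sz
  rw [sum_comm]
  refine Eq.trans ?_ (Equiv.sum_comp g.toEquiv _)
  refine sum_congr rfl fun x _ => ?_
  calc _ = ∑ i, (if i = c x then ind (c (g x) = j) else 0) := by
        refine sum_congr rfl fun i _ => ?_
        unfold ind; split_ifs <;> grind
    _ = _ := by simp

theorem sum_EE_le {n : ℕ} (c : V → Fin n) (g : G ≃g G) (j : Fin n) :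
    ∑ i, EE c g i j ≤ bd G c j := by
  unfold EE bd
  rw [sum_comm, ← Equiv.sum_comp g.toEquiv (fun u => ∑ v, ind (G.Adj u v ∧ c u = j ∧ c v ≠ j))]
  refine sum_le_sum fun x _ => ?_
  rw [sum_comm]
  refine le_of_le_of_eq ?_ (Equiv.sum_comp g.toEquiv _)
  refine sum_le_sum fun y _ => ?_
  have h1 : G.Adj (g x) (g y) ↔ G.Adj x y := g.map_adj_iff
  calc _ ≤ ∑ i, (if i = c x then ind (G.Adj x y ∧ c (g x) = j ∧ c (g y) ≠ j) else 0) := by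
        refine sum_le_sum fun i _ => ?_
        unfold ind; split_ifs <;> grind
    _ ≤ _ := by
        simp [h1]

/-- all crossing edges, ordered -/
theorem sum_bd {n : ℕ} (c : V → Fin n) :
    ∑ j, bd G c j = ∑ u, ∑ v, ind (G.Adj u v ∧ c v ≠ c u) := by
  unfold bd
  rw [sum_comm]
  refine sum_congr rfl fun x _ => ?_
  rw [sum_comm]
  refine sum_congr rfl fun y _ => ?_
  calc _ = ∑ i, (if i = c x then ind (G.Adj x y ∧ c y ≠ c x) else 0) := by
        refine sum_congr rfl fun i _ => ?_
        unfold ind; split_ifs <;> grind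
    _ = _ := by simp

theorem sum_WW_le {n : ℕ} (c : V → Fin n) (g : G ≃g G) :
    ∑ i, WW c g i ≤ ∑ j, bd G c j := by
  rw [sum_bd]
  unfold WW
  rw [sum_comm, ← Equiv.sum_comp g.toEquiv (fun u => ∑ v, ind (G.Adj u v ∧ c v ≠ c u))]
  refine sum_le_sum fun x _ => ?_
  rw [sum_comm]
  refine le_of_le_of_eq ?_ (Equiv.sum_comp g.toEquiv _)
  refine sum_le_sum fun y _ => ?_
  have h1 : G.Adj (g x) (g y) ↔ G.Adj x y := g.map_adj_iff
  calc _ ≤ ∑ i, (if i = c x then ind (G.Adj x y ∧ c (g y) ≠ c (g x)) else 0) := by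
        refine sum_le_sum fun i _ => ?_
        unfold ind; split_ifs <;> grind
    _ ≤ _ := by
        simp [h1]

theorem orbit_avg [Fintype (G ≃g G)] (ht : VertexTransitive G) (f : V → ℝ) (x : V) :
    (Fintype.card V : ℝ) * ∑ g : G ≃g G, f (g x) = Fintype.card (G ≃g G) * ∑ w, f w := by
  have h1 : ∀ y, ∑ g : G ≃g G, f (g y) = ∑ g : G ≃g G, f (g x) := by
    intro y
    obtain ⟨k, rfl⟩ := ht x y
    exact Equiv.sum_comp (Equiv.mulRight k) (fun g : G ≃g G => f (g x))
  have h2 : ∑ y, ∑ g : G ≃g G, f (g y) = ∑ y : V, ∑ g : G ≃g G, f (g x) :=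
    sum_congr rfl fun y _ => h1 y
  rw [sum_comm] at h2
  have h3 : ∀ g : G ≃g G, ∑ y, f (g y) = ∑ w, f w := fun g => Equiv.sum_comp g.toEquiv f
  simp only [h3, sum_const, card_univ, nsmul_eq_mul] at h2
  rw [h2]

/-- averaged: sum over points of colour i. -/
theorem orbit_avg_col [Fintype (G ≃g G)] (ht : VertexTransitive G) {n : ℕ} (c : V → Fin n)
    (f : V → ℝ) (i : Fin n) :
    (Fintype.card V : ℝ) * ∑ g : G ≃g G, ∑ x, ind (c x = i) * f (g x)
      = Fintype.card (G ≃g G) * (sz c i * ∑ w, f w) := by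
  rw [sum_comm, mul_sum]
  unfold sz
  rw [sum_mul, mul_sum]
  refine sum_congr rfl fun x _ => ?_
  rw [← mul_sum, mul_left_comm, orbit_avg ht]
  ring

theorem sum_g_SS [Fintype (G ≃g G)] (ht : VertexTransitive G) {n : ℕ} (c : V → Fin n)
    (i j : Fin n) :
    (Fintype.card V : ℝ) * ∑ g : G ≃g G, SS c g i j
      = Fintype.card (G ≃g G) * (sz c i * sz c j) := by
  rw [show sz c j = ∑ w, ind (c w = j) from rfl, ← orbit_avg_col ht c (fun w => ind (c w = j))]
  congr 1
  refine sum_congr rfl fun g _ => sum_congr rfl fun x _ => ?_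
  unfold ind; split_ifs <;> grind

theorem sum_g_EE [Fintype (G ≃g G)] (ht : VertexTransitive G) {n : ℕ} (c : V → Fin n)
    (i j : Fin n) :
    (Fintype.card V : ℝ) * ∑ g : G ≃g G, EE c g i j
      ≤ Fintype.card (G ≃g G) * (sz c i * bd G c j) := by
  unfold bd
  rw [← orbit_avg_col ht c (fun u => ∑ v, ind (G.Adj u v ∧ c u = j ∧ c v ≠ j))]
  refine mul_le_mul_of_nonneg_left ?_ (by positivity)
  refine sum_le_sum fun g _ => sum_le_sum fun x _ => ?_
  rw [mul_sum]
  refine le_of_le_of_eq ?_ (Equiv.sum_comp g.toEquiv _)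
  refine sum_le_sum fun y _ => ?_
  have h1 : G.Adj (g x) (g y) ↔ G.Adj x y := g.map_adj_iff
  simp only [RelIso.coe_fn_toEquiv, h1]
  unfold ind; split_ifs <;> grind

theorem sum_g_WW [Fintype (G ≃g G)] (ht : VertexTransitive G) {n : ℕ} (c : V → Fin n)
    (i : Fin n) :
    (Fintype.card V : ℝ) * ∑ g : G ≃g G, WW c g i
      ≤ Fintype.card (G ≃g G) * (sz c i * ∑ j, bd G c j) := by
  rw [sum_bd, ← orbit_avg_col ht c (fun u => ∑ v, ind (G.Adj u v ∧ c v ≠ c u))]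
  refine mul_le_mul_of_nonneg_left ?_ (by positivity)
  refine sum_le_sum fun g _ => sum_le_sum fun x _ => ?_
  rw [mul_sum]
  refine le_of_le_of_eq ?_ (Equiv.sum_comp g.toEquiv _)
  refine sum_le_sum fun y _ => ?_
  have h1 : G.Adj (g x) (g y) ↔ G.Adj x y := g.map_adj_iff
  simp only [RelIso.coe_fn_toEquiv, h1]
  unfold ind; split_ifs <;> grind

/-- splitting one class -/
theorem split_bound {n : ℕ} (c : V → Fin n) (hc : Function.Surjective c) (h H : ℝ)
    (hh : h < H) (h1 : ∀ i, bd G c i ≤ h * sz c i)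
    (h2 : ∀ C : V → Fin (n + 1), Function.Surjective C → ∃ i, H * sz C i ≤ bd G C i)
    (g : G ≃g G) (i j : Fin n) :
    H * SS c g i j ≤ h * sz c i + EE c g i j ∨ H * RR c g i j ≤ h * sz c i + EE c g i j := by
  have hb := bd_nonneg (G := G) c i
  have h1i := h1 i
  have hE := EE_nonneg c g i j
  by_cases hS : ∃ x, c x = i ∧ c (g x) = j
  swap
  · left
    have : SS c g i j = 0 := by
      unfold SS
      refine sum_eq_zero fun x _ => ?_
      have := not_exists.1 hS x
      simp [ind, this]
    rw [this]; linarith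
  by_cases hR : ∃ x, c x = i ∧ c (g x) ≠ j
  swap
  · right
    have : RR c g i j = 0 := by
      unfold RR
      refine sum_eq_zero fun x _ => ?_
      have := not_exists.1 hR x
      simp only [ind, this, if_false]
    rw [this]; linarith
  set C : V → Fin (n + 1) := fun x => if c x = i ∧ c (g x) = j then Fin.last n else (c x).castSucc
    with hC
  have hlast : ∀ x, C x = Fin.last n ↔ c x = i ∧ c (g x) = j := by
    intro x
    by_cases hx : c x = i ∧ c (g x) = j
    · simp [hC, hx]
    · simp only [hC, hx, if_false, iff_false]
      exact Fin.castSucc_ne_last _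
  have hcast : ∀ x k, C x = Fin.castSucc k ↔ c x = k ∧ ¬ (c x = i ∧ c (g x) = j) := by
    intro x k
    by_cases hx : c x = i ∧ c (g x) = j
    · simp only [hC, hx]
      simp [Ne.symm (Fin.castSucc_ne_last k)]
    · simp only [hC, hx, if_false]
      simp
  have hCs : Function.Surjective C := by
    intro k
    refine Fin.lastCases ?_ (fun k => ?_) k
    · obtain ⟨x, hx⟩ := hS
      exact ⟨x, (hlast x).2 hx⟩
    · by_cases hk : k = i
      · obtain ⟨x, hx⟩ := hR
        exact ⟨x, (hcast x k).2 (by grind)⟩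
      · obtain ⟨x, hx⟩ := hc k
        exact ⟨x, (hcast x k).2 (by grind)⟩
  obtain ⟨k, hk⟩ := h2 C hCs
  revert hk
  refine Fin.lastCases (fun hk => ?_) (fun k hk => ?_) k
  · left
    have e1 : sz C (Fin.last n) = SS c g i j := by
      unfold sz SS; simp only [hlast]
    have e2 : bd G C (Fin.last n) ≤ bd G c i + EE c g i j := by
      unfold bd EE
      rw [← sum_add_distrib]
      refine sum_le_sum fun x _ => ?_
      rw [← sum_add_distrib]
      refine sum_le_sum fun y _ => ?_
      simp only [ne_eq, hlast]
      unfold ind; split_ifs <;> grind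
    rw [e1] at hk; linarith
  · by_cases hki : k = i
    · right
      subst hki
      have e1 : sz C (Fin.castSucc k) = RR c g k j := by
        unfold sz RR
        refine sum_congr rfl fun x _ => ?_
        congr 1
        rw [hcast]; grind
      have e2 : bd G C (Fin.castSucc k) ≤ bd G c k + EE c g k j := by
        rw [EE_swap]
        unfold bd
        rw [← sum_add_distrib]
        refine sum_le_sum fun x _ => ?_
        rw [← sum_add_distrib]
        refine sum_le_sum fun y _ => ?_
        simp only [ne_eq, hcast]
        unfold ind; split_ifs <;> grind
      rw [e1] at hk; linarith
    · exfalso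
      have e0 : ∀ x, C x = Fin.castSucc k ↔ c x = k := by
        intro x; rw [hcast]; grind
      have e1 : sz C (Fin.castSucc k) = sz c k := by
        unfold sz; simp only [e0]
      have e2 : bd G C (Fin.castSucc k) = bd G c k := by
        unfold bd; simp only [ne_eq, e0]
      have := sz_pos c k (hc k)
      have := h1 k
      rw [e1, e2] at hk
      nlinarith

/-- adding a translate -/
theorem translate_bound {n : ℕ} (c : V → Fin n) (hc : Function.Surjective c) (h H : ℝ)
    (hh : h < H) (h1 : ∀ i, bd G c i ≤ h * sz c i)
    (h2 : ∀ C : V → Fin (n + 1), Function.Surjective C → ∃ i, H * sz C i ≤ bd G C i)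
    (hh0 : 0 ≤ h) (g : G ≃g G) (j : Fin n) :
    ∃ i, (H - h) * sz c i ≤ EE c g i j + H * SS c g i j := by
  by_cases hR : ∃ i, ∀ x, c x = i → c (g x) = j
  · obtain ⟨i, hi⟩ := hR
    refine ⟨i, ?_⟩
    have : RR c g i j = 0 := by
      unfold RR
      refine sum_eq_zero fun x _ => ?_
      have : ¬ (c x = i ∧ c (g x) ≠ j) := by have := hi x; tauto
      simp only [ind, this, if_false]
    have h3 := SS_add_RR c g i j
    have hE := EE_nonneg c g i j
    have := sz_pos c i (hc i)
    have : SS c g i j = sz c i := by linarith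
    rw [this]; nlinarith
  push Not at hR
  set C : V → Fin (n + 1) := fun x => if c (g x) = j then Fin.last n else (c x).castSucc
    with hC
  have hlast : ∀ x, C x = Fin.last n ↔ c (g x) = j := by
    intro x
    by_cases hx : c (g x) = j
    · simp [hC, hx]
    · simp only [hC, hx, if_false, iff_false]
      exact Fin.castSucc_ne_last _
  have hcast : ∀ x k, C x = Fin.castSucc k ↔ c x = k ∧ c (g x) ≠ j := by
    intro x k
    by_cases hx : c (g x) = j
    · simp only [hC, hx, if_true]
      simp [Ne.symm (Fin.castSucc_ne_last k)]
    · simp only [hC, hx, if_false]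
      simp [hx]
  have hCs : Function.Surjective C := by
    intro k
    refine Fin.lastCases ?_ (fun k => ?_) k
    · obtain ⟨x, hx⟩ := hc j
      exact ⟨g.symm x, (hlast _).2 (by simpa using hx)⟩
    · obtain ⟨x, hx⟩ := hR k
      exact ⟨x, (hcast x k).2 hx⟩
  obtain ⟨k, hk⟩ := h2 C hCs
  revert hk
  refine Fin.lastCases (fun hk => ?_) (fun k hk => ?_) k
  · exfalso
    have e1 : sz C (Fin.last n) = sz c j := by
      unfold sz; simp only [hlast]
      exact Equiv.sum_comp g.toEquiv (fun x => ind (c x = j))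
    have e2 : bd G C (Fin.last n) = bd G c j := by
      unfold bd
      simp only [ne_eq, hlast]
      rw [← Equiv.sum_comp g.toEquiv (fun u => ∑ v, ind (G.Adj u v ∧ c u = j ∧ ¬ c v = j))]
      refine sum_congr rfl fun x _ => ?_
      rw [← Equiv.sum_comp g.toEquiv (fun v => ind (G.Adj _ v ∧ _ ∧ ¬ c v = j))]
      refine sum_congr rfl fun y _ => ?_
      have h1 : G.Adj (g x) (g y) ↔ G.Adj x y := g.map_adj_iff
      simp [h1]
    have := sz_pos c j (hc j)
    have := h1 j
    rw [e1, e2] at hk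
    nlinarith
  · refine ⟨k, ?_⟩
    have e1 : sz C (Fin.castSucc k) = RR c g k j := by
      unfold sz RR
      simp only [hcast]
    have e2 : bd G C (Fin.castSucc k) ≤ bd G c k + EE c g k j := by
      rw [EE_swap]
      unfold bd
      rw [← sum_add_distrib]
      refine sum_le_sum fun x _ => ?_
      rw [← sum_add_distrib]
      refine sum_le_sum fun y _ => ?_
      simp only [ne_eq, hcast]
      unfold ind; split_ifs <;> grind
    have h3 := SS_add_RR c g k j
    have := h1 k
    rw [e1] at hk
    have : RR c g k j = sz c k - SS c g k j := by linarith
    rw [this] at hk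
    linarith


theorem size_lower [Fintype (G ≃g G)] (ht : VertexTransitive G) {n : ℕ} (c : V → Fin n)
    (hc : Function.Surjective c) (h H : ℝ)
    (hh : h < H) (h1 : ∀ i, bd G c i ≤ h * sz c i)
    (h2 : ∀ C : V → Fin (n + 1), Function.Surjective C → ∃ i, H * sz C i ≤ bd G C i)
    (hh0 : 0 ≤ h) (j : Fin n) :
    (H - h) * Fintype.card V ≤ n * (H + h) * sz c j := by
  have hG : (0 : ℝ) < Fintype.card (G ≃g G) := by exact_mod_cast Fintype.card_pos_iff.2 ⟨1⟩
  have hsz : ∀ i, 0 < sz c i := fun i => sz_pos c i (hc i)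
  have a1 : ∀ g : G ≃g G, H - h ≤ ∑ i, (EE c g i j + H * SS c g i j) / sz c i := by
    intro g
    obtain ⟨i, hi⟩ := translate_bound c hc h H hh h1 h2 hh0 g j
    have hnn : ∀ i, 0 ≤ (EE c g i j + H * SS c g i j) / sz c i := fun i => by
      have := EE_nonneg c g i j
      have := SS_nonneg c g i j
      have := hsz i
      have : 0 < H := by linarith
      positivity
    calc H - h ≤ (EE c g i j + H * SS c g i j) / sz c i := by
          rw [le_div_iff₀ (hsz i)]; exact hi
      _ ≤ _ := single_le_sum (f := fun i => (EE c g i j + H * SS c g i j) / sz c i)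
          (fun i _ => hnn i) (mem_univ i)
  have a2 : (Fintype.card (G ≃g G) : ℝ) * (H - h)
      ≤ ∑ g : G ≃g G, ∑ i, (EE c g i j + H * SS c g i j) / sz c i := by
    have := sum_le_sum (fun g (_ : g ∈ (univ : Finset (G ≃g G))) => a1 g)
    rwa [sum_const, card_univ, nsmul_eq_mul] at this
  rw [sum_comm] at a2
  have a3 : ∀ i, (Fintype.card V : ℝ) * ∑ g : G ≃g G, (EE c g i j + H * SS c g i j) / sz c i
      ≤ Fintype.card (G ≃g G) * ((H + h) * sz c j) := by
    intro i
    rw [← sum_div, ← mul_div_assoc, div_le_iff₀ (hsz i), sum_add_distrib, ← mul_sum]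
    have e1 := sum_g_EE ht c i j
    have e2 := sum_g_SS ht c i j
    have e3 : (Fintype.card (G ≃g G) : ℝ) * (sz c i * bd G c j)
        ≤ Fintype.card (G ≃g G) * (sz c i * (h * sz c j)) :=
      mul_le_mul_of_nonneg_left (mul_le_mul_of_nonneg_left (h1 j) (hsz i).le) hG.le
    have : (Fintype.card V : ℝ) * (∑ g : G ≃g G, EE c g i j + H * ∑ g : G ≃g G, SS c g i j)
      = (Fintype.card V : ℝ) * ∑ g : G ≃g G, EE c g i j +
        H * ((Fintype.card V : ℝ) * ∑ g : G ≃g G, SS c g i j) := by ring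
    rw [this, e2]
    linarith
  have a4 := sum_le_sum (fun i (_ : i ∈ (univ : Finset (Fin n))) => a3 i)
  rw [← mul_sum] at a4
  simp only [sum_const, card_univ, Fintype.card_fin, nsmul_eq_mul] at a4
  have a5 := mul_le_mul_of_nonneg_left a2 (Nat.cast_nonneg (α := ℝ) (Fintype.card V))
  have a6 : (Fintype.card (G ≃g G) : ℝ) * ((H - h) * Fintype.card V)
      ≤ Fintype.card (G ≃g G) * (n * (H + h) * sz c j) := by linarith
  exact le_of_mul_le_mul_left a6 hG

theorem majority {n : ℕ} (hn : 2 ≤ n) (c : V → Fin n)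
    (hc : Function.Surjective c) (h H : ℝ) (hh0 : 0 ≤ h) (hgap : 2 * (n + 1) * h < H)
    (h1 : ∀ i, bd G c i ≤ h * sz c i)
    (h2 : ∀ C : V → Fin (n + 1), Function.Surjective C → ∃ i, H * sz C i ≤ bd G C i)
    (hlow : ∀ j, (H - h) * Fintype.card V ≤ n * (H + h) * sz c j)
    (g : G ≃g G) (j : Fin n) : ∃ i, sz c i < 2 * SS c g i j := by
  by_contra hcon
  push Not at hcon
  have hn' : (2 : ℝ) ≤ n := by exact_mod_cast hn
  have hh : h < H := by nlinarith
  have hH : 0 < H := by linarith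
  have hV : (0 : ℝ) < Fintype.card V := by
    obtain ⟨x, _⟩ := hc j
    exact_mod_cast Fintype.card_pos_iff.2 ⟨x⟩
  have a1 : ∀ i, H * SS c g i j ≤ h * sz c i + EE c g i j := by
    intro i
    rcases split_bound c hc h H hh h1 h2 g i j with h3 | h3
    · exact h3
    · have := SS_add_RR c g i j
      have := hcon i
      have : SS c g i j ≤ RR c g i j := by linarith
      nlinarith
  have a2 := sum_le_sum (fun i (_ : i ∈ (univ : Finset (Fin n))) => a1 i)
  rw [← mul_sum, sum_add_distrib, ← mul_sum, sum_SS, sum_sz] at a2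
  have a3 := sum_EE_le c g j
  have a4 := h1 j
  have a5 := hlow j
  have a6 : (H - h) * sz c j ≤ h * Fintype.card V := by linarith
  have a7 : (H - h) * ((H - h) * Fintype.card V) ≤ n * (H + h) * (h * Fintype.card V) := by
    calc _ ≤ (H - h) * (n * (H + h) * sz c j) :=
          mul_le_mul_of_nonneg_left a5 (by linarith)
      _ = n * (H + h) * ((H - h) * sz c j) := by ring
      _ ≤ _ := mul_le_mul_of_nonneg_left a6 (by positivity)
  have a8 : (H - h) * (H - h) ≤ n * (H + h) * h := by
    refine le_of_mul_le_mul_right ?_ hV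
    linarith
  have b1 : (n : ℝ) * h ≤ (H - 2 * h) / 2 := by linarith
  have b2 : n * (H + h) * h ≤ (H + h) * ((H - 2 * h) / 2) := by
    calc _ = (H + h) * (n * h) := by ring
      _ ≤ _ := mul_le_mul_of_nonneg_left b1 (by linarith)
  have b3 : 6 * h ≤ H := by nlinarith
  nlinarith

theorem exists_perm {n : ℕ} (c : V → Fin n) (g : G ≃g G)
    (hm : ∀ j, ∃ i, sz c i < 2 * SS c g i j) :
    ∃ σ : Equiv.Perm (Fin n), ∀ i, sz c i < 2 * SS c g i (σ i) := by
  choose f hf using hm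
  have hinj : Function.Injective f := by
    intro j j' hjj
    by_contra hne
    have h1 := hf j
    have h2 := hf j'
    rw [← hjj] at h2
    have : SS c g (f j) j + SS c g (f j) j' ≤ sz c (f j) := by
      unfold SS sz
      rw [← sum_add_distrib]
      refine sum_le_sum fun x _ => ?_
      unfold ind; split_ifs <;> grind
    linarith
  have hbij : Function.Bijective f := Finite.injective_iff_bijective.1 hinj
  refine ⟨(Equiv.ofBijective f hbij).symm, fun i => ?_⟩
  have := hf ((Equiv.ofBijective f hbij).symm i)
  rwa [show f ((Equiv.ofBijective f hbij).symm i) = i from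
    (Equiv.ofBijective f hbij).apply_symm_apply i] at this

theorem RR_bound {n : ℕ} (c : V → Fin n)
    (hc : Function.Surjective c) (h H : ℝ) (hh : h < H) (hH : 0 < H)
    (h1 : ∀ i, bd G c i ≤ h * sz c i)
    (h2 : ∀ C : V → Fin (n + 1), Function.Surjective C → ∃ i, H * sz C i ≤ bd G C i)
    (g : G ≃g G) (i j : Fin n) (hm : sz c i < 2 * SS c g i j) :
    H * RR c g i j ≤ h * sz c i + WW c g i / 2 := by
  have := two_EE_le c g i j
  have := SS_add_RR c g i j
  rcases split_bound c hc h H hh h1 h2 g i j with h3 | h3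
  · have : RR c g i j ≤ SS c g i j := by linarith
    nlinarith
  · linarith

theorem hom_bad {n : ℕ} (c : V → Fin n) (g g' : G ≃g G) (i j k l : Fin n) (hkl : k ≠ l) :
    sz c i ≤ RR c g' i j + RR c (g * g') i k + RR c g j l := by
  have : RR c g j l = ∑ x, ind (c (g' x) = j ∧ c (g (g' x)) ≠ l) := by
    unfold RR
    exact (Equiv.sum_comp g'.toEquiv (fun x => ind (c x = j ∧ c (g x) ≠ l))).symm
  rw [this]
  unfold sz RR
  rw [← sum_add_distrib, ← sum_add_distrib]
  refine sum_le_sum fun x _ => ?_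
  have : (g * g') x = g (g' x) := rfl
  rw [this]
  unfold ind; split_ifs <;> grind

theorem hom_eq {n : ℕ} (hn : 2 ≤ n) (c : V → Fin n)
    (hc : Function.Surjective c) (h H : ℝ) (hh0 : 0 ≤ h) (hgap : 2 * (n + 1) * h < H)
    (h1 : ∀ i, bd G c i ≤ h * sz c i)
    (hlow : ∀ j, (H - h) * Fintype.card V ≤ n * (H + h) * sz c j)
    (σ : (G ≃g G) → Equiv.Perm (Fin n))
    (hσ : ∀ g i, H * RR c g i (σ g i) ≤ h * sz c i + WW c g i / 2)
    (g g' : G ≃g G) : σ (g * g') = σ g * σ g' := by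
  by_contra hne
  have hn' : (2 : ℝ) ≤ n := by exact_mod_cast hn
  have hh : h < H := by nlinarith
  have hH : 0 < H := by linarith
  have hV : (0 : ℝ) < Fintype.card V := by
    obtain ⟨x, _⟩ := hc ⟨0, by omega⟩
    exact_mod_cast Fintype.card_pos_iff.2 ⟨x⟩
  have hsz : ∀ i, 0 < sz c i := fun i => sz_pos c i (hc i)
  have hW0 : ∀ g i, 0 ≤ WW (G := G) c g i := fun g i =>
    sum_nonneg fun _ _ => sum_nonneg fun _ _ => ind_nonneg _
  have hB : ∑ j, bd G c j ≤ h * Fintype.card V := by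
    rw [← sum_sz c, mul_sum]
    exact sum_le_sum fun i _ => h1 i
  have hW : ∀ g : G ≃g G, ∑ i, WW c g i ≤ h * Fintype.card V := fun g =>
    (sum_WW_le c g).trans hB
  set L : Finset (Fin n) := univ.filter fun i => σ (g * g') i ≠ σ g (σ g' i) with hL
  have hWL : ∀ g : G ≃g G, ∑ i ∈ L, WW c g i ≤ h * Fintype.card V := fun g =>
    (sum_le_univ_sum_of_nonneg (fun i => hW0 g i)).trans (hW g)
  -- two bad elements
  obtain ⟨i0, hi0⟩ : ∃ i, σ (g * g') i ≠ σ g (σ g' i) := by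
    by_contra hcon
    push Not at hcon
    exact hne (Equiv.ext hcon)
  have hcard : 2 ≤ L.card := by
    set i1 := (σ (g * g')).symm (σ g (σ g' i0)) with hi1
    have e1 : σ (g * g') i1 = σ g (σ g' i0) := by simp [hi1]
    have e2 : i1 ≠ i0 := by
      intro e; rw [e] at e1; exact hi0 e1
    have e3 : σ (g * g') i1 ≠ σ g (σ g' i1) := by
      rw [e1]
      intro e
      exact e2 ((σ g').injective ((σ g).injective e)).symm
    have : ({i1, i0} : Finset (Fin n)) ⊆ L := by
      intro x hx
      simp only [mem_insert, mem_singleton] at hx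
      rcases hx with rfl | rfl
      · simp [hL, e3]
      · simp [hL, hi0]
    calc 2 = ({i1, i0} : Finset (Fin n)).card := (card_pair e2).symm
      _ ≤ _ := card_le_card this
  set X := ∑ i ∈ L, sz c i with hX
  have hXlow : 2 * ((H - h) * Fintype.card V) ≤ n * (H + h) * X := by
    have := sum_le_sum (fun i (_ : i ∈ L) => hlow i)
    rw [sum_const, nsmul_eq_mul, ← mul_sum] at this
    have h3 : (2 : ℝ) ≤ L.card := by exact_mod_cast hcard
    have h4 : 0 ≤ (H - h) * Fintype.card V := mul_nonneg (by linarith) hV.le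
    nlinarith
  have t1 : ∀ k : G ≃g G, H * ∑ i ∈ L, RR c k i (σ k i) ≤ h * X + h * Fintype.card V / 2 := by
    intro k
    have := sum_le_sum (fun i (_ : i ∈ L) => hσ k i)
    rw [← mul_sum, sum_add_distrib, ← mul_sum, ← sum_div] at this
    have := hWL k
    linarith
  have t2 : H * ∑ i ∈ L, RR c g (σ g' i) (σ g (σ g' i))
      ≤ h * Fintype.card V + h * Fintype.card V / 2 := by
    have e1 : ∑ i ∈ L, RR c g (σ g' i) (σ g (σ g' i)) ≤ ∑ i, RR c g i (σ g i) := by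
      rw [← Equiv.sum_comp (σ g') (fun i => RR c g i (σ g i))]
      exact sum_le_univ_sum_of_nonneg (fun i => RR_nonneg c g _ _)
    have := sum_le_sum (fun i (_ : i ∈ (univ : Finset (Fin n))) => hσ g i)
    rw [← mul_sum, sum_add_distrib, ← mul_sum, ← sum_div, sum_sz] at this
    have := hW g
    have := mul_le_mul_of_nonneg_left e1 hH.le
    linarith
  have t3 : X ≤ ∑ i ∈ L, RR c g' i (σ g' i) + ∑ i ∈ L, RR c (g * g') i (σ (g * g') i)
      + ∑ i ∈ L, RR c g (σ g' i) (σ g (σ g' i)) := by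
    rw [← sum_add_distrib, ← sum_add_distrib]
    refine sum_le_sum fun i hi => ?_
    exact hom_bad c g g' i _ _ _ (by simpa [hL] using hi)
  have t4 := mul_le_mul_of_nonneg_left t3 hH.le
  have t5 := t1 g'
  have t6 := t1 (g * g')
  have t7 : (H - 2 * h) * X ≤ 5 / 2 * (h * Fintype.card V) := by linarith
  have b3 : 6 * h ≤ H := by nlinarith
  have t8 : (H - 2 * h) * (2 * ((H - h) * Fintype.card V))
      ≤ n * (H + h) * (5 / 2 * (h * Fintype.card V)) := by
    calc _ ≤ (H - 2 * h) * (n * (H + h) * X) :=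
          mul_le_mul_of_nonneg_left hXlow (by linarith)
      _ = n * (H + h) * ((H - 2 * h) * X) := by ring
      _ ≤ _ := mul_le_mul_of_nonneg_left t7 (by positivity)
  have t9 : (H - 2 * h) * (2 * (H - h)) ≤ n * (H + h) * (5 / 2 * h) := by
    refine le_of_mul_le_mul_right ?_ hV
    linarith
  have b1 : (n : ℝ) * h ≤ (H - 2 * h) / 2 := by linarith
  have b2 : n * (H + h) * (5 / 2 * h) ≤ (H + h) * (5 / 2 * ((H - 2 * h) / 2)) := by
    calc _ = (H + h) * (5 / 2 * (n * h)) := by ring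
      _ ≤ _ := mul_le_mul_of_nonneg_left (by linarith) (by linarith)
  -- (H-2h) * (2(H-h) - 5/4 (H+h)) ≤ 0 is impossible
  have : (0 : ℝ) < (H - 2 * h) * (3 / 4 * H - 13 / 4 * h) :=
    mul_pos (by linarith) (by linarith)
  nlinarith

theorem core_thm (ht : VertexTransitive G) {n : ℕ} (hn : 2 ≤ n) (c : V → Fin n)
    (hc : Function.Surjective c) (h H : ℝ) (hh0 : 0 ≤ h) (hgap : 2 * (n + 1) * h < H)
    (h1 : ∀ i, bd G c i ≤ h * sz c i)
    (h2 : ∀ C : V → Fin (n + 1), Function.Surjective C → ∃ i, H * sz C i ≤ bd G C i) :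
    ∃ b : V → Fin n, Function.Surjective b ∧
      (∀ g : G ≃g G, ∃ σ : Equiv.Perm (Fin n), ∀ x, b (g x) = σ (b x)) ∧
      ∑ x, ind (b x ≠ c x) ≤ 4 * h / H * Fintype.card V := by
  have : Finite (G ≃g G) := Finite.of_injective (fun g : G ≃g G => g.toEquiv)
    RelIso.toEquiv_injective
  have : Fintype (G ≃g G) := Fintype.ofFinite _
  have hG : (0 : ℝ) < Fintype.card (G ≃g G) := by exact_mod_cast Fintype.card_pos_iff.2 ⟨1⟩
  have hn' : (2 : ℝ) ≤ n := by exact_mod_cast hn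
  have hh : h < H := by nlinarith
  have hH : 0 < H := by linarith
  have b3 : 6 * h < H := by nlinarith
  have hV : (0 : ℝ) < Fintype.card V := by
    obtain ⟨x, _⟩ := hc ⟨0, by omega⟩
    exact_mod_cast Fintype.card_pos_iff.2 ⟨x⟩
  have hsz : ∀ i, 0 < sz c i := fun i => sz_pos c i (hc i)
  have hlow := size_lower ht c hc h H hh h1 h2 hh0
  have hp := fun g : G ≃g G => exists_perm c g (majority hn c hc h H hh0 hgap h1 h2 hlow g)
  choose σ hσ using hp
  have hσ' := fun g i => RR_bound c hc h H hh hH h1 h2 g i _ (hσ g i)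
  have hhom := hom_eq hn c hc h H hh0 hgap h1 hlow σ hσ'
  have hB : ∑ j, bd G c j ≤ h * Fintype.card V := by
    rw [← sum_sz c, mul_sum]
    exact sum_le_sum fun i _ => h1 i
  set N : ℝ := (Fintype.card (G ≃g G) : ℝ) with hN
  -- averaged error
  have havg : ∀ i, H * ∑ g : G ≃g G, RR c g i (σ g i) ≤ N * (3 / 2 * h * sz c i) := by
    intro i
    have e1 := sum_le_sum (fun g (_ : g ∈ (univ : Finset (G ≃g G))) => hσ' g i)
    rw [← mul_sum, sum_add_distrib, ← sum_div] at e1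
    simp only [sum_const, card_univ, nsmul_eq_mul] at e1
    have e2 := sum_g_WW ht c i
    have e3 : N * (sz c i * ∑ j, bd G c j) ≤ N * (sz c i * (h * Fintype.card V)) :=
      mul_le_mul_of_nonneg_left (mul_le_mul_of_nonneg_left hB (hsz i).le) hG.le
    have e4 : ∑ g : G ≃g G, WW c g i ≤ N * (sz c i * h) := by
      refine le_of_mul_le_mul_left ?_ hV
      linarith
    linarith
  set Q : Fin n → V → ℝ := fun i x => ∑ g : G ≃g G, ind (c (g x) = σ g i) with hQ
  have hQinv : ∀ k i x, Q (σ k i) (k x) = Q i x := by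
    intro k i x
    simp only [hQ]
    rw [← Equiv.sum_comp (Equiv.mulRight k) (fun g : G ≃g G => ind (c (g x) = σ g i))]
    refine sum_congr rfl fun g _ => ?_
    simp only [Equiv.coe_mulRight, hhom]
    rfl
  have hQuniq : ∀ i i' x, N < 2 * Q i x → N < 2 * Q i' x → i = i' := by
    intro i i' x ha hb
    by_contra hne
    have : Q i x + Q i' x ≤ N := by
      simp only [hQ]
      rw [← sum_add_distrib]
      calc _ ≤ ∑ g : G ≃g G, (1 : ℝ) := by
            refine sum_le_sum fun g _ => ?_
            have : σ g i ≠ σ g i' := fun e => hne ((σ g).injective e)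
            unfold ind; split_ifs <;> grind
        _ = N := by simp [hN]
    linarith
  have hRQ : ∀ i, ∑ g : G ≃g G, RR c g i (σ g i) = ∑ x, ind (c x = i) * (N - Q i x) := by
    intro i
    unfold RR
    rw [sum_comm]
    refine sum_congr rfl fun x _ => ?_
    have : N - Q i x = ∑ g : G ≃g G, (1 - ind (c (g x) = σ g i)) := by
      rw [sum_sub_distrib]; simp [hN, hQ]
    rw [this, mul_sum]
    refine sum_congr rfl fun g _ => ?_
    unfold ind; split_ifs <;> grind
  have hQle : ∀ i x, Q i x ≤ N := by
    intro i x
    calc _ ≤ ∑ g : G ≃g G, (1 : ℝ) := by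
          refine sum_le_sum fun g _ => ?_
          unfold ind; split_ifs <;> norm_num
      _ = N := by simp [hN]
  have hbad : ∀ i, H * ∑ x, ind (c x = i ∧ ¬ (N < 2 * Q i x)) ≤ 3 * h * sz c i := by
    intro i
    have e1 := havg i
    rw [hRQ] at e1
    have e2 : N / 2 * ∑ x, ind (c x = i ∧ ¬ (N < 2 * Q i x))
        ≤ ∑ x, ind (c x = i) * (N - Q i x) := by
      rw [mul_sum]
      refine sum_le_sum fun x _ => ?_
      have := hQle i x
      by_cases hx : c x = i
      · by_cases hy : N < 2 * Q i x
        · simp [ind, hx, hy, this]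
        · simp only [ind, hx, hy]
          simp
          linarith
      · simp [ind, hx]
    have e3 := mul_le_mul_of_nonneg_left e2 hH.le
    refine le_of_mul_le_mul_left ?_ hG
    linarith
  have hne : ∀ i, ∃ x, N < 2 * Q i x := by
    intro i
    by_contra hcon
    have hcon' : ∀ x, ¬ N < 2 * Q i x := not_exists.1 hcon
    have e1 := hbad i
    have e2 : ∑ x, ind (c x = i ∧ ¬ (N < 2 * Q i x)) = sz c i := by
      unfold sz
      refine sum_congr rfl fun x _ => ?_
      simp [hcon' x]
    rw [e2] at e1
    have := hsz i
    nlinarith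
  have hex : ∀ x, ∃ i, N < 2 * Q i x := by
    intro x
    obtain ⟨y, hy⟩ := hne ⟨0, by omega⟩
    obtain ⟨k, rfl⟩ := ht y x
    exact ⟨σ k ⟨0, by omega⟩, by rw [hQinv]; exact hy⟩
  choose b hb using hex
  have hbiff : ∀ i x, N < 2 * Q i x ↔ b x = i := fun i x =>
    ⟨fun hx => hQuniq _ _ x (hb x) hx, fun e => e ▸ hb x⟩
  refine ⟨b, ?_, ?_, ?_⟩
  · intro i
    obtain ⟨x, hx⟩ := hne i
    exact ⟨x, (hbiff i x).1 hx⟩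
  · intro g
    refine ⟨σ g, fun x => ?_⟩
    rw [← hbiff, hQinv]
    exact hb x
  · have e1 := sum_le_sum (fun i (_ : i ∈ (univ : Finset (Fin n))) => hbad i)
    rw [← mul_sum, ← mul_sum, sum_sz, sum_comm] at e1
    have e2 : ∑ x, ind (b x ≠ c x) = ∑ x, ∑ i, ind (c x = i ∧ ¬ (N < 2 * Q i x)) := by
      refine sum_congr rfl fun x _ => ?_
      rw [Finset.sum_eq_single (c x)]
      · simp [hbiff]
      · intro i _ hi
        simp [ind, Ne.symm hi]
      · simp
    rw [← e2] at e1
    rw [div_mul_eq_mul_div, le_div_iff₀ hH]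
    nlinarith


theorem ncard_eq_sum {W : Type*} [Fintype W] (p : W → Prop) :
    (({x | p x} : Set W).ncard : ℝ) = ∑ x, ind (p x) := by
  unfold ind
  rw [Finset.sum_boole, Set.ncard_eq_toFinset_card']
  congr 2
  ext x; simp

theorem ncard_eq_sz {α : Type*} (c : V → α) (i : α) :
    (({x | c x = i} : Set V).ncard : ℝ) = sz c i := ncard_eq_sum _

theorem ncard_eq_bd {α : Type*} (G : SimpleGraph V) (c : V → α) (i : α) :
    ((edgeBdry G {x | c x = i}).ncard : ℝ) = bd G c i := by
  have e1 : edgeBdry G {x | c x = i} =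
      (fun p : V × V => s(p.1, p.2)) '' {p | G.Adj p.1 p.2 ∧ c p.1 = i ∧ c p.2 ≠ i} := by
    ext e
    constructor
    · rintro ⟨he, u, v, rfl, hu, hv⟩
      exact ⟨(u, v), ⟨he, hu, hv⟩, rfl⟩
    · rintro ⟨⟨u, v⟩, ⟨he, hu, hv⟩, rfl⟩
      exact ⟨he, u, v, rfl, hu, hv⟩
  have e2 : Set.InjOn (fun p : V × V => s(p.1, p.2))
      {p | G.Adj p.1 p.2 ∧ c p.1 = i ∧ c p.2 ≠ i} := by
    rintro ⟨u, v⟩ ⟨_, hu, hv⟩ ⟨u', v'⟩ ⟨_, hu', hv'⟩ he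
    simp only [Sym2.eq_iff] at he
    rcases he with ⟨rfl, rfl⟩ | ⟨rfl, rfl⟩
    · rfl
    · exact absurd hu hv'
  rw [e1, e2.ncard_image, ncard_eq_sum]
  unfold bd
  rw [Fintype.sum_prod_type]

theorem part_of_col {n : ℕ} (c : V → Fin n) (hc : Function.Surjective c) :
    IsNPartition n (fun i => {x | c x = i}) := by
  refine ⟨fun i => hc i, fun i j hij => ?_, ?_⟩
  · rw [Set.disjoint_left]
    intro x hx hy
    exact hij (hx.symm.trans hy)
  · ext x; simp

theorem col_of_part {n : ℕ} (A : Fin n → Set V) (hA : IsNPartition n A) :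
    ∃ c : V → Fin n, Function.Surjective c ∧ A = fun i => {x | c x = i} := by
  obtain ⟨h1, h2, h3⟩ := hA
  have : ∀ x, ∃ i, x ∈ A i := fun x => by
    have : x ∈ ⋃ i, A i := h3 ▸ Set.mem_univ x
    simpa using this
  choose c hc using this
  have hiff : ∀ x i, x ∈ A i ↔ c x = i := by
    intro x i
    constructor
    · intro hx
      by_contra hne
      exact Set.disjoint_left.1 (h2 _ _ hne) (hc x) hx
    · rintro rfl; exact hc x
  refine ⟨c, fun i => ?_, ?_⟩
  · obtain ⟨x, hx⟩ := h1 i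
    exact ⟨x, (hiff x i).1 hx⟩
  · ext i x
    exact hiff x i

end core

theorem imprimitivity_from_h_gap {V : Type*} [Fintype V] (G : SimpleGraph V)
    (htrans : VertexTransitive G)
    (n : ℕ) (hn : 2 ≤ n) (hcard : n + 1 ≤ Fintype.card V)
    (hgap : multiH G (n + 1) > 2 * (n + 1) * multiH G n)
    (A : Fin n → Set V) (hA : IsNPartition n A)
    (hach : edgeRatioMax G A = multiH G n) :
    ∃ B : Fin n → Set V, IsNPartition n B ∧
      (∀ φ : G ≃g G, ∃ σ : Equiv.Perm (Fin n), ∀ i, ⇑φ '' B i = B (σ i)) ∧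
      (∀ i, ((symmDiff (B i) (A i)).ncard : ℝ)
          ≤ 4 * multiH G n / multiH G (n + 1) * Fintype.card V) := by
  classical
  obtain ⟨c, hc, rfl⟩ := col_of_part A hA
  have hn0 : 0 < n := by omega
  have : Nonempty (Fin n) := ⟨⟨0, hn0⟩⟩
  have hsz : ∀ i, 0 < sz c i := fun i => sz_pos c i (hc i)
  have h1 : ∀ i, bd G c i ≤ multiH G n * sz c i := by
    intro i
    rw [← hach, ← div_le_iff₀ (hsz i), ← ncard_eq_sz, ← ncard_eq_bd]
    exact le_ciSup (f := fun i => ((edgeBdry G {x | c x = i}).ncard : ℝ)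
      / (({x | c x = i} : Set V).ncard : ℝ)) (Set.finite_range _).bddAbove i
  have hh0 : 0 ≤ multiH G n := by
    have := h1 ⟨0, hn0⟩
    have h3 := bd_nonneg (G := G) c ⟨0, hn0⟩
    have h4 := hsz ⟨0, hn0⟩
    by_contra hneg
    push Not at hneg
    nlinarith
  have h2 : ∀ C : V → Fin (n + 1), Function.Surjective C →
      ∃ i, multiH G (n + 1) * sz C i ≤ bd G C i := by
    intro C hC
    have e1 : multiH G (n + 1) ≤ edgeRatioMax G (fun i => {x | C x = i}) := by
      refine csInf_le ⟨0, ?_⟩ ⟨_, part_of_col C hC, rfl⟩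
      rintro r ⟨B, _, rfl⟩
      exact Real.iSup_nonneg fun i => by positivity
    obtain ⟨i, hi⟩ := exists_eq_ciSup_of_finite
      (f := fun i => ((edgeBdry G {x | C x = i}).ncard : ℝ)
        / (({x | C x = i} : Set V).ncard : ℝ))
    refine ⟨i, ?_⟩
    rw [← le_div_iff₀ (sz_pos C i (hC i)), ← ncard_eq_sz, ← ncard_eq_bd]
    exact e1.trans hi.ge
  obtain ⟨b, hb, hσ, hd⟩ := core_thm htrans hn c hc _ _ hh0 hgap h1 h2
  refine ⟨fun i => {x | b x = i}, part_of_col b hb, ?_, ?_⟩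
  · intro φ
    obtain ⟨σ, hs⟩ := hσ φ
    refine ⟨σ, fun i => ?_⟩
    ext y
    constructor
    · rintro ⟨x, hx, rfl⟩
      have hx' : b x = i := hx
      show b (φ x) = σ i
      rw [hs, hx']
    · intro hy
      have hy' : b y = σ i := hy
      refine ⟨φ.symm y, ?_, by simp⟩
      have := hs (φ.symm y)
      rw [RelIso.apply_symm_apply, hy'] at this
      exact (σ.injective this).symm
  · intro i
    refine le_trans ?_ hd
    have e1 : (({x | b x ≠ c x} : Set V).ncard : ℝ) = ∑ x, ind (b x ≠ c x) := ncard_eq_sum _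
    rw [← e1]
    refine Nat.cast_le.2 (Set.ncard_le_ncard ?_ (Set.toFinite _))
    intro x hx
    rw [Set.mem_symmDiff] at hx
    simp only [Set.mem_ofPred_eq] at hx ⊢
    rintro e
    rw [e] at hx
    tauto

end Multiway
end

section
/- Let Γ be a finite vertex-transitive graph (possibly disconnected) on vertex set V and let 2 ≤ n ≤ |V| − 1. Assume ι_{n+1}(Γ) > 2(n+1)·ι_n(Γ). Then for every partition V = A_1 ⊔ ⋯ ⊔ A_n into n non-empty sets achieving ι_n(Γ) (i.e., with max_{1≤i≤n} |δA_i|/|A_i| = ι_n(Γ)), there exists a partition V = V_1 ⊔ ⋯ ⊔ V_n into n non-empty sets such that: (a) (V_1,…,V_n) is a system of imprimitivity of size n for the action of Aut(Γ) on V, and (c) for every 1 ≤ i ≤ n, |V_i △ A_i| ≤ (4·ι_n(Γ)/ι_{n+1}(Γ))·|V|. -/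
open scoped Pointwise

namespace Multiway

variable {V : Type*}

section helpers
set_option linter.unusedSectionVars false
open Classical

variable {V : Type*} [Fintype V]

lemma ncard_eq_sum_s6 (S : Set V) [DecidablePred (· ∈ S)] : (S.ncard : ℝ) = ∑ x, if x ∈ S then (1:ℝ) else 0 := by
  rw [Set.ncard_eq_toFinset_card']
  simp

lemma vertBdry_image (G : SimpleGraph V) (φ : G ≃g G) (A : Set V) :
    vertBdry G (φ '' A) = φ '' vertBdry G A := by
  ext x
  constructor
  · rintro ⟨y, hxy, h⟩
    refine ⟨φ.symm x, ⟨φ.symm y, ?_, ?_⟩, by simp⟩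
    · exact (φ.symm.map_adj_iff).2 hxy
    · intro h'
      apply h
      constructor
      · rintro ⟨z, hz, rfl⟩
        exact ⟨φ.symm y, h'.1 (by simpa using hz), by simp⟩
      · rintro ⟨z, hz, rfl⟩
        exact ⟨φ.symm x, h'.2 (by simpa using hz), by simp⟩
  · rintro ⟨z, ⟨y, hxy, h⟩, rfl⟩
    refine ⟨φ y, (φ.map_adj_iff).2 hxy, ?_⟩
    simpa [φ.injective.mem_set_image] using h

lemma bdry_inter (G : SimpleGraph V) (X Y : Set V) :
    vertBdry G (X ∩ Y) ⊆ vertBdry G X ∪ vertBdry G Y := by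
  rintro x ⟨y, hxy, h⟩
  by_cases h1 : (x ∈ X ↔ y ∈ X)
  · right
    refine ⟨y, hxy, fun h2 => h ?_⟩
    simp only [Set.mem_inter_iff]; tauto
  · left; exact ⟨y, hxy, h1⟩

lemma bdry_diff (G : SimpleGraph V) (X Y : Set V) :
    vertBdry G (X \ Y) ⊆ vertBdry G X ∪ vertBdry G Y := by
  rintro x ⟨y, hxy, h⟩
  by_cases h1 : (x ∈ X ↔ y ∈ X)
  · right
    refine ⟨y, hxy, fun h2 => h ?_⟩
    simp only [Set.mem_sdiff]; tauto
  · left; exact ⟨y, hxy, h1⟩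

lemma bdry_inter' (G : SimpleGraph V) (X Y : Set V) :
    vertBdry G (X ∩ Y) ⊆ (vertBdry G X ∩ Y) ∪ ((X ∩ vertBdry G Y) ∪
      (vertBdry G X ∩ vertBdry G Y)) := by
  rintro x ⟨y, hxy, h⟩
  have hX : x ∉ vertBdry G X → (x ∈ X ↔ y ∈ X) := fun hx => by
    by_contra h'; exact hx ⟨y, hxy, h'⟩
  have hY : x ∉ vertBdry G Y → (x ∈ Y ↔ y ∈ Y) := fun hx => by
    by_contra h'; exact hx ⟨y, hxy, h'⟩
  simp only [Set.mem_inter_iff, Set.mem_union] at *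
  tauto

lemma ncard_bdry_inter (G : SimpleGraph V) (X Y : Set V) :
    ((vertBdry G (X ∩ Y)).ncard : ℝ) ≤ (vertBdry G X).ncard + (vertBdry G Y).ncard := by
  exact_mod_cast (Set.ncard_le_ncard (bdry_inter G X Y)).trans (Set.ncard_union_le _ _)

lemma ncard_bdry_diff (G : SimpleGraph V) (X Y : Set V) :
    ((vertBdry G (X \ Y)).ncard : ℝ) ≤ (vertBdry G X).ncard + (vertBdry G Y).ncard := by
  exact_mod_cast (Set.ncard_le_ncard (bdry_diff G X Y)).trans (Set.ncard_union_le _ _)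

lemma ratio_nonneg (G : SimpleGraph V) {n : ℕ} (A : Fin n → Set V) : 0 ≤ vertRatioMax G A :=
  Real.iSup_nonneg fun i => by positivity

lemma iota_le (G : SimpleGraph V) {n : ℕ} (A : Fin n → Set V) (hA : IsNPartition n A) :
    multiIota G n ≤ vertRatioMax G A := by
  apply csInf_le
  · exact ⟨0, by rintro r ⟨B, -, rfl⟩; exact ratio_nonneg G B⟩
  · exact ⟨A, hA, rfl⟩

lemma card_pos_of {n : ℕ} {A : Fin n → Set V} (hA : IsNPartition n A) (i : Fin n) :
    (0:ℝ) < (A i).ncard := by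
  exact_mod_cast (Set.ncard_pos).2 (hA.1 i)

lemma bdry_le (G : SimpleGraph V) {n : ℕ} (A : Fin n → Set V) (hA : IsNPartition n A)
    (i : Fin n) : ((vertBdry G (A i)).ncard : ℝ) ≤ vertRatioMax G A * (A i).ncard := by
  rw [← div_le_iff₀ (card_pos_of hA i)]
  exact le_ciSup (f := fun i => ((vertBdry G (A i)).ncard : ℝ) / ((A i).ncard : ℝ))
    (Set.finite_range _).bddAbove i

lemma exists_piece (G : SimpleGraph V) {n : ℕ} (A : Fin (n+1) → Set V)
    (hA : IsNPartition (n+1) A) :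
    ∃ k, multiIota G (n+1) * (A k).ncard ≤ (vertBdry G (A k)).ncard := by
  obtain ⟨k, hk⟩ := exists_eq_ciSup_of_finite
    (f := fun i => ((vertBdry G (A i)).ncard : ℝ) / ((A i).ncard : ℝ))
  refine ⟨k, ?_⟩
  rw [← le_div_iff₀ (card_pos_of hA k)]
  refine (iota_le G A hA).trans (le_of_eq ?_)
  exact hk.symm

lemma split (G : SimpleGraph V) {n : ℕ} (P : Fin n → Set V) (hP : IsNPartition n P)
    (hlt : ∀ k, ((vertBdry G (P k)).ncard : ℝ) < multiIota G (n+1) * (P k).ncard)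
    (i : Fin n) (T : Set V) :
    multiIota G (n+1) * (P i ∩ T).ncard ≤ (vertBdry G (P i ∩ T)).ncard ∨
    multiIota G (n+1) * (P i \ T).ncard ≤ (vertBdry G (P i \ T)).ncard := by
  rcases Set.eq_empty_or_nonempty (P i ∩ T) with h1 | h1
  · left; simp [h1]
  rcases Set.eq_empty_or_nonempty (P i \ T) with h2 | h2
  · right; simp [h2]
  have hsub : ∀ j, Function.update P i (P i \ T) j ⊆ P j := by
    intro j
    by_cases h : j = i
    · subst h; simp
    · simp [h]
  have key : ∀ j, Disjoint (P i ∩ T) (Function.update P i (P i \ T) j) := by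
    intro j
    by_cases h : j = i
    · subst h; simp only [Function.update_self]
      exact Set.disjoint_left.2 fun x hx hx' => hx'.2 hx.2
    · simp only [Function.update_of_ne h]
      exact (hP.2.1 i j (Ne.symm h)).mono_left Set.inter_subset_left
  have hpart : IsNPartition (n+1)
      (Fin.cons (P i ∩ T) (Function.update P i (P i \ T)) : Fin (n+1) → Set V) := by
    refine ⟨?_, ?_, ?_⟩
    · intro k
      refine Fin.cases ?_ ?_ k
      · simpa using h1
      · intro j
        by_cases h : j = i
        · subst h; simpa using h2
        · simpa [h] using hP.1 j
    · intro k l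
      refine Fin.cases ?_ ?_ k <;> refine Fin.cases ?_ ?_ l
      · simp
      · intro j _; simpa using key j
      · intro j _; simpa using (key j).symm
      · intro j j' h
        simp only [Fin.cons_succ]
        exact (hP.2.1 j' j (fun e => h (by rw [e]))).mono (hsub _) (hsub _)
    · rw [Set.eq_univ_iff_forall]
      intro x
      have hx : x ∈ ⋃ i, P i := by rw [hP.2.2]; trivial
      obtain ⟨j, hj⟩ := Set.mem_iUnion.1 hx
      rw [Set.mem_iUnion]
      by_cases h : j = i
      · subst h
        by_cases hT : x ∈ T
        · exact ⟨0, by simpa using ⟨hj, hT⟩⟩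
        · exact ⟨j.succ, by simpa using ⟨hj, hT⟩⟩
      · exact ⟨j.succ, by simpa [h] using hj⟩
  obtain ⟨k, hk⟩ := exists_piece G _ hpart
  revert hk
  refine Fin.cases ?_ ?_ k
  · intro hk; left; simpa using hk
  · intro j hk
    by_cases h : j = i
    · subst h; right; simpa using hk
    · simp only [Fin.cons_succ, Function.update_of_ne h] at hk
      exact absurd hk (not_le.2 (hlt j))

lemma image_partition {G : SimpleGraph V} {n : ℕ} {P : Fin n → Set V} (hP : IsNPartition n P)
    (φ : G ≃g G) : IsNPartition n (fun i => φ '' P i) := by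
  refine ⟨fun i => (hP.1 i).image _, fun i j h => ?_, ?_⟩
  · exact (Set.disjoint_image_iff φ.injective).2 (hP.2.1 i j h)
  · rw [← Set.image_iUnion, hP.2.2, Set.image_univ, φ.surjective.range_eq]

lemma iota_lt (G : SimpleGraph V) (n : ℕ) (h : n + 1 ≤ Fintype.card V) :
    multiIota G (n+1) < 2 * (n+1) := by
  obtain ⟨e⟩ : Nonempty (V ≃ Fin (Fintype.card V)) := ⟨Fintype.equivFin V⟩
  set N := Fintype.card V with hN
  set q := N / (n+1) with hq
  have hq1 : 1 ≤ q := (Nat.one_le_div_iff (Nat.succ_pos n)).2 h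
  have hqN : (n+1) * q ≤ N := Nat.mul_div_le N (n+1)
  have hqN' : N < (n+1) * (q+1) := Nat.lt_mul_div_succ N (Nat.succ_pos n)
  let P : Fin (n+1) → Set V := fun i => {x | (e x : ℕ) % (n+1) = i}
  have hcard : ∀ i, q ≤ (P i).ncard := by
    intro i
    have hb : ∀ k : Fin q, (i:ℕ) + (n+1) * k < N := by
      intro k
      have h1 := i.2
      have h2 := k.2
      calc (i:ℕ) + (n+1) * k < (n+1) + (n+1) * k := by omega
        _ = (n+1) * (k+1) := by ring
        _ ≤ (n+1) * q := Nat.mul_le_mul_left _ h2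
        _ ≤ N := hqN
    let f : Fin q → V := fun k => e.symm ⟨i + (n+1) * k, hb k⟩
    have hf : Function.Injective f := by
      intro k l hkl
      have := e.symm.injective hkl
      simp only [Fin.mk.injEq, Nat.add_left_cancel_iff] at this
      exact Fin.ext (Nat.eq_of_mul_eq_mul_left (Nat.succ_pos n) this)
    have : (Set.range f).ncard = q := by
      rw [← Set.image_univ, Set.ncard_image_of_injective _ hf]; simp
    rw [← this]
    refine Set.ncard_le_ncard ?_ (Set.toFinite _)
    rintro _ ⟨k, rfl⟩
    simp only [P, f, Set.mem_ofPred_eq, Equiv.apply_symm_apply, Nat.add_mul_mod_self_left]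
    exact Nat.mod_eq_of_lt i.2
  have hP : IsNPartition (n+1) P := by
    refine ⟨fun i => (Set.ncard_pos).1 (lt_of_lt_of_le hq1 (hcard i)), ?_, ?_⟩
    · intro i j hij
      exact Set.disjoint_left.2 fun x hx hx' => hij (Fin.ext (hx.symm.trans hx'))
    · rw [Set.eq_univ_iff_forall]
      intro x
      exact Set.mem_iUnion.2 ⟨⟨(e x : ℕ) % (n+1), Nat.mod_lt _ (Nat.succ_pos n)⟩, rfl⟩
  obtain ⟨k, hk⟩ := exists_piece G P hP
  have h1 : ((vertBdry G (P k)).ncard : ℝ) ≤ N := by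
    have := Set.ncard_le_ncard (Set.subset_univ (vertBdry G (P k)))
    rw [Set.ncard_univ, Nat.card_eq_fintype_card] at this
    exact_mod_cast this
  have h2 : (N:ℝ) < 2 * (n+1) * q := by
    have : N < 2 * (n+1) * q := by nlinarith
    exact_mod_cast this
  have h3 : (q:ℝ) ≤ (P k).ncard := by exact_mod_cast hcard k
  by_contra hcon
  push Not at hcon
  have h4 : 2 * ((n:ℝ)+1) * q ≤ multiIota G (n+1) * (P k).ncard :=
    mul_le_mul hcon h3 (by positivity) (le_trans (by positivity) hcon)
  linarith

noncomputable instance autFintype (G : SimpleGraph V) : Fintype (G ≃g G) :=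
  have : Finite (G ≃g G) := DFunLike.finite _
  Fintype.ofFinite _

lemma exists_avg (G : SimpleGraph V) (htrans : VertexTransitive G) (hV : Nonempty V) :
    ∃ c : ℝ, 0 < c ∧ ∀ X Y : Set V,
      ∑ g : G ≃g G, (((g '' X) ∩ Y).ncard : ℝ) = c * X.ncard * Y.ncard := by
  obtain ⟨v⟩ := hV
  let s : V → V → ℝ := fun x y => ∑ g : G ≃g G, if g x = y then (1:ℝ) else 0
  have hs : ∀ x y, s x y = s v v := by
    intro x y
    obtain ⟨p, hp⟩ := htrans v x
    obtain ⟨q, hq⟩ := htrans v y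
    let E : (G ≃g G) ≃ (G ≃g G) :=
      (Equiv.mulRight p).trans (Equiv.mulLeft q⁻¹)
    refine Fintype.sum_equiv E _ _ fun g => ?_
    have : E g v = v ↔ g x = y := by
      have : E g v = q⁻¹ (g (p v)) := rfl
      rw [this, hp, ← hq]
      constructor
      · intro h
        have := congrArg q h
        rwa [RelIso.apply_inv_self] at this
      · intro h; rw [h, RelIso.inv_apply_self]
    simp [this]
  refine ⟨s v v, ?_, fun X Y => ?_⟩
  · refine Finset.sum_pos' (fun g _ => by positivity) ⟨1, Finset.mem_univ _, by simp⟩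
  · have h1 : ∀ g : G ≃g G, (((g '' X) ∩ Y).ncard : ℝ) =
        ∑ x, ∑ y, (if x ∈ X then (1:ℝ) else 0) * (if y ∈ Y then 1 else 0) *
          (if g x = y then 1 else 0) := by
      intro g
      rw [ncard_eq_sum_s6, Finset.sum_comm]
      refine Finset.sum_congr rfl fun y _ => ?_
      rw [Finset.sum_eq_single (g.symm y)]
      · have : y ∈ g '' X ↔ g.symm y ∈ X := by
          constructor
          · rintro ⟨z, hz, rfl⟩; simpa using hz
          · intro h; exact ⟨_, h, by simp⟩
        simp only [Set.mem_inter_iff, this]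
        by_cases h1 : g.symm y ∈ X <;> by_cases h2 : y ∈ Y <;> simp [h1, h2]
      · intro x _ hx
        have : g x ≠ y := by rintro rfl; simp at hx
        simp [this]
      · simp
    simp_rw [h1]
    rw [Finset.sum_comm, ncard_eq_sum_s6 X, ncard_eq_sum_s6 Y, mul_assoc, Finset.sum_mul_sum,
      Finset.mul_sum]
    refine Finset.sum_congr rfl fun x _ => ?_
    rw [Finset.sum_comm, Finset.mul_sum]
    refine Finset.sum_congr rfl fun y _ => ?_
    rw [← Finset.mul_sum, ← hs x y]
    simp only [s]; ring

end helpers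

section main
set_option linter.unusedSectionVars false
open Classical

variable {V : Type*} [Fintype V]

lemma sum_card {n : ℕ} {A : Fin n → Set V} (hA : IsNPartition n A) :
    ∑ i, ((A i).ncard : ℝ) = Fintype.card V := by
  simp_rw [ncard_eq_sum_s6]
  rw [Finset.sum_comm]
  have : ∀ x : V, ∑ i, (if x ∈ A i then (1:ℝ) else 0) = 1 := by
    intro x
    have hx : x ∈ ⋃ i, A i := by rw [hA.2.2]; trivial
    obtain ⟨j, hj⟩ := Set.mem_iUnion.1 hx
    rw [Finset.sum_eq_single j]
    · simp [hj]
    · intro k _ hk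
      have : x ∉ A k := fun h => Set.disjoint_left.1 (hA.2.1 k j hk) h hj
      simp [this]
    · simp
  simp [this]

lemma size_cmp (G : SimpleGraph V) (htrans : VertexTransitive G)
    (n : ℕ) (hn : 2 ≤ n) (hcard : n + 1 ≤ Fintype.card V)
    (hgap : multiIota G (n + 1) > 2 * (n + 1) * multiIota G n)
    (A : Fin n → Set V) (hA : IsNPartition n A)
    (hach : vertRatioMax G A = multiIota G n) (i j : Fin n) :
    multiIota G (n + 1) * ((A j).ncard - (A i).ncard) ≤
      (vertBdry G (A i)).ncard + (vertBdry G (A j)).ncard := by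
  have hd := bdry_le G A hA
  rw [hach] at hd
  have ha0 : 0 ≤ multiIota G n := hach ▸ ratio_nonneg G A
  have hb2 := iota_lt G n hcard
  have hn' : (2:ℝ) ≤ n := by exact_mod_cast hn
  have hne : Nonempty V := ⟨(hA.1 i).some⟩
  obtain ⟨c, hc, havg⟩ := exists_avg G htrans hne
  set a := multiIota G n
  set b := multiIota G (n+1)
  have ha1 : a < 1 := by
    by_contra h; push Not at h
    nlinarith
  have hab : 2 * a + a * a < b := by nlinarith
  have hlt : ∀ k, ((vertBdry G (A k)).ncard : ℝ) < b * (A k).ncard := by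
    intro k
    have := card_pos_of hA k
    nlinarith [hd k]
  have hi := card_pos_of hA i
  have hj := card_pos_of hA j
  obtain ⟨g, hg⟩ : ∃ g : G ≃g G, ((vertBdry G ((g '' A i) ∩ A j)).ncard : ℝ) <
      b * ((g '' A i) ∩ A j).ncard := by
    by_contra hcon
    push Not at hcon
    have h1 := Finset.sum_le_sum (s := Finset.univ) fun g _ => hcon g
    rw [← Finset.mul_sum, havg] at h1
    have h2 : ∑ g : G ≃g G, ((vertBdry G ((g '' A i) ∩ A j)).ncard : ℝ) ≤
        ∑ g : G ≃g G, ((((g '' vertBdry G (A i)) ∩ A j).ncard : ℝ) +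
          ((((g '' A i) ∩ vertBdry G (A j)).ncard : ℝ) +
          ((g '' vertBdry G (A i)) ∩ vertBdry G (A j)).ncard)) := by
      refine Finset.sum_le_sum fun g _ => ?_
      have h3 := bdry_inter' G (g '' A i) (A j)
      rw [vertBdry_image] at h3
      have h4 := (Set.ncard_le_ncard h3).trans (Set.ncard_union_le _ _)
      have h5 := h4.trans (Nat.add_le_add_left (Set.ncard_union_le _ _) _)
      exact_mod_cast h5
    rw [Finset.sum_add_distrib, Finset.sum_add_distrib, havg, havg, havg] at h2
    have e1 := hd i
    have e2 := hd j
    set x : ℝ := ((A i).ncard : ℝ)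
    set y : ℝ := ((A j).ncard : ℝ)
    set dx : ℝ := ((vertBdry G (A i)).ncard : ℝ)
    set dy : ℝ := ((vertBdry G (A j)).ncard : ℝ)
    have hdx : 0 ≤ dx := by positivity
    have hdy : 0 ≤ dy := by positivity
    have h6 : b * (x * y) ≤ dx * y + x * dy + dx * dy := by
      refine le_of_mul_le_mul_left ?_ hc
      nlinarith
    have h7 : dx * y ≤ a * x * y := mul_le_mul_of_nonneg_right e1 hj.le
    have h8 : x * dy ≤ x * (a * y) := mul_le_mul_of_nonneg_left e2 hi.le
    have h9 : dx * dy ≤ (a * x) * (a * y) := mul_le_mul e1 e2 hdy (by positivity)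
    have h10 : 0 < x * y := mul_pos hi hj
    nlinarith
  rcases split G A hA hlt j (g '' A i) with h | h
  · rw [Set.inter_comm] at h
    exact absurd h (not_le.2 hg)
  · have h1 := ncard_bdry_diff G (A j) (g '' A i)
    rw [vertBdry_image, Set.ncard_image_of_injective _ g.injective] at h1
    have h2 : ((A j).ncard : ℝ) - (A i).ncard ≤ (A j \ g '' A i).ncard := by
      have h3 := Set.ncard_le_ncard (s := A j) (t := (A j \ g '' A i) ∪ g '' A i)
        (by intro x hx; by_cases h : x ∈ g '' A i
            · right; exact h
            · left; exact ⟨hx, h⟩)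
      have h4 := h3.trans (Set.ncard_union_le _ _)
      rw [Set.ncard_image_of_injective _ g.injective] at h4
      have h5 : ((A j).ncard : ℝ) ≤ (A j \ g '' A i).ncard + (A i).ncard := by exact_mod_cast h4
      linarith
    have hb : 0 ≤ b := by nlinarith
    have := mul_le_mul_of_nonneg_left h2 hb
    linarith

lemma bdry_compl (G : SimpleGraph V) (A : Set V) : vertBdry G Aᶜ = vertBdry G A := by
  ext x
  simp only [vertBdry, Set.mem_ofPred_eq, Set.mem_compl_iff, not_iff_not]

lemma six_lt (G : SimpleGraph V) (htrans : VertexTransitive G)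
    (n : ℕ) (hn : 2 ≤ n) (hcard : n + 1 ≤ Fintype.card V)
    (hgap : multiIota G (n + 1) > 2 * (n + 1) * multiIota G n)
    (A : Fin n → Set V) (hA : IsNPartition n A)
    (hach : vertRatioMax G A = multiIota G n) (i j : Fin n) :
    6 * ((vertBdry G (A j)).ncard : ℝ) < multiIota G (n + 1) * (A i).ncard := by
  have hs := size_cmp G htrans n hn hcard hgap A hA hach i j
  have hd := bdry_le G A hA
  rw [hach] at hd
  have ha0 : 0 ≤ multiIota G n := hach ▸ ratio_nonneg G A
  have hi := card_pos_of hA i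
  have hj := card_pos_of hA j
  have hdi := hd i
  have hdj := hd j
  rcases hn.eq_or_lt with h2 | h3
  · subst h2
    have : vertBdry G (A j) = vertBdry G (A i) := by
      by_cases hij : j = i
      · rw [hij]
      · rw [← bdry_compl G (A i)]
        congr 1
        ext x
        have hx : x ∈ ⋃ i, A i := by rw [hA.2.2]; trivial
        obtain ⟨k, hk⟩ := Set.mem_iUnion.1 hx
        constructor
        · intro h1 h2
          exact Set.disjoint_left.1 (hA.2.1 j i hij) h1 h2
        · intro h1
          have : k ≠ i := by rintro rfl; exact h1 hk
          have : k = j := by omega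
          exact this ▸ hk
    rw [this]
    push_cast at hgap
    nlinarith
  · have hn' : (3:ℝ) ≤ n := by exact_mod_cast h3
    set a := multiIota G n
    set b := multiIota G (n+1)
    have hb : 8 * a < b := by nlinarith
    set x : ℝ := ((A i).ncard : ℝ)
    set y : ℝ := ((A j).ncard : ℝ)
    have h1 : (b - a) * y ≤ (b + a) * x := by nlinarith
    have h2 : 6 * a * y < b * x := by
      have hba : 0 < b - a := by linarith
      refine lt_of_mul_lt_mul_left ?_ hba.le
      have h4 := mul_le_mul_of_nonneg_left h1 (by linarith : 0 ≤ 6 * a)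
      have h5 : 0 < (b * b - 7 * a * b - 6 * a * a) * x := by
        apply mul_pos _ hi
        nlinarith
      nlinarith
    linarith

lemma exists_sigma (G : SimpleGraph V) (htrans : VertexTransitive G)
    (n : ℕ) (hn : 2 ≤ n) (hcard : n + 1 ≤ Fintype.card V)
    (hgap : multiIota G (n + 1) > 2 * (n + 1) * multiIota G n)
    (A : Fin n → Set V) (hA : IsNPartition n A)
    (hach : vertRatioMax G A = multiIota G n) (g : G ≃g G) (i : Fin n) :
    ∃ j, multiIota G (n + 1) * (g '' A i \ A j).ncard ≤
      (vertBdry G (A i)).ncard + (vertBdry G (A j)).ncard := by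
  by_contra hcon
  push Not at hcon
  have hs := fun j => size_cmp G htrans n hn hcard hgap A hA hach i j
  have hd := bdry_le G A hA
  rw [hach] at hd
  have ha0 : 0 ≤ multiIota G n := hach ▸ ratio_nonneg G A
  have hi := card_pos_of hA i
  have hn' : (2:ℝ) ≤ n := by exact_mod_cast hn
  set a := multiIota G n
  set b := multiIota G (n+1)
  have hba : 0 < b - a := by nlinarith
  have hlt : ∀ k, ((vertBdry G (g '' A k)).ncard : ℝ) < b * (g '' A k).ncard := by
    intro k
    rw [vertBdry_image, Set.ncard_image_of_injective _ g.injective,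
      Set.ncard_image_of_injective _ g.injective]
    have := card_pos_of hA k
    nlinarith [hd k]
  have h1 : ∀ j, b * (g '' A i ∩ A j).ncard ≤ a * (A i).ncard + a * (A j).ncard := by
    intro j
    rcases split G _ (image_partition hA g) hlt i (A j) with h | h
    · have h2 := ncard_bdry_inter G (g '' A i) (A j)
      rw [vertBdry_image, Set.ncard_image_of_injective _ g.injective] at h2
      have := hd i
      have := hd j
      linarith
    · have h2 := ncard_bdry_diff G (g '' A i) (A j)
      rw [vertBdry_image, Set.ncard_image_of_injective _ g.injective] at h2
      have := hcon j
      linarith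
  have h2 : ((A i).ncard : ℝ) ≤ ∑ j, ((g '' A i ∩ A j).ncard : ℝ) := by
    have : g '' A i = ⋃ j, (g '' A i ∩ A j) := by
      rw [← Set.inter_iUnion, hA.2.2, Set.inter_univ]
    have h3 : (A i).ncard ≤ ∑ j, (g '' A i ∩ A j).ncard := by
      rw [← Set.ncard_image_of_injective (A i) g.injective]
      conv_lhs => rw [this]
      exact Set.ncard_iUnion_le_of_fintype _
    exact_mod_cast h3
  have h3 : ∀ j, (b - a) * (b * (g '' A i ∩ A j).ncard) ≤ 2 * a * b * (A i).ncard := by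
    intro j
    have h4 := mul_le_mul_of_nonneg_left (h1 j) hba.le
    have h5 : (b - a) * (A j).ncard ≤ (b + a) * (A i).ncard := by
      have := hs j; have := hd i; have := hd j; linarith
    have h6 := mul_le_mul_of_nonneg_left h5 ha0
    linarith
  have h4 := Finset.sum_le_sum (s := Finset.univ) fun j _ => h3 j
  rw [← Finset.mul_sum, ← Finset.mul_sum] at h4
  simp only [Finset.sum_const, Finset.card_univ, Fintype.card_fin, nsmul_eq_mul] at h4
  have hb : 0 < b := by linarith
  have h5 := mul_le_mul_of_nonneg_left h2 (mul_pos hba hb).le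
  have h6 : 0 < b * (A i).ncard * (b - a - 2 * a * n) := by
    apply mul_pos (mul_pos hb hi); nlinarith
  nlinarith

lemma voting (G : SimpleGraph V) (htrans : VertexTransitive G) (n : ℕ) (hn : 2 ≤ n)
    (A : Fin n → Set V) (hA : IsNPartition n A)
    (σ : (G ≃g G) → Equiv.Perm (Fin n)) (hσ : ∀ g h i, σ (g * h) i = σ g (σ h i))
    (e : ℝ) (he : 2 * e < Fintype.card V)
    (herr : ∀ g : G ≃g G, ∑ i, ((g '' A i \ A (σ g i)).ncard : ℝ) ≤ e)
    (hbig : ∀ i, e < (A i).ncard) :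
    ∃ B : Fin n → Set V, IsNPartition n B ∧
      (∀ φ : G ≃g G, ∃ σ : Equiv.Perm (Fin n), ∀ i, ⇑φ '' B i = B (σ i)) ∧
      (∀ i, ((symmDiff (B i) (A i)).ncard : ℝ) ≤ e) := by
  have hcov : ∀ x : V, ∃ i, x ∈ A i := by
    intro x
    have hx : x ∈ ⋃ i, A i := by rw [hA.2.2]; trivial
    exact Set.mem_iUnion.1 hx
  choose κ hκ using hcov
  have hκ' : ∀ x i, x ∈ A i ↔ κ x = i := by
    intro x i
    constructor
    · intro h
      by_contra hne
      exact Set.disjoint_left.1 (hA.2.1 _ _ hne) (hκ x) h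
    · rintro rfl; exact hκ x
  let F : Fin n → V → ℝ := fun i x => ∑ g : G ≃g G, if κ (g x) = σ g i then (1:ℝ) else 0
  let M : ℝ := Fintype.card (G ≃g G)
  let N : ℝ := Fintype.card V
  have hM : 0 < M := by
    have : Nonempty (G ≃g G) := ⟨1⟩
    simp only [M]; exact_mod_cast Fintype.card_pos
  have hF0 : ∀ i x, 0 ≤ F i x := fun i x => Finset.sum_nonneg fun g _ => by positivity
  have hFsum : ∀ x, ∑ i, F i x = M := by
    intro x
    simp only [F]
    rw [Finset.sum_comm]
    have : ∀ g : G ≃g G, ∑ i, (if κ (g x) = σ g i then (1:ℝ) else 0) = 1 := by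
      intro g
      rw [Finset.sum_eq_single ((σ g).symm (κ (g x)))]
      · simp
      · intro k _ hk
        rw [if_neg]
        intro h; apply hk; rw [h]; simp
      · simp
    simp [this, M]
  have hFequi : ∀ h i x, F (σ h i) (h x) = F i x := by
    intro h i x
    refine Fintype.sum_equiv (Equiv.mulRight h) _ _ fun g => ?_
    have h1 : (Equiv.mulRight h) g = g * h := rfl
    rw [h1, hσ]
    rfl
  have hpair : ∀ i j x, i ≠ j → F i x + F j x ≤ M := by
    intro i j x hij
    rw [← hFsum x, ← Finset.sum_pair (f := fun i => F i x) hij]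
    exact Finset.sum_le_sum_of_subset_of_nonneg (Finset.subset_univ _) fun k _ _ => hF0 k x
  have htot : ∑ x, (M - F (κ x) x) ≤ M * e := by
    have h1 : ∑ x, (M - F (κ x) x) =
        ∑ g : G ≃g G, ∑ i, ((g '' A i \ A (σ g i)).ncard : ℝ) := by
      have h2 : ∀ x, M - F (κ x) x =
          ∑ g : G ≃g G, if κ (g x) = σ g (κ x) then (0:ℝ) else 1 := by
        intro x
        have : M = ∑ g : G ≃g G, (1:ℝ) := by simp [M]
        rw [this, ← Finset.sum_sub_distrib]
        refine Finset.sum_congr rfl fun g _ => ?_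
        split_ifs <;> simp
      simp_rw [h2]
      rw [Finset.sum_comm]
      refine Finset.sum_congr rfl fun g _ => ?_
      have h3 : ∀ i, ((g '' A i \ A (σ g i)).ncard : ℝ) =
          ∑ x, if κ x = i ∧ κ (g x) ≠ σ g i then (1:ℝ) else 0 := by
        intro i
        have : g '' A i \ A (σ g i) = g '' {x | κ x = i ∧ κ (g x) ≠ σ g i} := by
          ext y
          constructor
          · rintro ⟨⟨x, hx, rfl⟩, hy⟩
            exact ⟨x, ⟨(hκ' _ _).1 hx, fun h => hy ((hκ' _ _).2 h)⟩, rfl⟩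
          · rintro ⟨x, ⟨hx, hx'⟩, rfl⟩
            exact ⟨⟨x, (hκ' _ _).2 hx, rfl⟩, fun h => hx' ((hκ' _ _).1 h)⟩
        rw [this, Set.ncard_image_of_injective _ g.injective, ncard_eq_sum_s6]
        refine Finset.sum_congr rfl fun x _ => ?_
        simp only [Set.mem_ofPred_eq]
      simp_rw [h3]
      rw [Finset.sum_comm]
      refine Finset.sum_congr rfl fun x _ => ?_
      rw [Finset.sum_eq_single (κ x)]
      · by_cases h : κ (g x) = σ g (κ x) <;> simp [h]
      · intro i _ hi
        rw [if_neg]; rintro ⟨h, -⟩; exact hi h.symm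
      · simp
    rw [h1]
    calc _ ≤ ∑ g : G ≃g G, e := Finset.sum_le_sum fun g _ => herr g
      _ = M * e := by simp [M]
  -- a good vertex
  obtain ⟨x0, hx0⟩ : ∃ x, M < 2 * F (κ x) x := by
    by_contra hcon
    push Not at hcon
    have h1 : ∑ x : V, M / 2 ≤ ∑ x, (M - F (κ x) x) :=
      Finset.sum_le_sum fun x _ => by linarith [hcon x]
    simp only [Finset.sum_const, Finset.card_univ, nsmul_eq_mul] at h1
    nlinarith
  obtain ⟨m, hm⟩ : ∃ m, m = F (κ x0) x0 := ⟨_, rfl⟩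
  rw [← hm] at hx0
  have hmax : ∀ y, ∃ i, F i y = m := by
    intro y
    obtain ⟨φ, rfl⟩ := htrans x0 y
    exact ⟨σ φ (κ x0), by rw [hFequi, hm]⟩
  choose β hβ using hmax
  have hβ' : ∀ i y, M < 2 * F i y ↔ β y = i := by
    intro i y
    constructor
    · intro h
      by_contra hne
      have := hpair _ _ y hne
      rw [hβ] at this
      linarith
    · rintro rfl; rw [hβ]; exact hx0
  have hmM : m ≤ M := by
    rw [hm, ← hFsum x0]
    exact Finset.single_le_sum (f := fun i => F i x0) (fun k _ => hF0 k x0) (Finset.mem_univ _)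
  let bad : Set V := {x | β x ≠ κ x}
  have hbad : (bad.ncard : ℝ) ≤ e := by
    have h1 : ∀ x, (M - m) + (2 * m - M) * (if x ∈ bad then (1:ℝ) else 0) ≤ M - F (κ x) x := by
      intro x
      by_cases h : x ∈ bad
      · have := hpair _ _ x h
        rw [hβ] at this
        simp only [h, if_true]; linarith
      · have h' : β x = κ x := by
          by_contra h2; exact h h2
        rw [if_neg h, ← h', hβ]; linarith
    have h2 := (Finset.sum_le_sum (s := Finset.univ) fun x _ => h1 x).trans htot
    rw [Finset.sum_add_distrib, ← Finset.mul_sum, ← ncard_eq_sum_s6] at h2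
    simp only [Finset.sum_const, Finset.card_univ, nsmul_eq_mul] at h2
    change N * (M - m) + (2 * m - M) * bad.ncard ≤ M * e at h2
    change 2 * e < N at he
    set p : ℝ := (bad.ncard : ℝ)
    by_contra hcon
    push Not at hcon
    rcases le_total (2 * p) N with h3 | h3
    · have : 0 ≤ (M - m) * (N - 2 * p) := mul_nonneg (by linarith) (by linarith)
      nlinarith
    · have : 0 ≤ (2 * m - M) * (2 * p - N) := mul_nonneg (by linarith) (by linarith)
      nlinarith
  have hsym : ∀ i, ((symmDiff ({x | β x = i} : Set V) (A i)).ncard : ℝ) ≤ e := by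
    intro i
    refine le_trans ?_ hbad
    have : (symmDiff ({x | β x = i} : Set V) (A i)) ⊆ bad := by
      intro x hx hxx
      rcases hx with ⟨h1, h2⟩ | ⟨h1, h2⟩
      · exact h2 ((hκ' _ _).2 (hxx.symm.trans h1))
      · exact h2 (hxx.trans ((hκ' _ _).1 h1))
    exact_mod_cast Set.ncard_le_ncard this
  refine ⟨fun i => {x | β x = i}, ⟨?_, ?_, ?_⟩, ?_, hsym⟩
  · intro i
    by_contra hne
    rw [Set.not_nonempty_iff_eq_empty] at hne
    change ({x | β x = i} : Set V) = ∅ at hne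
    have h1 := hsym i
    rw [hne] at h1
    have h2 : symmDiff (∅ : Set V) (A i) = A i := bot_symmDiff _
    rw [h2] at h1
    linarith [hbig i]
  · intro i j hij
    exact Set.disjoint_left.2 fun x hx hx' => hij (hx.symm.trans hx')
  · rw [Set.eq_univ_iff_forall]
    intro x
    exact Set.mem_iUnion.2 ⟨β x, rfl⟩
  · intro φ
    have hk : ∀ x i, β x = i ↔ β (φ x) = σ φ i := by
      intro x i
      rw [← hβ', ← hβ', hFequi]
    refine ⟨σ φ, fun i => ?_⟩
    ext y
    constructor
    · rintro ⟨x, hx, rfl⟩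
      exact (hk x i).1 hx
    · intro hy
      refine ⟨φ.symm y, ?_, by simp⟩
      apply (hk _ _).2
      simpa using hy

end main

theorem imprimitivity_from_iota_gap {V : Type*} [Fintype V] (G : SimpleGraph V)
    (htrans : VertexTransitive G)
    (n : ℕ) (hn : 2 ≤ n) (hcard : n + 1 ≤ Fintype.card V)
    (hgap : multiIota G (n + 1) > 2 * (n + 1) * multiIota G n)
    (A : Fin n → Set V) (hA : IsNPartition n A)
    (hach : vertRatioMax G A = multiIota G n) :
    ∃ B : Fin n → Set V, IsNPartition n B ∧
      (∀ φ : G ≃g G, ∃ σ : Equiv.Perm (Fin n), ∀ i, ⇑φ '' B i = B (σ i)) ∧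
      (∀ i, ((symmDiff (B i) (A i)).ncard : ℝ)
          ≤ 4 * multiIota G n / multiIota G (n + 1) * Fintype.card V) := by
  classical
  have hs := fun i j => size_cmp G htrans n hn hcard hgap A hA hach i j
  have h6 := fun i j => six_lt G htrans n hn hcard hgap A hA hach i j
  have hσ := fun g i => exists_sigma G htrans n hn hcard hgap A hA hach g i
  have hd := bdry_le G A hA
  rw [hach] at hd
  have ha0 : 0 ≤ multiIota G n := hach ▸ ratio_nonneg G A
  have hn' : (2:ℝ) ≤ n := by exact_mod_cast hn
  have hsum := sum_card hA
  set a := multiIota G n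
  set b := multiIota G (n+1)
  have hb : 0 < b := by nlinarith
  have hNpos : (0:ℝ) < Fintype.card V := by
    have : 0 < Fintype.card V := by omega
    exact_mod_cast this
  choose τ hτ using hσ
  have hmul : ∀ g h i, τ (g * h) i = τ g (τ h i) := by
    intro g h i
    by_contra hne
    have hsub : (g * h : G ≃g G) '' A i ⊆ ((g * h : G ≃g G) '' A i \ A (τ (g * h) i)) ∪
        (g '' (h '' A i \ A (τ h i)) ∪ (g '' A (τ h i) \ A (τ g (τ h i)))) := by
      rintro _ ⟨x, hx, rfl⟩
      by_cases h1 : (g * h : G ≃g G) x ∈ A (τ (g * h) i)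
      · right
        by_cases h2 : h x ∈ A (τ h i)
        · right
          refine ⟨⟨h x, h2, rfl⟩, fun h3 => ?_⟩
          exact Set.disjoint_left.1 (hA.2.1 _ _ hne) h1 h3
        · left
          exact ⟨h x, ⟨⟨x, hx, rfl⟩, h2⟩, rfl⟩
      · left; exact ⟨⟨x, hx, rfl⟩, h1⟩
    have h1 := (Set.ncard_le_ncard hsub).trans ((Set.ncard_union_le _ _).trans
      (Nat.add_le_add_left (Set.ncard_union_le _ _) _))
    rw [Set.ncard_image_of_injective _ (g * h).injective,
      Set.ncard_image_of_injective _ g.injective] at h1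
    have h2 : ((A i).ncard : ℝ) ≤ ((g * h : G ≃g G) '' A i \ A (τ (g * h) i)).ncard +
        ((h '' A i \ A (τ h i)).ncard + (g '' A (τ h i) \ A (τ g (τ h i))).ncard) := by
      exact_mod_cast h1
    have h3 := mul_le_mul_of_nonneg_left h2 hb.le
    have e1 := hτ (g * h) i
    have e2 := hτ h i
    have e3 := hτ g (τ h i)
    have f1 := h6 i i
    have f2 := h6 i (τ h i)
    have f3 := h6 i (τ (g * h) i)
    have f4 := h6 i (τ g (τ h i))
    linarith
  have hone : ∀ i, τ 1 i = i := by
    intro i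
    by_contra hne
    have h1 := hτ 1 i
    have h2 : (1 : G ≃g G) '' A i \ A (τ 1 i) = A i := by
      have h3 : (1 : G ≃g G) '' A i = A i := by
        ext x; constructor
        · rintro ⟨y, hy, rfl⟩; exact hy
        · intro hx; exact ⟨x, hx, rfl⟩
      rw [h3]
      exact (hA.2.1 _ _ (Ne.symm hne)).sdiff_eq_left
    rw [h2] at h1
    have f1 := h6 i i
    have f2 := h6 i (τ 1 i)
    have := card_pos_of hA i
    have := mul_pos hb this
    linarith
  let σ : (G ≃g G) → Equiv.Perm (Fin n) := fun g =>
    { toFun := τ g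
      invFun := τ g⁻¹
      left_inv := fun i => by rw [← hmul, inv_mul_cancel, hone]
      right_inv := fun i => by rw [← hmul, mul_inv_cancel, hone] }
  have hdsum : ∑ i, ((vertBdry G (A i)).ncard : ℝ) ≤ a * Fintype.card V := by
    rw [← hsum, Finset.mul_sum]
    exact Finset.sum_le_sum fun i _ => hd i
  obtain ⟨B, hB, hB1, hB2⟩ := voting G htrans n hn A hA σ (fun g h i => hmul g h i)
    (2 * a / b * Fintype.card V) (by
      rw [← sub_pos]
      have : 2 * a / b < 1 / 2 := by
        rw [div_lt_iff₀ hb]; nlinarith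
      nlinarith) (by
      intro g
      have h1 : b * ∑ i, ((g '' A i \ A (σ g i)).ncard : ℝ) ≤ 2 * a * Fintype.card V := by
        rw [Finset.mul_sum]
        have h2 : ∑ i, b * ((g '' A i \ A (σ g i)).ncard : ℝ) ≤
            ∑ i, (((vertBdry G (A i)).ncard : ℝ) + (vertBdry G (A (σ g i))).ncard) :=
          Finset.sum_le_sum fun i _ => hτ g i
        rw [Finset.sum_add_distrib,
          Equiv.sum_comp (σ g) (fun i => ((vertBdry G (A i)).ncard : ℝ))] at h2
        linarith
      rw [div_mul_eq_mul_div, le_div_iff₀ hb]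
      linarith) (by
      intro i
      rw [div_mul_eq_mul_div, div_lt_iff₀ hb]
      by_contra hcon
      push Not at hcon
      have hba : 0 < b - a := by nlinarith
      have h1 : ∀ j, (b - a) * (A j).ncard ≤ (b + a) * (A i).ncard := by
        intro j
        have := hs i j; have := hd i; have := hd j; linarith
      have h2 := Finset.sum_le_sum (s := Finset.univ) fun j _ => h1 j
      rw [← Finset.mul_sum, hsum] at h2
      simp only [Finset.sum_const, Finset.card_univ, Fintype.card_fin, nsmul_eq_mul] at h2
      have hi := card_pos_of hA i
      set N : ℝ := (Fintype.card V : ℝ)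
      set x : ℝ := ((A i).ncard : ℝ)
      have h3 := mul_le_mul_of_nonneg_left h2 hb.le
      have h4 := mul_le_mul_of_nonneg_left hcon (by positivity : 0 ≤ (n:ℝ) * (b + a))
      have h5 : 0 < b * (b - a) - 2 * a * n * (b + a) := by
        have h7 : 0 < b * (b - 2 * (n + 1) * a) := mul_pos hb (by linarith)
        have h8 : 0 ≤ a * (b - 2 * (n + 1) * a) := mul_nonneg ha0 (by linarith)
        nlinarith
      have h7 := mul_pos h5 hNpos
      nlinarith)
  refine ⟨B, hB, hB1, fun i => (hB2 i).trans ?_⟩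
  apply mul_le_mul_of_nonneg_right _ hNpos.le
  apply div_le_div_of_nonneg_right _ hb.le
  linarith

end Multiway
end

section
/- Let Γ be a finite vertex-transitive graph (possibly disconnected) on vertex set V, let 2 ≤ n ≤ |V| − 1, and let G be a group acting on Γ by graph automorphisms whose action on V is transitive. If there exists no system of imprimitivity of size n for the action G ↷ V, then h_{n+1}(Γ) ≤ 2(n+1)·h_n(Γ) and ι_{n+1}(Γ) ≤ 2(n+1)·ι_n(Γ). -/
open scoped Pointwise

namespace Multiway

variable {V : Type*}

open Finset in
theorem avg_count {V G : Type*} [Fintype V] [DecidableEq V] [Fintype G] [Group G]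
    [MulAction G V] (htrans : ∀ u v : V, ∃ g : G, g • u = v) (S : Finset V) (u : V) :
    #{g : G | g⁻¹ • u ∈ S} * Fintype.card V = Fintype.card G * #S := by
  classical
  have hconst : ∀ v : V, #{g : G | g⁻¹ • v ∈ S} = #{g : G | g⁻¹ • u ∈ S} := by
    intro v
    obtain ⟨k, rfl⟩ := htrans u v
    refine Finset.card_bij' (fun g _ => k⁻¹ * g) (fun g _ => k * g) ?_ ?_ ?_ ?_ <;>
      simp [mul_smul]
  have h1 : ∑ v : V, #{g : G | g⁻¹ • v ∈ S} = ∑ g : G, #{v : V | g⁻¹ • v ∈ S} := by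
    simp only [Finset.card_filter]
    exact Finset.sum_comm
  have h2 : ∀ g : G, #{v : V | g⁻¹ • v ∈ S} = #S := by
    intro g
    refine Finset.card_bij' (fun v _ => g⁻¹ • v) (fun v _ => g • v) ?_ ?_ ?_ ?_ <;> simp
  simp only [hconst, h2, Finset.sum_const, Finset.card_univ, smul_eq_mul] at h1
  linarith

open Finset in
theorem comb {V G : Type*} [Fintype V] [DecidableEq V] [Fintype G] [Group G]
    [MulAction G V] (htrans : ∀ u v : V, ∃ g : G, g • u = v) {n : ℕ} (hn : 2 ≤ n)
    (c : V → Fin n) (j : Fin n) (hpos : 0 < #{v : V | c v = j})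
    (hmin : ∀ i, #{v : V | c v = j} ≤ #{v : V | c v = i})
    (σ : G → Fin n)
    (hσ : ∀ g, (n + 1) * #{v : V | c v = σ g ∧ ¬ c (g⁻¹ • v) = j} < #{v : V | c v = σ g}) :
    ∃ f : V → Fin n, Function.Surjective f ∧
      ∀ k : G, ∃ τ : Equiv.Perm (Fin n), ∀ v, f (k • v) = τ (f v) := by
  classical
  set s := #{v : V | c v = j} with hs
  set a : Fin n → ℕ := fun i => #{v : V | c v = i} with ha
  have hgS : ∀ g : G, #{v : V | c (g⁻¹ • v) = j} = s := by
    intro g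
    refine Finset.card_bij' (fun v _ => g⁻¹ • v) (fun v _ => g • v) ?_ ?_ ?_ ?_ <;> simp
  -- splitting
  have hsplit1 : ∀ g, #{v : V | c v = σ g ∧ c (g⁻¹ • v) = j}
      + #{v : V | c v = σ g ∧ ¬ c (g⁻¹ • v) = j} = a (σ g) := by
    intro g
    rw [← Finset.filter_filter, ← Finset.filter_filter]
    exact Finset.card_filter_add_card_filter_not _
  have hsplit2 : ∀ g, #{v : V | c v = σ g ∧ c (g⁻¹ • v) = j}
      + #{v : V | c (g⁻¹ • v) = j ∧ ¬ c v = σ g} = s := by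
    intro g
    rw [← hgS g, ← Finset.card_filter_add_card_filter_not (s := {v : V | c (g⁻¹ • v) = j})
      (fun v => c v = σ g), Finset.filter_filter, Finset.filter_filter]
    simp only [and_comm]
  have hσ' : ∀ g, (n + 1) * #{v : V | c v = σ g ∧ ¬ c (g⁻¹ • v) = j} < a (σ g) := hσ
  have hI : ∀ g, n * a (σ g) < (n + 1) * #{v : V | c v = σ g ∧ c (g⁻¹ • v) = j} := by
    intro g; have := hsplit1 g; have := hσ' g; nlinarith
  have hd : ∀ g, (n + 1) * #{v : V | c (g⁻¹ • v) = j ∧ ¬ c v = σ g} < s := by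
    intro g; have := hI g; have := hsplit2 g
    have h3 : s ≤ a (σ g) := hmin _
    nlinarith
  have hsz : ∀ g, n * a (σ g) < (n + 1) * s := by
    intro g; have := hI g; have := hsplit2 g
    nlinarith
  have huniq : ∀ g i, s ≤ (n + 1) * #{v : V | c (g⁻¹ • v) = j ∧ c v = i} → σ g = i := by
    intro g i h
    by_contra hne
    have : #{v : V | c (g⁻¹ • v) = j ∧ c v = i} ≤ #{v : V | c (g⁻¹ • v) = j ∧ ¬ c v = σ g} := by
      apply Finset.card_le_card
      intro v; simp only [Finset.mem_filter, Finset.mem_univ, true_and]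
      rintro ⟨h1, rfl⟩; exact ⟨h1, fun h => hne h.symm⟩
    have := hd g
    nlinarith
  have hGpos : 0 < Fintype.card G := Fintype.card_pos
  have hsumV : ∑ i, a i = Fintype.card V := by
    rw [← Finset.card_univ]
    exact (Finset.card_eq_sum_card_fiberwise (f := c) (t := Finset.univ) (by simp)).symm
  have hns : n * s ≤ Fintype.card V := by
    rw [← hsumV]
    calc n * s = ∑ _i : Fin n, s := by simp
      _ ≤ _ := Finset.sum_le_sum (fun i _ => hmin i)
  have havg : ∀ u : V, #{g : G | c (g⁻¹ • u) = j} * Fintype.card V = Fintype.card G * s := by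
    intro u
    have := avg_count (G := G) htrans {v : V | c v = j} u
    simpa using this
  -- surjectivity
  have hsurj : Function.Surjective σ := by
    by_contra hns'
    obtain ⟨i0, hi0⟩ : ∃ i0, ∀ g, σ g ≠ i0 := by
      simpa [Function.Surjective] using hns'
    let H : Finset (Fin n) := Finset.univ.image σ
    let U : Finset V := {v : V | c v ∉ H}
    have hU1 : ∀ g : G, (n + 1) * #{v ∈ U | c (g⁻¹ • v) = j} < s := by
      intro g
      refine lt_of_le_of_lt (Nat.mul_le_mul_left _ (Finset.card_le_card ?_)) (hd g)
      intro v
      simp only [U, H, Finset.mem_filter, Finset.mem_univ, true_and, Finset.mem_image, not_exists]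
      rintro ⟨h1, h2⟩
      exact ⟨h2, fun h => h1 g h.symm⟩
    have hdc : ∑ g : G, #{v ∈ U | c (g⁻¹ • v) = j} = ∑ v ∈ U, #{g : G | c (g⁻¹ • v) = j} := by
      simp only [Finset.card_filter]
      exact Finset.sum_comm
    have hlt : (n + 1) * ∑ g : G, #{v ∈ U | c (g⁻¹ • v) = j} < Fintype.card G * s := by
      rw [Finset.mul_sum]
      calc _ < ∑ _g : G, s := Finset.sum_lt_sum_of_nonempty ⟨1, Finset.mem_univ _⟩ (fun g _ => hU1 g)
        _ = _ := by simp
    have heq : (∑ v ∈ U, #{g : G | c (g⁻¹ • v) = j}) * Fintype.card V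
        = #U * (Fintype.card G * s) := by
      rw [Finset.sum_mul, Finset.sum_congr rfl (fun v _ => havg v)]; simp
    have hUV : (n + 1) * #U < Fintype.card V := by
      rw [hdc] at hlt
      have hgs : 0 < Fintype.card G * s := by positivity
      have hV : 0 < Fintype.card V := by nlinarith
      have := Nat.mul_lt_mul_of_pos_right hlt hV
      rw [mul_assoc, heq] at this
      nlinarith
    have hUs : s ≤ #U := by
      refine (hmin i0).trans (Finset.card_le_card ?_)
      intro v
      simp only [U, H, Finset.mem_filter, Finset.mem_univ, true_and, Finset.mem_image, not_exists]
      rintro rfl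
      exact fun g => hi0 g
    have hcompl : #U + ∑ i ∈ H, a i = Fintype.card V := by
      have : ∑ i ∈ H, a i = #{v : V | c v ∈ H} := by
        rw [Finset.card_eq_sum_card_fiberwise (f := c) (t := H) (by intro v; simp)]
        refine Finset.sum_congr rfl fun i hi => ?_
        simp only [ha, Finset.filter_filter]
        congr 1; ext v
        simp only [Finset.mem_filter, Finset.mem_univ, true_and]
        constructor
        · rintro rfl; exact ⟨hi, rfl⟩
        · exact fun h => h.2
      rw [this, ← Finset.card_univ, add_comm]
      exact Finset.card_filter_add_card_filter_not _
    have hHc : #H + 1 ≤ n := by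
      have : #H < Fintype.card (Fin n) := by
        apply Finset.card_lt_univ_of_notMem (x := i0)
        simp [H, hi0]
      simpa using this
    have hHs : n * ∑ i ∈ H, a i ≤ #H * ((n + 1) * s) := by
      rw [Finset.mul_sum]
      calc _ ≤ ∑ _i ∈ H, (n + 1) * s := by
            refine Finset.sum_le_sum fun i hi => ?_
            obtain ⟨g, -, rfl⟩ := Finset.mem_image.1 hi
            exact (hsz g).le
        _ = _ := by simp
    obtain ⟨m, rfl⟩ : ∃ m, n = m + 1 := ⟨n - 1, by omega⟩
    have h5 : #H * ((m + 1 + 1) * s) ≤ m * ((m + 1 + 1) * #U) := by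
      apply Nat.mul_le_mul (by omega) (Nat.mul_le_mul_left _ hUs)
    have h6 : (m + 1) * #U < ∑ i ∈ H, a i := by nlinarith
    have h7 := Nat.mul_lt_mul_of_pos_left h6 (show 0 < m + 1 by omega)
    nlinarith
  -- compatibility
  have hcompat : ∀ k g h : G, σ g = σ h → σ (k * g) = σ (k * h) := by
    intro k g h hgh
    have e1 : σ (g⁻¹ * h) = j := by
      apply huniq
      have hb : #{v : V | c ((g⁻¹ * h)⁻¹ • v) = j ∧ c v = j}
          = #{v : V | c (h⁻¹ • v) = j ∧ c (g⁻¹ • v) = j} := by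
        refine Finset.card_bij' (fun v _ => g • v) (fun v _ => g⁻¹ • v) ?_ ?_ ?_ ?_ <;>
          simp [mul_smul]
      rw [hb]
      have hcov : a (σ g) ≤ #{v : V | c (h⁻¹ • v) = j ∧ c (g⁻¹ • v) = j} +
          (#{v : V | c v = σ g ∧ ¬ c (g⁻¹ • v) = j} + #{v : V | c v = σ h ∧ ¬ c (h⁻¹ • v) = j}) := by
        refine le_trans (Finset.card_le_card ?_) ((Finset.card_union_le _ _).trans
          (Nat.add_le_add_left (Finset.card_union_le _ _) _))
        intro v
        simp only [Finset.mem_union, Finset.mem_filter, Finset.mem_univ, true_and, ← hgh]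
        tauto
      have h1 := hσ' g
      have h2 := hσ' h
      rw [← hgh] at h2 hcov
      have h3 : s ≤ a (σ g) := hmin _
      nlinarith
    by_contra hne
    have hI' := hI (g⁻¹ * h)
    rw [e1] at hI'
    have hb : #{v : V | c v = j ∧ c ((g⁻¹ * h)⁻¹ • v) = j}
        = #{v : V | c ((k * g)⁻¹ • v) = j ∧ c ((k * h)⁻¹ • v) = j} := by
      refine Finset.card_bij' (fun v _ => (k * g) • v) (fun v _ => (k * g)⁻¹ • v) ?_ ?_ ?_ ?_ <;>
        simp [mul_smul]
    rw [hb] at hI'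
    have hcov : #{v : V | c ((k * g)⁻¹ • v) = j ∧ c ((k * h)⁻¹ • v) = j} ≤
        #{v : V | c ((k * g)⁻¹ • v) = j ∧ ¬ c v = σ (k * g)} +
        #{v : V | c ((k * h)⁻¹ • v) = j ∧ ¬ c v = σ (k * h)} := by
      refine le_trans (Finset.card_le_card ?_) (Finset.card_union_le _ _)
      intro v
      simp only [Finset.mem_union, Finset.mem_filter, Finset.mem_univ, true_and]
      rintro ⟨h1, h2⟩
      by_cases h3 : c v = σ (k * g)
      · right; exact ⟨h2, fun h => hne (h3.symm.trans h)⟩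
      · left; exact ⟨h1, h3⟩
    have h1 := hd (k * g)
    have h2 := hd (k * h)
    have h3 : a j = s := rfl
    rw [h3] at hI'
    nlinarith
  -- the permutation
  have hτ : ∀ k : G, ∃ τ : Equiv.Perm (Fin n), ∀ g, σ (k * g) = τ (σ g) := by
    intro k
    choose r hr using hsurj
    have key : ∀ g, σ (k * g) = σ (k * r (σ g)) := fun g => hcompat k _ _ (hr _).symm
    have hinj : Function.Injective (fun i => σ (k * r i)) := by
      intro x y hxy
      have := hcompat k⁻¹ _ _ hxy
      simpa [hr] using this
    exact ⟨Equiv.ofBijective _ (Finite.injective_iff_bijective.1 hinj), fun g => key g⟩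
  choose τ hτ using hτ
  let F : V → Fin n → ℕ := fun v i => #{g : G | c (g⁻¹ • v) = j ∧ σ g = i}
  have hF : ∀ k v i, F (k • v) (τ k i) = F v i := by
    intro k v i
    refine Finset.card_bij' (fun g _ => k⁻¹ * g) (fun g _ => k * g) ?_ ?_ ?_ ?_
    · intro g
      have := hτ k (k⁻¹ * g)
      simp only [mul_inv_cancel_left] at this
      simp [mul_smul, this]
    · intro g; simp [mul_smul, hτ]
    · simp
    · simp
  let q : Fin n → ℕ := fun i => #{g : G | σ g = i}
  have hq : ∀ k i, q (τ k i) = q i := by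
    intro k i
    refine Finset.card_bij' (fun g _ => k⁻¹ * g) (fun g _ => k * g) ?_ ?_ ?_ ?_
    · intro g
      have := hτ k (k⁻¹ * g)
      simp only [mul_inv_cancel_left] at this
      simp [this]
    · intro g; simp [hτ]
    · simp
    · simp
  have hq' : ∀ i, q i = q j := by
    intro i
    obtain ⟨g, rfl⟩ := hsurj i
    obtain ⟨h, hh⟩ := hsurj j
    rw [← hh, ← hq (g * h⁻¹) (σ h), ← hτ]; simp
  have hqsum : n * q j = Fintype.card G := by
    rw [← Finset.card_univ, Finset.card_eq_sum_card_fiberwise (f := σ) (t := Finset.univ) (by simp)]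
    calc n * q j = ∑ _i : Fin n, q j := by simp
      _ = _ := Finset.sum_congr rfl (fun i _ => (hq' i).symm)
  have hqpos : 0 < q j := by
    rcases Nat.eq_zero_or_pos (q j) with h | h
    · rw [h] at hqsum; omega
    · exact h
  have hFsum : ∀ v, ∑ i, F v i ≤ q j := by
    intro v
    have e : ∑ i, F v i = #{g : G | c (g⁻¹ • v) = j} := by
      rw [Finset.card_eq_sum_card_fiberwise (f := σ) (t := Finset.univ) (by simp)]
      simp only [F, Finset.filter_filter]
    rw [e]
    have h1 := havg v
    rw [← hqsum] at h1
    have hV : 0 < Fintype.card V := by nlinarith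
    refine Nat.le_of_mul_le_mul_right (c := Fintype.card V) ?_ hV
    nlinarith
  have hbig : ∀ i, ∃ v, q j < 2 * F v i := by
    intro i
    by_contra hcon
    push Not at hcon
    have hdc : ∑ v : V with c v = i, F v i
        = ∑ g : G with σ g = i, #{v : V | c v = i ∧ c (g⁻¹ • v) = j} := by
      simp only [F, Finset.card_filter, Finset.sum_filter]
      simp only [ite_and]
      simp_rw [← Finset.sum_filter]
      simp only [Finset.sum_filter]
      have : ∀ v : V, (if c v = i then ∑ g : G, if c (g⁻¹ • v) = j then if σ g = i then 1 else 0 else 0 else 0)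
        = ∑ g : G, if c v = i then if c (g⁻¹ • v) = j then if σ g = i then 1 else 0 else 0 else 0 := by
        intro v; split_ifs <;> simp
      simp only [this]
      rw [Finset.sum_comm]
      refine Finset.sum_congr rfl fun g _ => ?_
      split_ifs <;> simp
    have hge : q j * (n * a i) < (n + 1) * ∑ v : V with c v = i, F v i := by
      rw [hdc, Finset.mul_sum]
      calc q j * (n * a i) = ∑ g : G with σ g = i, n * a i := by
            rw [Finset.sum_const, smul_eq_mul, ← hq' i]
        _ < _ := by
            refine Finset.sum_lt_sum_of_nonempty ?_ ?_
            · obtain ⟨g, hg⟩ := hsurj i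
              exact ⟨g, by simp [hg]⟩
            · intro g hg
              simp only [Finset.mem_filter, Finset.mem_univ, true_and] at hg
              have := hI g
              rwa [hg] at this
    have hle : 2 * ∑ v : V with c v = i, F v i ≤ a i * q j := by
      rw [Finset.mul_sum]
      calc _ ≤ ∑ v : V with c v = i, q j := Finset.sum_le_sum fun v _ => hcon v
        _ = _ := by simp [ha]
    nlinarith [Nat.zero_le (a i * q j)]
  have hex : ∀ v, ∃ i, q j < 2 * F v i := by
    intro v
    obtain ⟨v0, h0⟩ := hbig j
    obtain ⟨k, rfl⟩ := htrans v0 v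
    exact ⟨τ k j, by rwa [hF]⟩
  have hun : ∀ v i i', q j < 2 * F v i → q j < 2 * F v i' → i = i' := by
    intro v i i' h1 h2
    by_contra hne
    have h3 : ∑ x ∈ ({i, i'} : Finset (Fin n)), F v x ≤ ∑ x, F v x :=
      Finset.sum_le_sum_of_subset (Finset.subset_univ _)
    rw [Finset.sum_pair hne] at h3
    have := hFsum v
    omega
  choose f hf using hex
  refine ⟨f, ?_, ?_⟩
  · intro i
    obtain ⟨v, hv⟩ := hbig i
    exact ⟨v, hun v _ _ (hf v) hv⟩
  · intro k
    refine ⟨τ k, fun v => hun _ _ _ (hf _) ?_⟩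
    rw [hF]; exact hf v

theorem core {V : Type*} [Fintype V] {n : ℕ} (hn : 2 ≤ n)
    {G : Type*} [Group G] [MulAction G V]
    (htrans : ∀ u v : V, ∃ g : G, g • u = v)
    (hnoimp : ¬ ∃ B : Fin n → Set V, IsNPartition n B ∧
        ∀ g : G, ∃ σ : Equiv.Perm (Fin n), ∀ i, g • B i = B (σ i))
    (b : Set V → ℝ) (hb0 : ∀ A, 0 ≤ b A) (hbinv : ∀ (g : G) A, b (g • A) = b A)
    (hsub : ∀ A B, b (A \ B) ≤ b A + b B)
    (A : Fin n → Set V) (hA : IsNPartition n A) (r : ℝ)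
    (hr : ∀ i, b (A i) / ((A i).ncard : ℝ) ≤ r) :
    ∃ A' : Fin (n + 1) → Set V, IsNPartition (n + 1) A' ∧
      ∀ i, b (A' i) / ((A' i).ncard : ℝ) ≤ 2 * (n + 1) * r := by
  classical
  by_contra hcon
  obtain ⟨hne, hdisj, hcov⟩ := hA
  have hApos : ∀ i, 0 < (A i).ncard := fun i => (Set.ncard_pos (Set.toFinite _)).2 (hne i)
  have hr' : ∀ i, b (A i) ≤ r * (A i).ncard := fun i => by
    have := hApos i
    rw [← div_le_iff₀ (by exact_mod_cast this)]; exact hr i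
  haveI : Nonempty (Fin n) := ⟨⟨0, by omega⟩⟩
  have hr0 : 0 ≤ r := (div_nonneg (hb0 _) (Nat.cast_nonneg _)).trans (hr (Classical.arbitrary _))
  obtain ⟨j, hj⟩ := Finite.exists_min (fun i => (A i).ncard)
  have hsm : ∀ g : G, (g • A j).ncard = (A j).ncard := fun g => by
    rw [← Set.image_smul]
    exact Set.ncard_image_of_injective _ (MulAction.injective g)
  have hkey : ∀ g : G, ∃ i, (n + 1) * (A i \ g • A j).ncard < (A i).ncard := by
    intro g
    by_contra hno
    push Not at hno
    apply hcon
    have hpos' : ∀ i, 0 < (A i \ g • A j).ncard := by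
      intro i
      rcases Nat.eq_zero_or_pos (A i \ g • A j).ncard with h | h
      · have := hno i; have := hApos i; rw [h] at *; omega
      · exact h
    refine ⟨Fin.cons (g • A j) (fun i => A i \ g • A j), ⟨?_, ?_, ?_⟩, ?_⟩
    · intro i
      refine Fin.cases ?_ (fun i => ?_) i
      · simpa using (hne j).smul_set (a := g)
      · simpa using (Set.ncard_pos (Set.toFinite _)).1 (hpos' i)
    · intro i i'
      refine Fin.cases ?_ (fun i => ?_) i <;> refine Fin.cases ?_ (fun i' => ?_) i'
      · simp
      · intro _
        simpa using Set.disjoint_sdiff_right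
      · intro _
        simpa using Set.disjoint_sdiff_left
      · intro h
        simp only [Fin.cons_succ]
        exact (hdisj i i' (fun e => h (by rw [e]))).mono Set.diff_subset Set.diff_subset
    · rw [Set.eq_univ_iff_forall] at hcov ⊢
      intro v
      by_cases hv : v ∈ g • A j
      · exact Set.mem_iUnion.2 ⟨0, by simpa using hv⟩
      · obtain ⟨i, hi⟩ := Set.mem_iUnion.1 (hcov v)
        exact Set.mem_iUnion.2 ⟨i.succ, by simpa using ⟨hi, hv⟩⟩
    · have hn0 : (0 : ℝ) ≤ n := Nat.cast_nonneg n
      intro i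
      refine Fin.cases ?_ (fun i => ?_) i
      · simp only [Fin.cons_zero]
        rw [hbinv, hsm]
        refine (hr j).trans ?_
        nlinarith [mul_nonneg hn0 hr0]
      · simp only [Fin.cons_succ]
        have hp : (0 : ℝ) < (A i \ g • A j).ncard := by exact_mod_cast hpos' i
        rw [div_le_iff₀ hp]
        have h1 := hsub (A i) (g • A j)
        rw [hbinv] at h1
        have h2 := hr' i
        have h3 := hr' j
        have h4 : ((A j).ncard : ℝ) ≤ (A i).ncard := by exact_mod_cast hj i
        have h5 : ((A i).ncard : ℝ) ≤ (n + 1) * (A i \ g • A j).ncard := by exact_mod_cast hno i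
        have h6 := mul_le_mul_of_nonneg_left h4 hr0
        have h7 := mul_le_mul_of_nonneg_left h5 hr0
        linarith
  -- colouring
  have hc : ∀ v, ∃ i, v ∈ A i := fun v => Set.mem_iUnion.1 (hcov ▸ Set.mem_univ v)
  choose c hc using hc
  have hmem : ∀ v i, v ∈ A i ↔ c v = i := by
    intro v i
    constructor
    · intro h
      by_contra hne'
      exact Set.disjoint_left.1 (hdisj _ _ hne') (hc v) h
    · rintro rfl; exact hc v
  have hcardA : ∀ i, (A i).ncard = (Finset.univ.filter (fun v => c v = i)).card := by
    intro i
    rw [← Set.ncard_coe_finset]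
    congr 1; ext v; simp [hmem]
  let H : Subgroup (Equiv.Perm V) := (MulAction.toPermHom G V).range
  haveI : Fintype H := Fintype.ofFinite H
  have htr : ∀ u v : V, ∃ h : H, h • u = v := by
    intro u v
    obtain ⟨g, hg⟩ := htrans u v
    exact ⟨⟨MulAction.toPermHom G V g, ⟨g, rfl⟩⟩, hg⟩
  have hkeyH : ∀ h : H, ∃ i, (n + 1) * (Finset.univ.filter
      (fun v => c v = i ∧ ¬ c (h⁻¹ • v) = j)).card
      < (Finset.univ.filter (fun v => c v = i)).card := by
    rintro ⟨_, g, rfl⟩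
    obtain ⟨i, hi⟩ := hkey g
    refine ⟨i, ?_⟩
    rw [hcardA] at hi
    convert hi using 2
    rw [← Set.ncard_coe_finset]
    congr 1; ext v
    have : (⟨MulAction.toPermHom G V g, ⟨g, rfl⟩⟩ : H)⁻¹ • v = g⁻¹ • v := rfl
    simp only [Finset.coe_filter, Finset.mem_univ, true_and, Set.mem_setOf_eq, Set.mem_diff, hmem,
      Set.mem_smul_set_iff_inv_smul_mem]
    rw [← this]
  choose σ hσ using hkeyH
  obtain ⟨f, hfs, hf⟩ := comb htr hn c j (by rw [← hcardA]; exact hApos j)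
    (fun i => by rw [← hcardA, ← hcardA]; exact hj i) σ hσ
  apply hnoimp
  refine ⟨fun i => {v | f v = i}, ⟨fun i => hfs i, ?_, ?_⟩, ?_⟩
  · intro i i' h
    rw [Set.disjoint_left]
    rintro v rfl h'
    exact h h'
  · rw [Set.eq_univ_iff_forall]
    intro v
    exact Set.mem_iUnion.2 ⟨f v, rfl⟩
  · intro g
    obtain ⟨τ, hτ⟩ := hf ⟨MulAction.toPermHom G V g, ⟨g, rfl⟩⟩
    refine ⟨τ, fun i => ?_⟩
    ext v
    rw [Set.mem_smul_set_iff_inv_smul_mem]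
    have := hτ (g⁻¹ • v)
    have h2 : (⟨MulAction.toPermHom G V g, ⟨g, rfl⟩⟩ : H) • (g⁻¹ • v) = v :=
      smul_inv_smul g v
    rw [h2] at this
    simp [this]

theorem exists_partition {V : Type*} [Fintype V] (n : ℕ) (hn : 2 ≤ n)
    (hcard : n ≤ Fintype.card V) : ∃ A : Fin n → Set V, IsNPartition n A := by
  haveI : Nonempty (Fin n) := ⟨⟨0, by omega⟩⟩
  obtain ⟨e⟩ : Nonempty (Fin n ↪ V) := by
    rw [Function.Embedding.nonempty_iff_card_le]; simpa using hcard
  refine ⟨fun i => {v | Function.invFun e v = i},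
    fun i => ⟨e i, Function.leftInverse_invFun e.injective i⟩, ?_, ?_⟩
  · intro i i' h
    rw [Set.disjoint_left]
    rintro v rfl h'
    exact h h'
  · rw [Set.eq_univ_iff_forall]
    intro v
    exact Set.mem_iUnion.2 ⟨_, rfl⟩

theorem final_step {V : Type*} [Fintype V] {n : ℕ} (hn : 2 ≤ n) (hcard : n + 1 ≤ Fintype.card V)
    {G : Type*} [Group G] [MulAction G V]
    (htrans : ∀ u v : V, ∃ g : G, g • u = v)
    (hnoimp : ¬ ∃ B : Fin n → Set V, IsNPartition n B ∧
        ∀ g : G, ∃ σ : Equiv.Perm (Fin n), ∀ i, g • B i = B (σ i))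
    (b : Set V → ℝ) (hb0 : ∀ A, 0 ≤ b A) (hbinv : ∀ (g : G) A, b (g • A) = b A)
    (hsub : ∀ A B, b (A \ B) ≤ b A + b B) :
    sInf {r | ∃ A : Fin (n + 1) → Set V, IsNPartition (n + 1) A ∧
        r = ⨆ i, b (A i) / ((A i).ncard : ℝ)} ≤
      2 * (n + 1) * sInf {r | ∃ A : Fin n → Set V, IsNPartition n A ∧
        r = ⨆ i, b (A i) / ((A i).ncard : ℝ)} := by
  have hpos : (0 : ℝ) < 2 * (n + 1) := by positivity
  rw [← div_le_iff₀' hpos]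
  apply le_csInf
  · obtain ⟨A, hA⟩ := exists_partition (V := V) n hn (by omega)
    exact ⟨_, A, hA, rfl⟩
  · rintro _ ⟨A, hA, rfl⟩
    rw [div_le_iff₀' hpos]
    obtain ⟨A', hA', h⟩ := core hn htrans hnoimp b hb0 hbinv hsub A hA
      (⨆ i, b (A i) / ((A i).ncard : ℝ)) (fun i => le_ciSup (f := fun i => b (A i) / ((A i).ncard : ℝ))
        (Set.finite_range _).bddAbove i)
    refine le_trans (csInf_le ?_ ⟨A', hA', rfl⟩) (ciSup_le h)
    refine ⟨0, ?_⟩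
    rintro _ ⟨A, -, rfl⟩
    exact Real.iSup_nonneg fun i => div_nonneg (hb0 _) (Nat.cast_nonneg _)

theorem edgeBdry_diff {V : Type*} (Γ : SimpleGraph V) (A B : Set V) :
    edgeBdry Γ (A \ B) ⊆ edgeBdry Γ A ∪ edgeBdry Γ B := by
  rintro e ⟨he, u, v, rfl, hu, hv⟩
  by_cases hvA : v ∈ A
  · have hvB : v ∈ B := by
      by_contra h; exact hv ⟨hvA, h⟩
    exact Or.inr ⟨he, v, u, Sym2.eq_swap, hvB, hu.2⟩
  · exact Or.inl ⟨he, u, v, rfl, hu.1, hvA⟩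

theorem vertBdry_diff {V : Type*} (Γ : SimpleGraph V) (A B : Set V) :
    vertBdry Γ (A \ B) ⊆ vertBdry Γ A ∪ vertBdry Γ B := by
  rintro x ⟨y, hxy, h⟩
  by_cases hA : x ∈ A ↔ y ∈ A
  · by_cases hB : x ∈ B ↔ y ∈ B
    · exact absurd (by simp [hA, hB]) h
    · exact Or.inr ⟨y, hxy, hB⟩
  · exact Or.inl ⟨y, hxy, hA⟩

theorem edgeBdry_smul {V : Type*} (Γ : SimpleGraph V) {G : Type*} [Group G] [MulAction G V]
    (hact : ∀ (g : G) (u v : V), Γ.Adj (g • u) (g • v) ↔ Γ.Adj u v) (g : G) (A : Set V) :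
    edgeBdry Γ (g • A) = Sym2.map (g • ·) '' edgeBdry Γ A := by
  ext e
  constructor
  · rintro ⟨he, u, v, rfl, hu, hv⟩
    rw [Set.mem_smul_set_iff_inv_smul_mem] at hu hv
    refine ⟨s(g⁻¹ • u, g⁻¹ • v), ⟨?_, _, _, rfl, hu, hv⟩, by simp⟩
    rw [SimpleGraph.mem_edgeSet] at he ⊢
    exact (hact _ _ _).2 he
  · rintro ⟨_, ⟨he, u, v, rfl, hu, hv⟩, rfl⟩
    refine ⟨?_, g • u, g • v, by simp, Set.smul_mem_smul_set hu, by simpa using hv⟩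
    rw [SimpleGraph.mem_edgeSet] at he
    rw [Sym2.map_mk, SimpleGraph.mem_edgeSet]
    exact (hact _ _ _).2 he

theorem vertBdry_smul {V : Type*} (Γ : SimpleGraph V) {G : Type*} [Group G] [MulAction G V]
    (hact : ∀ (g : G) (u v : V), Γ.Adj (g • u) (g • v) ↔ Γ.Adj u v) (g : G) (A : Set V) :
    vertBdry Γ (g • A) = g • vertBdry Γ A := by
  ext x
  rw [Set.mem_smul_set_iff_inv_smul_mem]
  constructor
  · rintro ⟨y, hxy, h⟩
    rw [Set.mem_smul_set_iff_inv_smul_mem, Set.mem_smul_set_iff_inv_smul_mem] at h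
    exact ⟨g⁻¹ • y, (hact _ _ _).2 hxy, h⟩
  · rintro ⟨y, hxy, h⟩
    refine ⟨g • y, ?_, ?_⟩
    · rw [← hact g] at hxy; simpa using hxy
    · rw [Set.mem_smul_set_iff_inv_smul_mem, Set.mem_smul_set_iff_inv_smul_mem]; simpa using h

theorem no_imprimitivity_implies_no_gap {V : Type*} [Fintype V] (Γ : SimpleGraph V)
    (n : ℕ) (hn : 2 ≤ n) (hcard : n + 1 ≤ Fintype.card V)
    (G : Type*) [Group G] [MulAction G V]
    (hact : ∀ (g : G) (u v : V), Γ.Adj (g • u) (g • v) ↔ Γ.Adj u v)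
    (htrans : ∀ u v : V, ∃ g : G, g • u = v)
    (hnoimp : ¬ ∃ B : Fin n → Set V, IsNPartition n B ∧
        ∀ g : G, ∃ σ : Equiv.Perm (Fin n), ∀ i, g • B i = B (σ i)) :
    multiH Γ (n + 1) ≤ 2 * (n + 1) * multiH Γ n ∧
      multiIota Γ (n + 1) ≤ 2 * (n + 1) * multiIota Γ n := by
  constructor
  · refine final_step hn hcard htrans hnoimp (fun A => ((edgeBdry Γ A).ncard : ℝ))
      (fun A => Nat.cast_nonneg _) ?_ ?_
    · intro g A
      simp only [edgeBdry_smul Γ hact]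
      rw [Set.ncard_image_of_injective _ (Sym2.map.injective (MulAction.injective g))]
    · intro A B
      have := (Set.ncard_le_ncard (edgeBdry_diff Γ A B) (Set.toFinite _)).trans
        (Set.ncard_union_le _ _)
      exact_mod_cast this
  · refine final_step hn hcard htrans hnoimp (fun A => ((vertBdry Γ A).ncard : ℝ))
      (fun A => Nat.cast_nonneg _) ?_ ?_
    · intro g A
      simp only [vertBdry_smul Γ hact]
      rw [← Set.image_smul, Set.ncard_image_of_injective _ (MulAction.injective g)]
    · intro A B
      have := (Set.ncard_le_ncard (vertBdry_diff Γ A B) (Set.toFinite _)).trans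
        (Set.ncard_union_le _ _)
      exact_mod_cast this

end Multiway
end

section
/- Let Γ be a finite vertex-transitive graph (possibly disconnected) on vertex set V, let 2 ≤ n ≤ |V| − 1, and let G be a group acting on Γ by graph automorphisms whose action on V is transitive. Assume G admits no transitive action on an n-point set. Then h_{n+1}(Γ) ≤ 2(n+1)·h_n(Γ) and ι_{n+1}(Γ) ≤ 2(n+1)·ι_n(Γ). -/
open scoped Pointwise

namespace Multiway

variable {V : Type*}

section aux

open scoped Classical

lemma ncard_inter_smul {V P : Type*} [Group P] [MulAction P V] (g k : P) (A B : Set V) :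
    ((g • A) ∩ (k • B)).ncard = (((k⁻¹ * g) • A) ∩ B).ncard := by
  have : (g • A) ∩ (k • B) = k • (((k⁻¹ * g) • A) ∩ B) := by
    rw [Set.smul_set_inter, smul_smul]; simp
  rw [this, Set.ncard_smul_set]

lemma avg_inter {V P : Type*} [Fintype V] [Group P] [Fintype P] [MulAction P V]
    (htr : ∀ u v : V, ∃ g : P, g • u = v) (A : Set V) :
    Fintype.card V * ∑ g : P, ((g • A) ∩ A).ncard = Fintype.card P * (A.ncard * A.ncard) := by
  have hN : ∀ x y : V, Fintype.card V * (Finset.univ.filter fun g : P => g • x = y).card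
      = Fintype.card P := by
    intro x y
    have h1 : ∀ z, (Finset.univ.filter fun g : P => g • x = z).card
        = (Finset.univ.filter fun g : P => g • x = y).card := by
      intro z
      obtain ⟨k, hk⟩ := htr z y
      refine Finset.card_bij (fun g _ => k * g) ?_ ?_ ?_
      · intro g hg
        simp only [Finset.mem_filter, Finset.mem_univ, true_and] at hg ⊢
        rw [mul_smul, hg, hk]
      · intro a _ b _ h
        exact mul_left_cancel h
      · intro b hb
        simp only [Finset.mem_filter, Finset.mem_univ, true_and] at hb
        refine ⟨k⁻¹ * b, ?_, by simp⟩
        simp only [Finset.mem_filter, Finset.mem_univ, true_and]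
        rw [mul_smul, hb, ← hk, inv_smul_smul]
    have h2 := Finset.card_eq_sum_card_fiberwise (s := (Finset.univ : Finset P))
      (t := (Finset.univ : Finset V)) (f := fun g => g • x) (fun _ _ => by simp)
    rw [Finset.sum_congr rfl (fun z _ => h1 z)] at h2
    simpa using h2.symm
  have h3 : ∀ g : P, ((g • A) ∩ A).ncard
      = ∑ x ∈ A.toFinset, ∑ y ∈ A.toFinset, if g • x = y then 1 else 0 := by
    intro g
    have e : (g • A) ∩ A = ((A.toFinset.filter fun x => g • x ∈ A).image (fun x => g • x) :
        Finset V) := by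
      ext y
      simp only [Set.mem_inter_iff, Set.mem_smul_set, Finset.coe_image, Finset.coe_filter,
        Set.mem_toFinset, Set.mem_image, Set.mem_setOf_eq]
      constructor
      · rintro ⟨⟨x, hx, rfl⟩, h⟩
        exact ⟨x, ⟨hx, h⟩, rfl⟩
      · rintro ⟨x, ⟨hx, h⟩, rfl⟩
        exact ⟨⟨x, hx, rfl⟩, h⟩
    rw [e, Set.ncard_coe_finset, Finset.card_image_of_injective _ (MulAction.injective g),
      Finset.card_filter]
    refine Finset.sum_congr rfl fun x _ => ?_
    rw [Finset.sum_ite_eq]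
    simp
  have h4 : ∑ g : P, ((g • A) ∩ A).ncard = ∑ x ∈ A.toFinset, ∑ y ∈ A.toFinset,
      (Finset.univ.filter fun g : P => g • x = y).card := by
    rw [Finset.sum_congr rfl (fun g _ => h3 g), Finset.sum_comm]
    refine Finset.sum_congr rfl fun x _ => ?_
    rw [Finset.sum_comm]
    refine Finset.sum_congr rfl fun y _ => ?_
    rw [Finset.card_filter]
  rw [h4, Finset.mul_sum]
  simp only [Finset.mul_sum, hN]
  rw [Set.ncard_eq_toFinset_card' A]
  simp only [Finset.sum_const, smul_eq_mul]
  ring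

lemma dichotomy {V P : Type*} [Fintype V] [Group P] [Fintype P] [MulAction P V]
    (htr : ∀ u v : V, ∃ g : P, g • u = v) (n : ℕ) (hn : 2 ≤ n)
    (A : Fin n → Set V) (hA : IsNPartition n A) (i₀ : Fin n)
    (hmin : ∀ i, (A i₀).ncard ≤ (A i).ncard)
    (hno : ¬ ∃ ρ : P →* Equiv.Perm (Fin n), ∀ i j : Fin n, ∃ g : P, ρ g i = j) :
    ∃ g : P, ∀ i, (A i).ncard ≤ (n + 1) * (A i \ g • A i₀).ncard := by
  by_contra hcon
  push Not at hcon
  choose c hc using hcon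
  obtain ⟨hne, hdis, hun⟩ := hA
  set a := (A i₀).ncard with ha
  have hapos : 0 < a := (Set.ncard_pos).2 (hne i₀)
  have hsm : ∀ g : P, (g • A i₀).ncard = a := fun g => Set.ncard_smul_set _ _
  have hbig : ∀ g : P, n * (A (c g)).ncard < (n + 1) * ((g • A i₀) ∩ A (c g)).ncard := by
    intro g
    have h1 := Set.ncard_inter_add_ncard_diff_eq_ncard (A (c g)) (g • A i₀) (Set.toFinite _)
    have h2 := hc g
    rw [Set.inter_comm] at h1
    nlinarith
  have hself : ∀ g : P, (n - 1) * a < (n + 1) * ((g • A i₀) ∩ A i₀).ncard →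
      n * a < (n + 1) * ((g • A i₀) ∩ A i₀).ncard := by
    intro g hg
    by_cases hi : c g = i₀
    · have := hbig g
      rwa [hi] at this
    · exfalso
      have h1 := hbig g
      have h2 := hmin (c g)
      have h3 : ((g • A i₀) ∩ A i₀).ncard + ((g • A i₀) ∩ A (c g)).ncard ≤ a := by
        rw [← Set.ncard_union_eq, ← hsm g]
        · exact Set.ncard_le_ncard (Set.union_subset Set.inter_subset_left Set.inter_subset_left)
        · exact ((hdis _ _ hi).symm).mono Set.inter_subset_right Set.inter_subset_right
      obtain ⟨k, rfl⟩ : ∃ k, n = k + 2 := ⟨n - 2, by omega⟩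
      have : k + 2 - 1 = k + 1 := by omega
      rw [this] at hg
      nlinarith [Nat.mul_le_mul_left (k+2) h2, Nat.mul_le_mul_left (k+2+1) h3, Nat.zero_le (k * a)]
  let H : Subgroup P :=
    { carrier := {g | n * a < (n + 1) * ((g • A i₀) ∩ A i₀).ncard}
      one_mem' := by
        simp only [Set.mem_setOf_eq, one_smul, Set.inter_self]
        nlinarith
      inv_mem' := by
        intro g hg
        simp only [Set.mem_setOf_eq] at hg ⊢
        have := ncard_inter_smul (1 : P) g (A i₀) (A i₀)
        rw [one_smul, mul_one, Set.inter_comm] at this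
        rwa [← this]
      mul_mem' := by
        intro g k hg hk
        simp only [Set.mem_setOf_eq] at hg hk ⊢
        apply hself
        have h1 := ncard_inter_smul (g * k) g (A i₀) (A i₀)
        rw [inv_mul_cancel_left] at h1
        rw [← h1] at hk
        have h2 : (((g * k) • A i₀) ∩ (g • A i₀)).ncard + ((g • A i₀) ∩ A i₀).ncard
            ≤ a + (((g * k) • A i₀) ∩ A i₀).ncard := by
          rw [← Set.ncard_union_add_ncard_inter]
          apply Nat.add_le_add
          · rw [← hsm g]
            exact Set.ncard_le_ncard
              (Set.union_subset Set.inter_subset_right Set.inter_subset_left)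
          · exact Set.ncard_le_ncard fun x hx => ⟨hx.1.1, hx.2.2⟩
        obtain ⟨q, rfl⟩ : ∃ q, n = q + 1 := ⟨n - 1, by omega⟩
        have : q + 1 - 1 = q := by omega
        rw [this]
        nlinarith [Nat.mul_le_mul_left (q+1+1) h2] }
  have hHmem : ∀ g, g ∈ H ↔ n * a < (n + 1) * ((g • A i₀) ∩ A i₀).ncard := fun g => Iff.rfl
  have hinj : Function.Injective (fun q : P ⧸ H => c q.out) := by
    intro q r hqr
    simp only at hqr
    rw [← Quotient.out_eq' q, ← Quotient.out_eq' r]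
    apply Eq.symm
    change ((r.out : P) : P ⧸ H) = ((q.out : P) : P ⧸ H)
    rw [QuotientGroup.eq, hHmem]
    apply hself
    rw [← ncard_inter_smul]
    have h1 := hbig q.out
    have h2 := hbig r.out
    rw [← hqr] at h2
    have h4 := hmin (c q.out)
    have h3 : ((q.out • A i₀) ∩ A (c q.out)).ncard + ((r.out • A i₀) ∩ A (c q.out)).ncard
        ≤ (A (c q.out)).ncard + ((q.out • A i₀) ∩ (r.out • A i₀)).ncard := by
      rw [← Set.ncard_union_add_ncard_inter]
      apply Nat.add_le_add
      · exact Set.ncard_le_ncard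
          (Set.union_subset Set.inter_subset_right Set.inter_subset_right)
      · exact Set.ncard_le_ncard fun x hx => ⟨hx.1.1, hx.2.1⟩
    obtain ⟨k, rfl⟩ : ∃ q, n = q + 1 := ⟨n - 1, by omega⟩
    have : k + 1 - 1 = k := by omega
    rw [this]
    nlinarith [Nat.mul_le_mul_left (k+1+1) h3, Nat.mul_le_mul_left k h4]
  have hle : Nat.card (P ⧸ H) ≤ n := by
    simpa using Nat.card_le_card_of_injective _ hinj
  have hV : n * a ≤ Fintype.card V := by
    have h1 : ∑ i, (A i).ncard ≤ Fintype.card V := by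
      have := Finset.card_biUnion (s := (Finset.univ : Finset (Fin n)))
        (t := fun i => (A i).toFinset) (by
          intro i _ j _ hij
          simpa using hdis i j hij)
      simp only [Set.ncard_eq_toFinset_card']
      rw [← this]
      exact Finset.card_le_univ _
    have h2 : ∑ _i : Fin n, a ≤ ∑ i, (A i).ncard := Finset.sum_le_sum fun i _ => hmin i
    simp at h2
    omega
  have hge : n ≤ Nat.card (P ⧸ H) := by
    have h1 := avg_inter htr (A i₀)
    have h2 : Nat.card H * (n * a) ≤ (n + 1) * ∑ g : P, ((g • A i₀) ∩ A i₀).ncard := by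
      rw [Finset.mul_sum]
      calc Nat.card H * (n * a) = ∑ g ∈ Finset.univ.filter (fun g : P => g ∈ H), n * a := by
            rw [Finset.sum_const, smul_eq_mul, Nat.card_eq_fintype_card, Fintype.card_subtype]
        _ ≤ ∑ g ∈ Finset.univ.filter (fun g : P => g ∈ H),
              (n + 1) * ((g • A i₀) ∩ A i₀).ncard := by
            refine Finset.sum_le_sum fun g hg => ?_
            simp only [Finset.mem_filter, Finset.mem_univ, true_and] at hg
            exact le_of_lt hg
        _ ≤ _ := Finset.sum_le_sum_of_subset (Finset.subset_univ _)
    have h3 : Fintype.card P = Nat.card (P ⧸ H) * Nat.card H := by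
      rw [← Nat.card_eq_fintype_card]; exact Subgroup.card_eq_card_quotient_mul_card_subgroup H
    have hHpos : 0 < Nat.card H := Nat.card_pos
    set m := Nat.card (P ⧸ H)
    set s := Nat.card H
    set S := ∑ g : P, ((g • A i₀) ∩ A i₀).ncard
    rw [h3, ← ha] at h1
    have h4 : (s * a * a) * (n * n) ≤ (s * a * a) * ((n + 1) * m) := by
      calc (s * a * a) * (n * n) = (n * a) * (s * (n * a)) := by ring
        _ ≤ Fintype.card V * ((n + 1) * S) := Nat.mul_le_mul hV h2
        _ = (n + 1) * (Fintype.card V * S) := by ring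
        _ = _ := by rw [h1]; ring
    have h5 : n * n ≤ (n + 1) * m := Nat.le_of_mul_le_mul_left h4 (by positivity)
    by_contra hlt
    push Not at hlt
    nlinarith
  have hcardeq : Nat.card (P ⧸ H) = n := le_antisymm hle hge
  let e : P ⧸ H ≃ Fin n := Finite.equivFinOfCardEq hcardeq
  apply hno
  refine ⟨(e.permCongrHom.toMonoidHom).comp (MulAction.toPermHom P (P ⧸ H)), ?_⟩
  intro i j
  obtain ⟨g, hg⟩ := MulAction.exists_smul_eq P (e.symm i) (e.symm j)
  refine ⟨g, ?_⟩
  simp [Equiv.permCongrHom, hg]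

lemma refine_partition {V G : Type*} [Fintype V] [Group G] [MulAction G V]
    (htr : ∀ u v : V, ∃ g : G, g • u = v) (n : ℕ) (hn : 2 ≤ n)
    (hno : ¬ ∃ ρ : G →* Equiv.Perm (Fin n), ∀ i j : Fin n, ∃ g : G, ρ g i = j)
    (bd : Set V → ℕ) (hbd : ∀ A B, bd (A \ B) ≤ bd A + bd B)
    (hinv : ∀ (g : G) A, bd (g • A) = bd A)
    (A : Fin n → Set V) (hA : IsNPartition n A) (h : ℝ)
    (hh : ∀ i, (bd (A i) : ℝ) / ((A i).ncard : ℝ) ≤ h) :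
    ∃ B : Fin (n + 1) → Set V, IsNPartition (n + 1) B ∧
      ∀ i, (bd (B i) : ℝ) / ((B i).ncard : ℝ) ≤ 2 * (n + 1) * h := by
  haveI : Nonempty (Fin n) := ⟨⟨0, by omega⟩⟩
  obtain ⟨i₀, hmin⟩ := Finite.exists_min (fun i => (A i).ncard)
  obtain ⟨g, hg⟩ : ∃ g : G, ∀ i, (A i).ncard ≤ (n + 1) * (A i \ g • A i₀).ncard := by
    let P := (MulAction.toPermHom G V).range
    have htr' : ∀ u v : V, ∃ p : P, p • u = v := by
      intro u v
      obtain ⟨g, hg⟩ := htr u v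
      exact ⟨⟨MulAction.toPermHom G V g, g, rfl⟩, hg⟩
    have hno' : ¬ ∃ ρ : P →* Equiv.Perm (Fin n), ∀ i j : Fin n, ∃ g : P, ρ g i = j := by
      rintro ⟨ρ, hρ⟩
      refine hno ⟨ρ.comp (MulAction.toPermHom G V).rangeRestrict, fun i j => ?_⟩
      obtain ⟨⟨_, g, rfl⟩, hp⟩ := hρ i j
      exact ⟨g, hp⟩
    obtain ⟨⟨_, g, rfl⟩, hp⟩ := dichotomy htr' n hn A hA i₀ hmin hno'
    exact ⟨g, hp⟩
  obtain ⟨hne, hdis, hun⟩ := hA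
  have hpos : ∀ i, 0 < (A i).ncard := fun i => (Set.ncard_pos).2 (hne i)
  have hpos' : ∀ i, 0 < (A i \ g • A i₀).ncard := fun i => by
    have := hg i
    have := hpos i
    by_contra hc
    have : (A i \ g • A i₀).ncard = 0 := by omega
    simp_all
  have hh0 : 0 ≤ h := le_trans (by positivity) (hh i₀)
  have hh' : ∀ i, (bd (A i) : ℝ) ≤ h * (A i).ncard := fun i =>
    (div_le_iff₀ (by exact_mod_cast hpos i)).1 (hh i)
  refine ⟨Fin.cons (g • A i₀) (fun i => A i \ g • A i₀), ⟨?_, ?_, ?_⟩, ?_⟩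
  · intro i
    refine Fin.cases ?_ (fun i => ?_) i
    · simpa using hne i₀
    · simpa using (Set.ncard_pos).1 (hpos' i)
  · intro i j
    refine Fin.cases ?_ (fun i => ?_) i <;> refine Fin.cases ?_ (fun j => ?_) j
    · simp
    · intro _
      simpa using Set.disjoint_sdiff_right
    · intro _
      simpa using Set.disjoint_sdiff_left
    · intro hij
      simp only [Fin.cons_succ]
      exact (hdis i j fun h => hij (by rw [h])).mono Set.diff_subset Set.diff_subset
  · ext x
    simp only [Set.mem_iUnion, Set.mem_univ, iff_true]
    by_cases hx : x ∈ g • A i₀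
    · exact ⟨0, by simpa using hx⟩
    · have : x ∈ ⋃ i, A i := hun ▸ Set.mem_univ x
      obtain ⟨i, hi⟩ := Set.mem_iUnion.1 this
      exact ⟨i.succ, by simpa only [Fin.cons_succ] using ⟨hi, hx⟩⟩
  · intro i
    refine Fin.cases ?_ (fun i => ?_) i
    · simp only [Fin.cons_zero]
      rw [hinv, Set.ncard_smul_set]
      refine (hh i₀).trans ?_
      have : (0 : ℝ) ≤ n := by positivity
      nlinarith
    · simp only [Fin.cons_succ]
      rw [div_le_iff₀ (by exact_mod_cast hpos' i)]
      have h1 : (bd (A i \ g • A i₀) : ℝ) ≤ bd (A i) + bd (A i₀) := by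
        have := hbd (A i) (g • A i₀)
        rw [hinv] at this
        exact_mod_cast this
      have h2 : ((A i).ncard : ℝ) ≤ (n + 1) * (A i \ g • A i₀).ncard := by exact_mod_cast hg i
      have h3 : ((A i₀).ncard : ℝ) ≤ (A i).ncard := by exact_mod_cast hmin i
      have h4 := hh' i
      have h5 := hh' i₀
      have h6 := mul_le_mul_of_nonneg_left h2 hh0
      have h7 := mul_le_mul_of_nonneg_left h3 hh0
      linarith

lemma sInf_bound {V G : Type*} [Fintype V] [Group G] [MulAction G V]
    (htr : ∀ u v : V, ∃ g : G, g • u = v) (n : ℕ) (hn : 2 ≤ n) (hcard : n + 1 ≤ Fintype.card V)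
    (hno : ¬ ∃ ρ : G →* Equiv.Perm (Fin n), ∀ i j : Fin n, ∃ g : G, ρ g i = j)
    (bd : Set V → ℕ) (hbd : ∀ A B, bd (A \ B) ≤ bd A + bd B)
    (hinv : ∀ (g : G) A, bd (g • A) = bd A) :
    sInf {r : ℝ | ∃ A : Fin (n + 1) → Set V, IsNPartition (n + 1) A ∧
        r = ⨆ i, (bd (A i) : ℝ) / ((A i).ncard : ℝ)} ≤
      2 * (n + 1) * sInf {r : ℝ | ∃ A : Fin n → Set V, IsNPartition n A ∧
        r = ⨆ i, (bd (A i) : ℝ) / ((A i).ncard : ℝ)} := by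
  have hp : (0 : ℝ) < 2 * (n + 1) := by positivity
  rw [← div_le_iff₀' hp]
  apply le_csInf
  · haveI : Nonempty (Fin n) := ⟨⟨0, by omega⟩⟩
    obtain ⟨f⟩ : Nonempty (Fin n ↪ V) := Function.Embedding.nonempty_of_card_le (by simp; omega)
    have hs : Function.Surjective (Function.invFun f) := Function.invFun_surjective f.injective
    refine ⟨_, fun i => Function.invFun f ⁻¹' {i}, ⟨?_, ?_, ?_⟩, rfl⟩
    · intro i
      obtain ⟨v, hv⟩ := hs i
      exact ⟨v, hv⟩
    · intro i j hij
      exact Disjoint.preimage _ (by simpa using hij)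
    · ext x
      simp
  · rintro _ ⟨A, hA, rfl⟩
    rw [div_le_iff₀' hp]
    obtain ⟨B, hB, hB'⟩ := refine_partition htr n hn hno bd hbd hinv A hA
      (⨆ i, (bd (A i) : ℝ) / ((A i).ncard : ℝ))
      (fun i => le_ciSup (f := fun i => (bd (A i) : ℝ) / ((A i).ncard : ℝ))
        (Set.finite_range _).bddAbove i)
    refine le_trans (csInf_le ⟨0, ?_⟩ ⟨B, hB, rfl⟩) (ciSup_le hB')
    rintro _ ⟨C, _, rfl⟩
    exact Real.iSup_nonneg fun i => by positivity

end aux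

theorem no_transitive_action_implies_no_gap {V : Type*} [Fintype V] (Γ : SimpleGraph V)
    (n : ℕ) (hn : 2 ≤ n) (hcard : n + 1 ≤ Fintype.card V)
    (G : Type*) [Group G] [MulAction G V]
    (hact : ∀ (g : G) (u v : V), Γ.Adj (g • u) (g • v) ↔ Γ.Adj u v)
    (htrans : ∀ u v : V, ∃ g : G, g • u = v)
    (hnotrans : ¬ ∃ ρ : G →* Equiv.Perm (Fin n), ∀ i j : Fin n, ∃ g : G, ρ g i = j) :
    multiH Γ (n + 1) ≤ 2 * (n + 1) * multiH Γ n ∧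
      multiIota Γ (n + 1) ≤ 2 * (n + 1) * multiIota Γ n := by
  constructor
  · refine sInf_bound htrans n hn hcard hnotrans (fun A => (edgeBdry Γ A).ncard) ?_ ?_
    · intro A B
      refine le_trans (Set.ncard_le_ncard ?_ (Set.toFinite _)) (Set.ncard_union_le _ _)
      rintro _ ⟨he, u, v, rfl, hu, hv⟩
      by_cases hvA : v ∈ A
      · have hvB : v ∈ B := by
          by_contra hvB
          exact hv ⟨hvA, hvB⟩
        exact Or.inr ⟨he, v, u, Sym2.eq_swap, hvB, hu.2⟩
      · exact Or.inl ⟨he, u, v, rfl, hu.1, hvA⟩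
    · intro g A
      have : edgeBdry Γ (g • A) = Sym2.map (fun x => g • x) '' edgeBdry Γ A := by
        ext e
        constructor
        · rintro ⟨he, u, v, rfl, hu, hv⟩
          refine ⟨s(g⁻¹ • u, g⁻¹ • v), ⟨?_, _, _, rfl, ?_, ?_⟩, by simp⟩
          · rw [SimpleGraph.mem_edgeSet] at he ⊢
            exact (hact _ _ _).2 he
          · exact Set.mem_smul_set_iff_inv_smul_mem.1 hu
          · exact fun h => hv (Set.mem_smul_set_iff_inv_smul_mem.2 h)
        · rintro ⟨_, ⟨he, u, v, rfl, hu, hv⟩, rfl⟩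
          refine ⟨?_, g • u, g • v, by simp, Set.smul_mem_smul_set hu, ?_⟩
          · rw [Sym2.map_mk, SimpleGraph.mem_edgeSet]
            exact (hact _ _ _).2 he
          · exact fun h => hv (Set.smul_mem_smul_set_iff.1 h)
      simp only [this]
      exact Set.ncard_image_of_injective _ (Sym2.map.injective (MulAction.injective g))
  · refine sInf_bound htrans n hn hcard hnotrans (fun A => (vertBdry Γ A).ncard) ?_ ?_
    · intro A B
      refine le_trans (Set.ncard_le_ncard ?_ (Set.toFinite _)) (Set.ncard_union_le _ _)
      rintro x ⟨y, hxy, h⟩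
      by_cases hA : (x ∈ A ↔ y ∈ A)
      · refine Or.inr ⟨y, hxy, fun hB => h ?_⟩
        simp only [Set.mem_diff, hA, hB]
      · exact Or.inl ⟨y, hxy, hA⟩
    · intro g A
      have : vertBdry Γ (g • A) = g • vertBdry Γ A := by
        ext x
        rw [Set.mem_smul_set_iff_inv_smul_mem]
        constructor
        · rintro ⟨y, hxy, h⟩
          refine ⟨g⁻¹ • y, (hact _ _ _).2 hxy, ?_⟩
          rwa [Set.mem_smul_set_iff_inv_smul_mem, Set.mem_smul_set_iff_inv_smul_mem] at h
        · rintro ⟨y, hxy, h⟩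
          refine ⟨g • y, ?_, ?_⟩
          · rw [← hact g, smul_inv_smul] at hxy
            exact hxy
          · rwa [Set.mem_smul_set_iff_inv_smul_mem, Set.mem_smul_set_iff_inv_smul_mem,
              inv_smul_smul]
      simp only [this]
      exact Set.ncard_smul_set _ _

end Multiway
end

section
/- There exists a universal constant C > 0 such that for every finite regular graph Γ = (V,E) and every integer n with 2 ≤ n ≤ |V|, one has C·n^6·λ_n(Γ) ≥ (√(ι̃_n(Γ) + 1) − 1)^2, where ι̃_n(Γ) = min max_{1≤i≤n} |δS_i|/|S_i|, the minimum being taken over all collections of n non-empty pairwise disjoint subsets S_1,…,S_n ⊆ V. -/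
open scoped Pointwise

namespace Multiway

variable {V : Type*}

/-- `ι̃_n(Γ)`: minimum of `max_i |δS_i|/|S_i|` over collections of `n` non-empty
pairwise disjoint subsets (not necessarily covering `V`). -/
noncomputable def tildeIota (G : SimpleGraph V) (n : ℕ) : ℝ :=
  sInf {r | ∃ S : Fin n → Set V, (∀ i, (S i).Nonempty) ∧
    (∀ i j, i ≠ j → Disjoint (S i) (S j)) ∧ r = vertRatioMax G S}

/-- The eigenvalues of the (nonnormalized) combinatorial Laplacian of `G`,
sorted in nondecreasing order, indexed so that position `0` holds `λ_1 = 0`. -/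
noncomputable def lapEigenSorted {V : Type*} [Fintype V] [DecidableEq V]
    (G : SimpleGraph V) [DecidableRel G.Adj] : Fin (Fintype.card V) → ℝ :=
  (SimpleGraph.posSemidef_lapMatrix ℝ G).isHermitian.eigenvalues₀ ∘
    Tuple.sort (SimpleGraph.posSemidef_lapMatrix ℝ G).isHermitian.eigenvalues₀



noncomputable def cl (z : ℝ) : ℝ := max 0 (min z 1)

lemma cl_mono {a b : ℝ} (h : a ≤ b) : cl a ≤ cl b :=
  max_le_max le_rfl (min_le_min h le_rfl)

noncomputable def ww (M K j : ℕ) (y : ℝ) : ℝ :=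
  ∑ k ∈ Finset.range K, cl (y - ((j + k * M : ℕ) : ℝ))

lemma ww_mono (M K j : ℕ) {a b : ℝ} (h : a ≤ b) : ww M K j a ≤ ww M K j b :=
  Finset.sum_le_sum fun k _ => cl_mono (by linarith)

lemma sum_cl (P : ℕ) (y : ℝ) (hy : 0 ≤ y) :
    ∑ m ∈ Finset.range P, cl (y - (m : ℝ)) = min y P := by
  induction P with
  | zero => simp [hy]
  | succ P ih =>
    rw [Finset.sum_range_succ, ih]
    push_cast
    unfold cl
    rcases le_total y P with h | h
    · rw [min_eq_left h, min_eq_left (by linarith), min_eq_left (by linarith),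
        max_eq_left (by linarith)]; ring
    · rw [min_eq_right h]
      rcases le_total y (P + 1) with h' | h'
      · rw [min_eq_left (by linarith), min_eq_left h', max_eq_right (by linarith)]; ring
      · rw [min_eq_right (by linarith), min_eq_right h', max_eq_right (by linarith)]

lemma sum_range_mul' (f : ℕ → ℝ) (M K : ℕ) :
    ∑ j ∈ Finset.range M, ∑ k ∈ Finset.range K, f (j + k * M)
      = ∑ m ∈ Finset.range (K * M), f m := by
  induction K with
  | zero => simp
  | succ K ih =>
    rw [Nat.succ_mul, Finset.sum_range_add, ← ih]
    simp_rw [Finset.sum_range_succ]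
    rw [Finset.sum_add_distrib]
    congr 1
    exact Finset.sum_congr rfl fun j _ => by rw [add_comm]

lemma sum_ww (M K : ℕ) (y : ℝ) (hy : 0 ≤ y) (hy' : y ≤ ((K * M : ℕ) : ℝ)) :
    ∑ j ∈ Finset.range M, ww M K j y = y := by
  unfold ww
  rw [sum_range_mul' (fun m => cl (y - (m : ℝ))) M K, sum_cl _ _ hy, min_eq_left hy']

lemma sum_ww_sq_aux (M K : ℕ) (y z : ℝ) (hy : 0 ≤ y) (hyz : y ≤ z)
    (hz' : z ≤ ((K * M : ℕ) : ℝ)) :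
    ∑ j ∈ Finset.range M, (ww M K j z - ww M K j y) ^ 2 ≤ (z - y) ^ 2 := by
  have h1 : ∑ j ∈ Finset.range M, (ww M K j z - ww M K j y) = z - y := by
    rw [Finset.sum_sub_distrib, sum_ww _ _ _ (hy.trans hyz) hz', sum_ww _ _ _ hy (hyz.trans hz')]
  have h0 : ∀ j ∈ Finset.range M, 0 ≤ ww M K j z - ww M K j y := fun j _ =>
    sub_nonneg.2 (ww_mono M K j hyz)
  calc ∑ j ∈ Finset.range M, (ww M K j z - ww M K j y) ^ 2
      ≤ ∑ j ∈ Finset.range M, (ww M K j z - ww M K j y) * (z - y) := by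
        refine Finset.sum_le_sum fun j hj => ?_
        rw [sq]
        refine mul_le_mul_of_nonneg_left ?_ (h0 j hj)
        rw [← h1]
        exact Finset.single_le_sum h0 hj
    _ = (z - y) ^ 2 := by rw [← Finset.sum_mul, h1, sq]

lemma sum_ww_sq (M K : ℕ) (y z : ℝ) (hy : 0 ≤ y) (hz : 0 ≤ z)
    (hy' : y ≤ ((K * M : ℕ) : ℝ)) (hz' : z ≤ ((K * M : ℕ) : ℝ)) :
    ∑ j ∈ Finset.range M, (ww M K j z - ww M K j y) ^ 2 ≤ (z - y) ^ 2 := by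
  rcases le_total y z with h | h
  · exact sum_ww_sq_aux M K y z hy h hz'
  · have := sum_ww_sq_aux M K z y hz h hy'
    rw [sub_sq_comm z y]
    simp_rw [sub_sq_comm (ww M K _ z)]
    exact this

lemma ww_nonint (M K j : ℕ) (y : ℝ) (h : ¬ ∃ z : ℤ, ww M K j y = z) :
    ∃ k : ℕ, ⌊y⌋ = ((j + k * M : ℕ) : ℤ) := by
  by_contra hc
  push Not at hc
  apply h
  have : ∀ k, ∃ z : ℤ, cl (y - ((j + k * M : ℕ) : ℝ)) = z := by
    intro k
    have hk := hc k
    rcases lt_or_gt_of_ne hk with h1 | h1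
    · refine ⟨0, ?_⟩
      have : y < ((j + k * M : ℕ) : ℝ) := by
        have := Int.floor_lt.1 h1
        exact_mod_cast this
      unfold cl
      rw [max_eq_left ((min_le_left _ _).trans (by linarith))]; simp
    · refine ⟨1, ?_⟩
      have : ((j + k * M : ℕ) : ℝ) + 1 ≤ y := by
        have := Int.le_floor.1 (Int.add_one_le_of_lt h1)
        exact_mod_cast this
      unfold cl
      rw [min_eq_right (by linarith)]; simp
  choose z hz using this
  refine ⟨∑ k ∈ Finset.range K, z k, ?_⟩
  unfold ww
  push_cast
  exact Finset.sum_congr rfl fun k _ => by rw [← hz]; push_cast; rfl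

lemma ww_nonint_unique (M K j j' : ℕ) (hj : j < M) (hj' : j' < M) (y : ℝ)
    (h : ¬ ∃ z : ℤ, ww M K j y = z) (h' : ¬ ∃ z : ℤ, ww M K j' y = z) : j = j' := by
  obtain ⟨k, hk⟩ := ww_nonint _ _ _ _ h
  obtain ⟨k', hk'⟩ := ww_nonint _ _ _ _ h'
  rw [hk] at hk'
  have e : j + k * M = j' + k' * M := by exact_mod_cast hk'
  have := congrArg (· % M) e
  simpa [Nat.add_mul_mod_self_right, Nat.mod_eq_of_lt hj, Nat.mod_eq_of_lt hj'] using this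

lemma ww_eq_aux (M K j : ℕ) (hj : j < M) (y z : ℝ) (hy : 0 ≤ y)
    (hz' : z ≤ ((K * M : ℕ) : ℝ)) (h : y + 2 * M < z) : ww M K j y < ww M K j z := by
  have hM : (0 : ℝ) < M := by exact_mod_cast (Nat.zero_le j).trans_lt hj
  have hM1 : (1 : ℝ) ≤ M := by exact_mod_cast (Nat.succ_le_of_lt ((Nat.zero_le j).trans_lt hj))
  have hjM : (j : ℝ) < M := by exact_mod_cast hj
  set k := ⌈(y - j) / M⌉₊ with hk
  have h1 : (y - j) / M ≤ k := Nat.le_ceil _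
  have h1' : y - j ≤ k * M := by rwa [div_le_iff₀ hM] at h1
  have h2 : (k : ℝ) * M ≤ y + M := by
    rcases le_total 0 ((y - j) / M) with h0 | h0
    · have := Nat.ceil_lt_add_one h0
      rw [← hk] at this
      have h3 : (k : ℝ) * M ≤ ((y - j) / M + 1) * M := mul_le_mul_of_nonneg_right this.le hM.le
      have h4 : ((y - j) / M + 1) * M = y - j + M := by field_simp
      have : (0 : ℝ) ≤ j := Nat.cast_nonneg j
      linarith
    · have : k = 0 := by rw [hk]; exact Nat.ceil_eq_zero.2 h0
      rw [this]; simp; linarith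
  have hkK : k < K := by
    have : (k : ℝ) * M < K * M := by push_cast at hz'; linarith
    exact_mod_cast lt_of_mul_lt_mul_right this hM.le
  have h3 : (k : ℝ) * M + j + 1 ≤ z ∨ True := Or.inr trivial
  unfold ww
  refine Finset.sum_lt_sum (fun k _ => cl_mono (by linarith)) ⟨k, Finset.mem_range.2 hkK, ?_⟩
  unfold cl
  push_cast
  rw [max_eq_left ((min_le_left _ _).trans (by linarith))]
  refine lt_of_lt_of_le ?_ (le_max_right _ _)
  refine lt_min ?_ one_pos
  linarith

lemma ww_eq (M K j : ℕ) (hj : j < M) (y z : ℝ) (hy : 0 ≤ y) (hz : 0 ≤ z)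
    (hy' : y ≤ ((K * M : ℕ) : ℝ)) (hz' : z ≤ ((K * M : ℕ) : ℝ))
    (h : ww M K j y = ww M K j z) : |y - z| ≤ 2 * M := by
  rw [abs_le]
  constructor
  · by_contra hc
    exact (ww_eq_aux M K j hj y z hy hz' (by linarith)).ne h
  · by_contra hc
    exact (ww_eq_aux M K j hj z y hz hy' (by linarith)).ne h.symm

/-- grouping -/
lemma grouping {ι : Type*} [DecidableEq ι] (a : ι → ℝ) (η : ℝ) (hη : 0 ≤ η) (k : ℕ) :
    ∀ (s : Finset ι), (∀ i ∈ s, a i ≤ 1 + η) → (k : ℝ) * (1 + η) - 1 / 2 ≤ ∑ i ∈ s, a i →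
    ∃ T : Fin k → Finset ι, (∀ i, T i ⊆ s) ∧ (∀ i j, i ≠ j → Disjoint (T i) (T j)) ∧
      ∀ i, 1 / 2 ≤ ∑ x ∈ T i, a x := by
  induction k with
  | zero => intro s _ _; exact ⟨fun i => i.elim0, fun i => i.elim0, fun i => i.elim0, fun i => i.elim0⟩
  | succ k ih =>
    intro s hs hsum
    push_cast at hsum
    have hk : (0 : ℝ) ≤ k * (1 + η) := by positivity
    have hne : (s.powerset.filter fun T => 1 / 2 ≤ ∑ x ∈ T, a x).Nonempty :=
      ⟨s, by simp; linarith⟩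
    obtain ⟨T, hT, hmin⟩ := Finset.exists_min_image _ Finset.card hne
    simp only [Finset.mem_filter, Finset.mem_powerset] at hT hmin
    obtain ⟨hTs, hT2⟩ := hT
    have hTle : ∑ x ∈ T, a x ≤ 1 + η := by
      have hTne : T.Nonempty := by
        by_contra hc
        rw [Finset.not_nonempty_iff_eq_empty] at hc
        rw [hc] at hT2; norm_num at hT2
      obtain ⟨q, hq⟩ := hTne
      by_cases hq2 : a q ≤ 1 / 2
      · have h1 : ∑ x ∈ T.erase q, a x < 1 / 2 := by
          by_contra hc
          have := hmin (T.erase q) ⟨(Finset.erase_subset _ _).trans hTs, not_lt.1 hc⟩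
          have := Finset.card_erase_lt_of_mem hq
          omega
        have := Finset.add_sum_erase T a hq
        linarith
      · have h1 := hmin {q} ⟨by simpa using hTs hq, by simp at hq2 ⊢; linarith⟩
        have h2 : {q} = T := Finset.eq_of_subset_of_card_le (by simpa using hq) h1
        rw [← h2]; simpa using hs q (hTs hq)
    obtain ⟨T', h1, h2, h3⟩ := ih (s \ T) (fun i hi => hs i (Finset.sdiff_subset hi)) (by
      have := Finset.sum_sdiff (f := a) hTs
      linarith)
    refine ⟨Fin.cons T T', ?_, ?_, ?_⟩
    · intro i
      refine Fin.cases ?_ (fun i => ?_) i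
      · simpa using hTs
      · simpa using (h1 i).trans Finset.sdiff_subset
    · intro i j
      refine Fin.cases ?_ (fun i => ?_) i <;> refine Fin.cases ?_ (fun j => ?_) j
      · simp
      · intro _
        simpa using (Finset.disjoint_of_subset_left (h1 j) Finset.sdiff_disjoint).symm
      · intro _
        simpa using (Finset.disjoint_of_subset_left (h1 i) Finset.sdiff_disjoint)
      · intro h
        simpa using h2 i j (fun e => h (by rw [e]))
    · intro i
      refine Fin.cases ?_ (fun i => ?_) i
      · simpa using hT2
      · simpa using h3 i

lemma pigeon (M : ℕ) (hM : 0 < M) (m e : ℕ → ℝ) (A B : ℝ) (hA : 0 < A) (hB : 0 ≤ B)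
    (hm : ∀ j, 0 ≤ m j) (he : ∀ j, 0 ≤ e j)
    (hmA : ∑ j ∈ Finset.range M, m j ≤ A) (heB : ∑ j ∈ Finset.range M, e j ≤ B) :
    ∃ j < M, m j ≤ 2 * A / M ∧ e j ≤ 2 * B / M := by
  have hM' : (0 : ℝ) < M := by exact_mod_cast hM
  have key : ∃ j ∈ Finset.range M, m j / A + e j / B ≤ 2 / M := by
    by_contra hc
    push Not at hc
    have h1 : ∑ j ∈ Finset.range M, (2 / M : ℝ) < ∑ j ∈ Finset.range M, (m j / A + e j / B) :=
      Finset.sum_lt_sum_of_nonempty (Finset.nonempty_range_iff.2 hM.ne') hc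
    rw [Finset.sum_add_distrib, ← Finset.sum_div _ m, ← Finset.sum_div _ e] at h1
    have h2 : (∑ j ∈ Finset.range M, m j) / A ≤ 1 := div_le_one_of_le₀ hmA hA.le
    have h3 : (∑ j ∈ Finset.range M, e j) / B ≤ 1 := div_le_one_of_le₀ heB hB
    have h4 : ∑ j ∈ Finset.range M, (2 / M : ℝ) = 2 := by
      simp; field_simp
    linarith
  obtain ⟨j, hj, h⟩ := key
  have h1 : 0 ≤ m j / A := div_nonneg (hm j) hA.le
  have h2 : 0 ≤ e j / B := div_nonneg (he j) hB
  refine ⟨j, Finset.mem_range.1 hj, ?_, ?_⟩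
  · have : m j / A ≤ 2 / M := by linarith
    rw [div_le_iff₀ hA] at this
    calc m j ≤ _ := this
      _ = _ := by ring
  · rcases hB.eq_or_lt with h0 | h0
    · rw [← h0] at heB ⊢
      have := Finset.single_le_sum (f := e) (fun i _ => he i) hj
      simp; linarith
    · have : e j / B ≤ 2 / M := by linarith
      rw [div_le_iff₀ h0] at this
      calc e j ≤ _ := this
        _ = _ := by ring



open MeasureTheory in
lemma integral_ind (a b : ℝ) (h : a ≤ b) :
    ∫ t, (Set.Ico a b).indicator (fun _ => (1 : ℝ)) t = b - a := by
  rw [integral_indicator measurableSet_Ico]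
  simp [h]

open MeasureTheory in
lemma integrable_ind (a b : ℝ) :
    Integrable (fun t : ℝ => (Set.Ico a b).indicator (fun _ => (1 : ℝ)) t) := by
  rw [integrable_indicator_iff measurableSet_Ico]
  simp

open MeasureTheory Classical in
lemma layer {V : Type*} [Fintype V] (G : SimpleGraph V)
    (g D : V → ℝ) (hg : ∀ x, 0 ≤ g x) (hD : ∀ x, 0 ≤ D x)
    (hgD : ∀ x y, G.Adj x y → |g x - g y| ≤ D x) (c : ℝ)
    (h : ∀ S : Set V, S.Nonempty → (∀ x ∈ S, 0 < g x) →
      c * (S.ncard : ℝ) ≤ ((vertBdry G S).ncard : ℝ)) :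
    c * ∑ x, g x ^ 2 ≤ ∑ x, (4 * g x * D x + D x ^ 2) := by
  have e1 : ∫ t, (c * ∑ x, (Set.Ico 0 (g x ^ 2)).indicator (fun _ => (1 : ℝ)) t)
      = c * ∑ x, g x ^ 2 := by
    rw [integral_const_mul, integral_finsetSum _ (fun x _ => integrable_ind _ _)]
    congr 1
    refine Finset.sum_congr rfl fun x _ => ?_
    rw [integral_ind _ _ (sq_nonneg _), sub_zero]
  have e2 : ∫ t, (∑ x, (Set.Ico (g x ^ 2 - 2 * g x * D x) ((g x + D x) ^ 2)).indicator
      (fun _ => (1 : ℝ)) t) = ∑ x, (4 * g x * D x + D x ^ 2) := by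
    rw [integral_finsetSum _ (fun x _ => integrable_ind _ _)]
    refine Finset.sum_congr rfl fun x _ => ?_
    have := hg x
    have := hD x
    have := mul_nonneg (hg x) (hD x)
    rw [integral_ind _ _ (by nlinarith)]
    ring
  rw [← e1, ← e2]
  refine integral_mono ((integrable_finsetSum _ (fun x _ => integrable_ind _ _)).const_mul c)
    (integrable_finsetSum _ (fun x _ => integrable_ind _ _)) ?_
  intro t
  have hnn : ∀ x, 0 ≤ (Set.Ico (g x ^ 2 - 2 * g x * D x) ((g x + D x) ^ 2)).indicator
      (fun _ => (1 : ℝ)) t := fun x => Set.indicator_nonneg (fun _ _ => zero_le_one) _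
  show c * ∑ x, (Set.Ico 0 (g x ^ 2)).indicator (fun _ => (1 : ℝ)) t ≤
    ∑ x, (Set.Ico (g x ^ 2 - 2 * g x * D x) ((g x + D x) ^ 2)).indicator (fun _ => (1 : ℝ)) t
  set S : Set V := {x | 0 ≤ t ∧ t < g x ^ 2} with hS
  have l1 : ∑ x, (Set.Ico 0 (g x ^ 2)).indicator (fun _ => (1 : ℝ)) t = (S.ncard : ℝ) := by
    rw [Set.ncard_eq_toFinset_card']
    simp [Set.indicator_apply, hS, Set.mem_Ico]
  rw [l1]
  rcases S.eq_empty_or_nonempty with h0 | h0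
  · rw [h0]; simp only [Set.ncard_empty, Nat.cast_zero, mul_zero]
    exact Finset.sum_nonneg fun x _ => hnn x
  have ht : 0 ≤ t := by obtain ⟨x, hx⟩ := h0; exact hx.1
  refine (h S h0 ?_).trans ?_
  · intro x hx
    rcases (hg x).eq_or_lt with h1 | h1
    · have := hx.2; rw [← h1] at this; norm_num at this; linarith
    · exact h1
  rw [Set.ncard_eq_toFinset_card', Finset.card_eq_sum_ones]
  push_cast
  calc ∑ x ∈ (vertBdry G S).toFinset, (1 : ℝ)
      ≤ ∑ x ∈ (vertBdry G S).toFinset,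
        (Set.Ico (g x ^ 2 - 2 * g x * D x) ((g x + D x) ^ 2)).indicator (fun _ => (1 : ℝ)) t := by
        refine Finset.sum_le_sum fun x hx => ?_
        rw [Set.mem_toFinset] at hx
        obtain ⟨y, hxy, hne⟩ := hx
        have hd := abs_le.1 (hgD x y hxy)
        have g1 := hg x
        have g2 := hg y
        have d1 := hD x
        have gd := mul_nonneg g1 d1
        rw [Set.indicator_of_mem]
        simp only [hS, Set.mem_ofPred_eq, ht, true_and] at hne
        rw [Set.mem_Ico]
        by_cases hx : t < g x ^ 2
        · have hy : g y ^ 2 ≤ t := by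
            by_contra hc
            exact hne ⟨fun _ => not_le.1 hc, fun _ => hx⟩
          constructor
          · nlinarith [mul_le_mul_of_nonneg_left hd.2 g1, sq_nonneg (g x - g y)]
          · nlinarith [sq_nonneg (D x)]
        · have hy : t < g y ^ 2 := by
            by_contra hc
            exact hne ⟨fun h => absurd h hx, fun h => absurd h hc⟩
          constructor
          · nlinarith
          · have : g y ^ 2 ≤ (g x + D x) ^ 2 := pow_le_pow_left₀ g2 (by linarith) 2
            linarith
    _ ≤ _ := Finset.sum_le_sum_of_subset_of_nonneg (Finset.subset_univ _) fun x _ _ => hnn x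

open Classical in
lemma bht {V : Type*} [Fintype V] (G : SimpleGraph V) [DecidableRel G.Adj]
    (g : V → ℝ) (hg : ∀ x, 0 ≤ g x) (r : ℝ) (hr : 0 ≤ r) (hpos : 0 < ∑ x, g x ^ 2)
    (hE : ∑ x, ∑ y, (if G.Adj x y then (g x - g y) ^ 2 else 0) ≤ r ^ 2 * ∑ x, g x ^ 2) :
    ∃ S : Set V, S.Nonempty ∧ (∀ x ∈ S, 0 < g x) ∧
      ((vertBdry G S).ncard : ℝ) ≤ ((1 + 2 * r) ^ 2 - 1) * (S.ncard : ℝ) := by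
  set D : V → ℝ := fun x => Real.sqrt (∑ y, (if G.Adj x y then (g x - g y) ^ 2 else 0)) with hDdef
  have hin : ∀ x, 0 ≤ ∑ y, (if G.Adj x y then (g x - g y) ^ 2 else 0) := fun x =>
    Finset.sum_nonneg fun y _ => by split_ifs <;> positivity
  have hD : ∀ x, 0 ≤ D x := fun x => Real.sqrt_nonneg _
  have hD2 : ∀ x, D x ^ 2 = ∑ y, (if G.Adj x y then (g x - g y) ^ 2 else 0) := fun x =>
    Real.sq_sqrt (hin x)
  have hgD : ∀ x y, G.Adj x y → |g x - g y| ≤ D x := by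
    intro x y hxy
    apply Real.abs_le_sqrt
    have := Finset.single_le_sum (f := fun y => if G.Adj x y then (g x - g y) ^ 2 else 0)
      (fun y _ => by split_ifs <;> positivity) (Finset.mem_univ y)
    simpa [hxy] using this
  have hDs : ∑ x, D x ^ 2 ≤ r ^ 2 * ∑ x, g x ^ 2 := by simp_rw [hD2]; exact hE
  -- minimal ratio
  set P : Finset (Set V) := Finset.univ.filter fun S => S.Nonempty ∧ ∀ x ∈ S, 0 < g x with hP
  have hPne : P.Nonempty := by
    obtain ⟨x, -, hx⟩ : ∃ x ∈ Finset.univ, 0 < g x ^ 2 := by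
      by_contra hc
      push Not at hc
      exact absurd hpos (not_lt.2 (Finset.sum_nonpos hc))
    refine ⟨{x}, ?_⟩
    simp only [hP, Finset.mem_filter, Finset.mem_univ, true_and, Set.singleton_nonempty,
      Set.mem_singleton_iff, forall_eq]
    exact lt_of_le_of_ne (hg x) (fun h => by rw [← h] at hx; norm_num at hx)
  obtain ⟨S, hS, hmin⟩ := Finset.exists_min_image P
    (fun S => ((vertBdry G S).ncard : ℝ) / (S.ncard : ℝ)) hPne
  simp only [hP, Finset.mem_filter, Finset.mem_univ, true_and] at hS hmin
  have hcard : ∀ S : Set V, S.Nonempty → (0 : ℝ) < S.ncard := fun S h => by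
    exact_mod_cast (Set.ncard_pos (Set.toFinite S)).2 h
  refine ⟨S, hS.1, hS.2, ?_⟩
  rw [← div_le_iff₀ (hcard S hS.1)]
  have hl := layer G g D hg hD hgD (((vertBdry G S).ncard : ℝ) / (S.ncard : ℝ)) (by
    intro S' h1 h2
    rw [← le_div_iff₀ (hcard S' h1)]
    exact hmin S' ⟨h1, h2⟩)
  refine le_of_mul_le_mul_right (hl.trans ?_) hpos
  have hCS : ∑ x, g x * D x ≤ r * ∑ x, g x ^ 2 := by
    have h1 := Finset.sum_mul_sq_le_sq_mul_sq Finset.univ g D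
    refine abs_le_of_sq_le_sq' ?_ (by positivity) |>.2
    calc _ ≤ _ := h1
      _ ≤ (∑ x, g x ^ 2) * (r ^ 2 * ∑ x, g x ^ 2) := mul_le_mul_of_nonneg_left hDs hpos.le
      _ = _ := by ring
  rw [Finset.sum_add_distrib]
  have : ∑ x, 4 * g x * D x = 4 * ∑ x, g x * D x := by
    rw [Finset.mul_sum]; exact Finset.sum_congr rfl fun x _ => by ring
  rw [this]
  nlinarith [mul_nonneg (sq_nonneg r) hpos.le]


lemma radial {E : Type*} [NormedAddCommGroup E] [NormedSpace ℝ E] (a b : E) :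
    ‖a‖ * ‖‖a‖⁻¹ • a - ‖b‖⁻¹ • b‖ ≤ 2 * ‖a - b‖ := by
  by_cases ha : a = 0
  · simp [ha]
  by_cases hb : b = 0
  · subst hb
    simp only [smul_zero, sub_zero, norm_smul, norm_inv, norm_norm]
    rw [inv_mul_cancel₀ (norm_ne_zero_iff.2 ha)]
    have := norm_nonneg a
    linarith
  have ha' : 0 < ‖a‖ := norm_pos_iff.2 ha
  have hb' : 0 < ‖b‖ := norm_pos_iff.2 hb
  have e : ‖a‖ * ‖‖a‖⁻¹ • a - ‖b‖⁻¹ • b‖ = ‖(a - b) + ((‖b‖ - ‖a‖) * ‖b‖⁻¹) • b‖ := by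
    have : (a - b) + ((‖b‖ - ‖a‖) * ‖b‖⁻¹) • b = ‖a‖ • (‖a‖⁻¹ • a - ‖b‖⁻¹ • b) := by
      rw [smul_sub, smul_smul, smul_smul, mul_inv_cancel₀ ha'.ne', one_smul, sub_mul,
        mul_inv_cancel₀ hb'.ne', sub_smul, one_smul]
      abel
    rw [this, norm_smul, norm_norm]
  rw [e]
  refine (norm_add_le _ _).trans ?_
  rw [norm_smul, norm_mul, norm_inv, norm_norm, mul_assoc, inv_mul_cancel₀ hb'.ne', mul_one,
    Real.norm_eq_abs]
  have := abs_norm_sub_norm_le b a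
  rw [norm_sub_rev b a] at this
  linarith

lemma coord_le {n : ℕ} (x : EuclideanSpace ℝ (Fin n)) (i : Fin n) : |x i| ≤ ‖x‖ := by
  simpa using PiLp.norm_apply_le x i

lemma unit_le {E : Type*} [NormedAddCommGroup E] [NormedSpace ℝ E] (a : E) :
    ‖‖a‖⁻¹ • a‖ ≤ 1 := by
  rw [norm_smul, norm_inv, norm_norm]
  exact inv_mul_le_one

/-- spreading -/
lemma spread {V : Type*} [Fintype V] {n : ℕ} (hn : 1 ≤ n) (F : V → EuclideanSpace ℝ (Fin n))
    (hF : ∀ x, ∑ v, (inner ℝ x (F v)) ^ 2 = ‖x‖ ^ 2) (S : Finset V)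
    (hS : ∀ u ∈ S, ∀ v ∈ S, ‖‖F u‖⁻¹ • F u - ‖F v‖⁻¹ • F v‖ ^ 2 ≤ 4 / (25 * n)) :
    ∑ v ∈ S, ‖F v‖ ^ 2 ≤ 1 + 1 / (4 * n) := by
  have hn' : (1 : ℝ) ≤ n := by exact_mod_cast hn
  have hn0 : (0 : ℝ) < n := by linarith
  by_cases h : ∃ u ∈ S, F u ≠ 0
  swap
  · push Not at h
    rw [Finset.sum_eq_zero fun v hv => by rw [h v hv]; simp]
    positivity
  obtain ⟨u, hu, hu0⟩ := h
  set x := ‖F u‖⁻¹ • F u with hx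
  have hx1 : ‖x‖ = 1 := norm_smul_inv_norm (𝕜 := ℝ) hu0
  set q : ℝ := 2 / (25 * n) with hq
  have hq0 : 0 < q := by positivity
  have hqn : q * n = 2 / 25 := by rw [hq]; field_simp
  have hq1 : q ≤ 2 / 25 := by nlinarith
  have key : ∀ v ∈ S, (1 - q) ^ 2 * ‖F v‖ ^ 2 ≤ (inner ℝ x (F v)) ^ 2 := by
    intro v hv
    by_cases h0 : F v = 0
    · rw [h0]; simp
    have hv1 : ‖‖F v‖⁻¹ • F v‖ = 1 := norm_smul_inv_norm (𝕜 := ℝ) h0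
    have h1 := norm_sub_sq_real x (‖F v‖⁻¹ • F v)
    have h2 := hS u hu v hv
    rw [← hx, h1, hx1, hv1] at h2
    have h4 : (4 : ℝ) / (25 * n) = 2 * q := by rw [hq]; ring
    rw [h4] at h2
    have h3 : 1 - q ≤ inner ℝ x (‖F v‖⁻¹ • F v) := by linarith
    have h5 : inner ℝ x (F v) = ‖F v‖ * inner ℝ x (‖F v‖⁻¹ • F v) := by
      rw [inner_smul_right, ← mul_assoc, mul_inv_cancel₀ (norm_ne_zero_iff.2 h0), one_mul]
    rw [h5, mul_pow, mul_comm]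
    refine mul_le_mul_of_nonneg_left ?_ (by positivity)
    exact pow_le_pow_left₀ (by linarith) h3 2
  have h6 : (1 - q) ^ 2 * ∑ v ∈ S, ‖F v‖ ^ 2 ≤ 1 := by
    rw [Finset.mul_sum]
    calc _ ≤ ∑ v ∈ S, (inner ℝ x (F v)) ^ 2 := Finset.sum_le_sum key
      _ ≤ ∑ v, (inner ℝ x (F v)) ^ 2 :=
        Finset.sum_le_sum_of_subset_of_nonneg (Finset.subset_univ _) fun _ _ _ => sq_nonneg _
      _ = 1 := by rw [hF, hx1]; norm_num
  have h7 : 1 ≤ (1 - q) ^ 2 * (1 + 1 / (4 * n)) := by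
    have e : (1 : ℝ) / (4 * n) = 25 / 8 * q := by rw [hq]; field_simp; norm_num
    rw [e]; nlinarith
  have h8 : 0 < (1 - q) ^ 2 := by have : 0 < 1 - q := by linarith
                                  positivity
  exact le_of_mul_le_mul_left (h6.trans h7) h8

open Classical in
lemma core_s10 {V : Type*} [Fintype V] (G : SimpleGraph V) [DecidableRel G.Adj] {n : ℕ} (hn : 1 ≤ n)
    (F : V → EuclideanSpace ℝ (Fin n))
    (hF : ∀ x, ∑ v, (inner ℝ x (F v)) ^ 2 = ‖x‖ ^ 2) (hm : ∑ v, ‖F v‖ ^ 2 = n)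
    (E : ℝ) (hE : ∑ u, ∑ v, (if G.Adj u v then ‖F u - F v‖ ^ 2 else 0) = E) :
    ∃ g : Fin n → V → ℝ, (∀ i v, 0 ≤ g i v) ∧
      (∀ i j, i ≠ j → ∀ v, 0 < g i v → 0 < g j v → False) ∧
      (∀ i, 1 / 2 ≤ ∑ v, g i v ^ 2) ∧
      ∀ i, ∑ u, ∑ v, (if G.Adj u v then (g i u - g i v) ^ 2 else 0)
        ≤ (2 + 12800 * (n : ℝ) ^ 5) * E := by
  have hn' : (1 : ℝ) ≤ n := by exact_mod_cast hn
  have hn0 : (0 : ℝ) < n := by linarith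
  have hE0 : 0 ≤ E := by
    rw [← hE]
    exact Finset.sum_nonneg fun _ _ => Finset.sum_nonneg fun _ _ => by split_ifs <;> positivity
  set M : ℕ := 8 * n ^ 2 with hM
  set N : ℕ := 5 * n with hN
  have hMpos : 0 < M := by positivity
  have hMr : (M : ℝ) = 8 * (n : ℝ) ^ 2 := by rw [hM]; push_cast; ring
  have hNr : (N : ℝ) = 5 * (n : ℝ) := by rw [hN]; push_cast; ring
  have hMr0 : (0 : ℝ) < M := by exact_mod_cast hMpos
  have hNr0 : (0 : ℝ) < N := by rw [hNr]; positivity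
  set U : V → EuclideanSpace ℝ (Fin n) := fun v => ‖F v‖⁻¹ • F v with hU
  set y : V → Fin n → ℝ := fun v i => (U v i + 1) * (M * N) with hy
  have hUc : ∀ v i, |U v i| ≤ 1 := fun v i => (coord_le _ i).trans (unit_le _)
  have hy0 : ∀ v i, 0 ≤ y v i := fun v i => by
    have := (abs_le.1 (hUc v i)).1
    exact mul_nonneg (by linarith) (by positivity)
  have hy1 : ∀ v i, y v i ≤ ((2 * N * M : ℕ) : ℝ) := fun v i => by
    have h1 := (abs_le.1 (hUc v i)).2
    have : (U v i + 1) * (M * N : ℝ) ≤ 2 * (M * N) :=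
      mul_le_mul_of_nonneg_right (by linarith) (by positivity)
    push_cast
    calc y v i ≤ _ := this
      _ = _ := by ring
  -- choose shifts
  have hch : ∀ i : Fin n, ∃ j < M,
      (∑ v, if ∃ z : ℤ, ww M (2 * N) j (y v i) = z then 0 else ‖F v‖ ^ 2) ≤ 2 * n / M ∧
      (∑ u, ∑ v, if G.Adj u v then
        (ww M (2 * N) j (y u i) - ww M (2 * N) j (y v i)) ^ 2 * ‖F u‖ ^ 2 else 0)
        ≤ 2 * (4 * (M * N) ^ 2 * E) / M := by
    intro i
    refine pigeon M hMpos
      (fun j => ∑ v, if ∃ z : ℤ, ww M (2 * N) j (y v i) = z then 0 else ‖F v‖ ^ 2)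
      (fun j => ∑ u, ∑ v, if G.Adj u v then
        (ww M (2 * N) j (y u i) - ww M (2 * N) j (y v i)) ^ 2 * ‖F u‖ ^ 2 else 0)
      n (4 * (M * N) ^ 2 * E) hn0 (by positivity) ?_ ?_ ?_ ?_
    · intro j
      exact Finset.sum_nonneg fun _ _ => by split_ifs <;> positivity
    · intro j
      exact Finset.sum_nonneg fun _ _ => Finset.sum_nonneg fun _ _ => by split_ifs <;> positivity
    · rw [Finset.sum_comm, ← hm]
      refine Finset.sum_le_sum fun v _ => ?_
      by_cases h : ∃ j ∈ Finset.range M, ¬ ∃ z : ℤ, ww M (2 * N) j (y v i) = z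
      · obtain ⟨j, hj, hz⟩ := h
        rw [Finset.sum_eq_single_of_mem j hj, if_neg hz]
        intro j' hj' hne
        rw [if_pos]
        by_contra hc
        exact hne (ww_nonint_unique M _ j' j (Finset.mem_range.1 hj') (Finset.mem_range.1 hj) _ hc hz)
      · push Not at h
        rw [Finset.sum_eq_zero fun j hj => if_pos (h j hj)]
        positivity
    · rw [Finset.sum_comm, ← hE, Finset.mul_sum]
      refine Finset.sum_le_sum fun u _ => ?_
      rw [Finset.sum_comm, Finset.mul_sum]
      refine Finset.sum_le_sum fun v _ => ?_
      by_cases h : G.Adj u v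
      · simp only [h, if_true]
        rw [← Finset.sum_mul]
        have h1 := sum_ww_sq M (2 * N) (y v i) (y u i) (hy0 v i) (hy0 u i) (hy1 v i) (hy1 u i)
        have h2 : (y u i - y v i) ^ 2 * ‖F u‖ ^ 2 ≤ 4 * (M * N) ^ 2 * ‖F u - F v‖ ^ 2 := by
          have h3 : |U u i - U v i| ≤ ‖U u - U v‖ := by simpa using coord_le (U u - U v) i
          have h4 : ‖F u‖ * |U u i - U v i| ≤ 2 * ‖F u - F v‖ :=
            (mul_le_mul_of_nonneg_left h3 (norm_nonneg _)).trans (radial (F u) (F v))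
          have h5 := pow_le_pow_left₀ (by positivity) h4 2
          rw [mul_pow, sq_abs] at h5
          have h6 : (y u i - y v i) ^ 2 * ‖F u‖ ^ 2
            = (M * N) ^ 2 * (‖F u‖ ^ 2 * (U u i - U v i) ^ 2) := by rw [hy]; ring
          rw [h6]
          calc _ ≤ (M * N : ℝ) ^ 2 * (2 * ‖F u - F v‖) ^ 2 :=
                mul_le_mul_of_nonneg_left h5 (by positivity)
            _ = _ := by ring
        exact (mul_le_mul_of_nonneg_right h1 (by positivity)).trans h2
      · simp [h]
  choose j hjM hjm hje using hch
  set W : V → Fin n → ℝ := fun v i => ww M (2 * N) (j i) (y v i) with hW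
  set I : Finset V := Finset.univ.filter fun v => ∀ i, ∃ z : ℤ, W v i = z with hI
  -- lost mass
  have hlost : ∑ v ∈ Finset.univ.filter (fun v => ¬ ∀ i, ∃ z : ℤ, W v i = z), ‖F v‖ ^ 2 ≤ 1 / 4 := by
    calc _ ≤ ∑ v, ∑ i, (if ∃ z : ℤ, W v i = z then 0 else ‖F v‖ ^ 2) := by
          rw [Finset.sum_filter]
          refine Finset.sum_le_sum fun v _ => ?_
          have hnn : ∀ i ∈ Finset.univ, 0 ≤ (if ∃ z : ℤ, W v i = z then 0 else ‖F v‖ ^ 2) :=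
            fun i _ => by split_ifs <;> positivity
          split_ifs with h
          · exact Finset.sum_nonneg hnn
          · push Not at h
            obtain ⟨i, hi⟩ := h
            have := Finset.single_le_sum hnn (Finset.mem_univ i)
            rwa [if_neg (by push Not; exact hi)] at this
      _ = ∑ i, ∑ v, (if ∃ z : ℤ, W v i = z then 0 else ‖F v‖ ^ 2) := Finset.sum_comm
      _ ≤ ∑ i : Fin n, (2 * n / M : ℝ) := Finset.sum_le_sum fun i _ => hjm i
      _ = 1 / 4 := by
          rw [Finset.sum_const, Finset.card_univ, Fintype.card_fin, nsmul_eq_mul, hMr]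
          field_simp; norm_num
  have hkept : (n : ℝ) - 1 / 4 ≤ ∑ v ∈ I, ‖F v‖ ^ 2 := by
    have := Finset.sum_filter_add_sum_filter_not Finset.univ
      (fun v => ∀ i, ∃ z : ℤ, W v i = z) (fun v => ‖F v‖ ^ 2)
    rw [hm] at this
    linarith
  set a : (Fin n → ℝ) → ℝ := fun z => ∑ v ∈ I with W v = z, ‖F v‖ ^ 2 with ha
  have hsum : ∑ z ∈ I.image W, a z = ∑ v ∈ I, ‖F v‖ ^ 2 :=
    Finset.sum_fiberwise_of_maps_to (fun v hv => Finset.mem_image_of_mem W hv) _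
  obtain ⟨T, hTs, hTd, hTm⟩ := grouping a (1 / (4 * n)) (by positivity) n (I.image W) (by
    intro z _
    refine spread hn F hF _ ?_
    intro u hu v hv
    have huv : W u = W v := by
      rw [(Finset.mem_filter.1 hu).2, (Finset.mem_filter.1 hv).2]
    have hc : ∀ i, (U u i - U v i) ^ 2 ≤ 4 / (25 * n ^ 2) := by
      intro i
      have h1 := ww_eq M (2 * N) (j i) (hjM i) (y u i) (y v i) (hy0 u i) (hy0 v i) (hy1 u i)
        (hy1 v i) (congrFun huv i)
      have h2 : y u i - y v i = (U u i - U v i) * N * M := by rw [hy]; ring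
      rw [h2, abs_mul, abs_of_pos hMr0] at h1
      have h3 := le_of_mul_le_mul_right h1 hMr0
      have h4 := pow_le_pow_left₀ (abs_nonneg _) h3 2
      rw [sq_abs, mul_pow, hNr] at h4
      rw [le_div_iff₀ (by positivity)]
      nlinarith
    have : ‖U u - U v‖ ^ 2 = ∑ i, (U u i - U v i) ^ 2 := by
      rw [EuclideanSpace.norm_sq_eq]
      simp
    show ‖U u - U v‖ ^ 2 ≤ _
    rw [this]
    calc _ ≤ ∑ i : Fin n, (4 / (25 * n ^ 2) : ℝ) := Finset.sum_le_sum fun i _ => hc i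
      _ = _ := by
        rw [Finset.sum_const, Finset.card_univ, Fintype.card_fin, nsmul_eq_mul]
        field_simp) (by
    rw [hsum]
    refine le_trans (le_of_eq ?_) hkept
    field_simp; ring)
  have hTne : ∀ i, (T i : Set (Fin n → ℝ)).Nonempty := by
    intro i
    by_contra hc
    rw [Finset.coe_nonempty, Finset.not_nonempty_iff_eq_empty] at hc
    have := hTm i
    rw [hc] at this; norm_num at this
  have hTint : ∀ i, ∀ z ∈ T i, ∀ k, ∃ m : ℤ, z k = m := by
    intro i z hz k
    obtain ⟨v, hv, rfl⟩ := Finset.mem_image.1 (hTs i hz)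
    exact (Finset.mem_filter.1 hv).2 k
  set ψ : Fin n → V → ℝ := fun i v =>
    max 0 (1 - 2 * Metric.infDist (W v) (T i : Set (Fin n → ℝ))) with hψ
  have hψ0 : ∀ i v, 0 ≤ ψ i v := fun i v => le_max_left _ _
  have hψ1 : ∀ i v, ψ i v ≤ 1 := fun i v => max_le zero_le_one (by
    have := Metric.infDist_nonneg (x := W v) (s := (T i : Set (Fin n → ℝ)))
    linarith)
  have hψL : ∀ i u v, |ψ i u - ψ i v| ≤ 2 * dist (W u) (W v) := by
    intro i u v
    have h1 := Metric.infDist_le_infDist_add_dist (s := (T i : Set (Fin n → ℝ)))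
      (x := W u) (y := W v)
    have h2 := Metric.infDist_le_infDist_add_dist (s := (T i : Set (Fin n → ℝ)))
      (x := W v) (y := W u)
    rw [dist_comm (W v)] at h2
    refine (abs_max_sub_max_le_max _ _ _ _).trans (max_le (by simp) ?_)
    rw [abs_le]; constructor <;> linarith
  have hdist : ∀ u v, dist (W u) (W v) ^ 2 ≤ ∑ i, (W u i - W v i) ^ 2 := by
    intro u v
    have h0 : 0 ≤ ∑ i, (W u i - W v i) ^ 2 := Finset.sum_nonneg fun _ _ => sq_nonneg _
    have : dist (W u) (W v) ≤ Real.sqrt (∑ i, (W u i - W v i) ^ 2) := by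
      rw [dist_pi_le_iff (Real.sqrt_nonneg _)]
      intro i
      rw [Real.dist_eq]
      apply Real.abs_le_sqrt
      exact Finset.single_le_sum (f := fun i => (W u i - W v i) ^ 2)
        (fun _ _ => sq_nonneg _) (Finset.mem_univ i)
    calc _ ≤ _ := pow_le_pow_left₀ dist_nonneg this 2
      _ = _ := Real.sq_sqrt h0
  refine ⟨fun i v => ψ i v * ‖F v‖, fun i v => mul_nonneg (hψ0 i v) (norm_nonneg _), ?_, ?_, ?_⟩
  · intro i k hik v hi hk
    have aux : ∀ i, 0 < ψ i v * ‖F v‖ → ∃ z ∈ T i, dist (W v) z < 1 / 2 := by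
      intro i hi
      have h1 : 0 < ψ i v := pos_of_mul_pos_left hi (norm_nonneg _)
      have h2 : Metric.infDist (W v) (T i : Set (Fin n → ℝ)) < 1 / 2 := by
        rcases lt_max_iff.1 h1 with h | h
        · exact absurd h (lt_irrefl _)
        · linarith
      exact (Metric.infDist_lt_iff (hTne i)).1 h2
    obtain ⟨z, hz, hzd⟩ := aux i hi
    obtain ⟨z', hz', hzd'⟩ := aux k hk
    have hzz : z = z' := by
      ext l
      obtain ⟨p, hp⟩ := hTint i z hz l
      obtain ⟨p', hp'⟩ := hTint k z' hz' l
      have h1 : dist (z l) (z' l) < 1 := by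
        have := dist_le_pi_dist z z' l
        have h2 := dist_triangle_left z z' (W v)
        linarith
      rw [hp, hp', Int.dist_cast_real, Int.dist_eq] at h1
      have h3 : |p - p'| < 1 := by exact_mod_cast h1
      rw [hp, hp', sub_eq_zero.1 (Int.abs_lt_one_iff.1 h3)]
    exact Finset.disjoint_left.1 (hTd i k hik) hz (hzz ▸ hz')
  · intro i
    refine (hTm i).trans ?_
    have h1 : ∑ z ∈ T i, a z = ∑ v ∈ I with W v ∈ T i, ‖F v‖ ^ 2 := by
      rw [← Finset.sum_fiberwise_of_maps_to (g := W) (t := T i)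
        (fun v hv => (Finset.mem_filter.1 hv).2)]
      refine Finset.sum_congr rfl fun z hz => ?_
      refine Finset.sum_congr ?_ fun _ _ => rfl
      ext v
      simp only [Finset.mem_filter]
      constructor
      · rintro ⟨h1, rfl⟩; exact ⟨⟨h1, hz⟩, rfl⟩
      · rintro ⟨⟨h1, _⟩, h2⟩; exact ⟨h1, h2⟩
    rw [h1]
    calc _ ≤ ∑ v ∈ I with W v ∈ T i, (ψ i v * ‖F v‖) ^ 2 := by
          refine Finset.sum_le_sum fun v hv => le_of_eq ?_
          have h2 : W v ∈ (T i : Set (Fin n → ℝ)) := (Finset.mem_filter.1 hv).2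
          have : ψ i v = 1 := by
            simp only [hψ]
            rw [Metric.infDist_zero_of_mem h2]; norm_num
          rw [this, one_mul]
      _ ≤ _ := Finset.sum_le_sum_of_subset_of_nonneg (Finset.subset_univ _)
          fun _ _ _ => sq_nonneg _
  · intro i
    have hpt : ∀ u v, (if G.Adj u v then (ψ i u * ‖F u‖ - ψ i v * ‖F v‖) ^ 2 else 0)
        ≤ 2 * (if G.Adj u v then ‖F u - F v‖ ^ 2 else 0)
          + 8 * ∑ l, (if G.Adj u v then (W u l - W v l) ^ 2 * ‖F u‖ ^ 2 else 0) := by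
      intro u v
      by_cases h : G.Adj u v
      swap
      · simp [h]
      simp only [h, if_true]
      rw [← Finset.sum_mul]
      have h1 : ψ i u * ‖F u‖ - ψ i v * ‖F v‖
        = ψ i v * (‖F u‖ - ‖F v‖) + (ψ i u - ψ i v) * ‖F u‖ := by ring
      have h2 : (ψ i v * (‖F u‖ - ‖F v‖)) ^ 2 ≤ ‖F u - F v‖ ^ 2 := by
        rw [← sq_abs (ψ i v * _), abs_mul, abs_of_nonneg (hψ0 i v)]
        refine pow_le_pow_left₀ (mul_nonneg (hψ0 i v) (abs_nonneg _)) ?_ 2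
        calc _ ≤ 1 * |‖F u‖ - ‖F v‖| := mul_le_mul_of_nonneg_right (hψ1 i v) (abs_nonneg _)
          _ ≤ _ := by rw [one_mul]; exact abs_norm_sub_norm_le _ _
      have h3 : ((ψ i u - ψ i v) * ‖F u‖) ^ 2 ≤ 4 * ((∑ l, (W u l - W v l) ^ 2) * ‖F u‖ ^ 2) := by
        have h4 := pow_le_pow_left₀ (abs_nonneg _) (hψL i u v) 2
        rw [sq_abs] at h4
        have h5 : (ψ i u - ψ i v) ^ 2 ≤ 4 * ∑ l, (W u l - W v l) ^ 2 := by
          have := hdist u v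
          nlinarith
        rw [mul_pow, ← mul_assoc]
        exact mul_le_mul_of_nonneg_right h5 (by positivity)
      rw [h1]
      nlinarith [sq_nonneg (ψ i v * (‖F u‖ - ‖F v‖) - (ψ i u - ψ i v) * ‖F u‖)]
    calc _ ≤ ∑ u, ∑ v, (2 * (if G.Adj u v then ‖F u - F v‖ ^ 2 else 0)
          + 8 * ∑ l, (if G.Adj u v then (W u l - W v l) ^ 2 * ‖F u‖ ^ 2 else 0)) :=
          Finset.sum_le_sum fun u _ => Finset.sum_le_sum fun v _ => hpt u v
      _ = 2 * E + 8 * ∑ l, ∑ u, ∑ v,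
          (if G.Adj u v then (W u l - W v l) ^ 2 * ‖F u‖ ^ 2 else 0) := by
          simp_rw [Finset.sum_add_distrib, ← Finset.mul_sum]
          rw [hE]
          congr 2
          rw [Finset.sum_comm]
          conv_lhs => rw [Finset.sum_comm]
          conv_rhs => rw [Finset.sum_comm]
          exact Finset.sum_congr rfl fun u _ => Finset.sum_comm
      _ ≤ 2 * E + 8 * ∑ l : Fin n, (2 * (4 * (M * N) ^ 2 * E) / M) := by
          gcongr with l
          exact hje l
      _ = _ := by
          rw [Finset.sum_const, Finset.card_univ, Fintype.card_fin, nsmul_eq_mul, hMr, hNr]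
          field_simp; ring

lemma eigen {V : Type*} [Fintype V] [DecidableEq V] (G : SimpleGraph V) [DecidableRel G.Adj]
    (n : ℕ) (hn : 1 ≤ n) (hcard : n ≤ Fintype.card V) :
    ∃ F : V → EuclideanSpace ℝ (Fin n),
      (∀ x, ∑ v, (inner ℝ x (F v)) ^ 2 = ‖x‖ ^ 2) ∧ (∑ v, ‖F v‖ ^ 2 = n) ∧
      ∑ u, ∑ v, (if G.Adj u v then ‖F u - F v‖ ^ 2 else 0)
        ≤ 2 * n * lapEigenSorted G ⟨n - 1, by omega⟩ := by
  set hA := (SimpleGraph.posSemidef_lapMatrix ℝ G).isHermitian with hhA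
  set σ := Tuple.sort hA.eigenvalues₀ with hσ
  let e : Fin (Fintype.card V) ≃ V := Fintype.equivOfCardEq (Fintype.card_fin _)
  let p : Fin n → V := fun k => e (σ (Fin.castLE hcard k))
  have hp : Function.Injective p := fun a b h =>
    Fin.castLE_injective hcard (σ.injective (e.injective h))
  let b : Fin n → EuclideanSpace ℝ V := fun k => hA.eigenvectorBasis (p k)
  have hb : Orthonormal ℝ b := hA.eigenvectorBasis.orthonormal.comp p hp
  have hev : ∀ k, hA.eigenvalues (p k) ≤ lapEigenSorted G ⟨n - 1, by omega⟩ := by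
    intro k
    have h1 : hA.eigenvalues (p k) = (hA.eigenvalues₀ ∘ σ) (Fin.castLE hcard k) := by
      show hA.eigenvalues₀ (e.symm (e (σ (Fin.castLE hcard k)))) = _
      rw [Equiv.symm_apply_apply]; rfl
    rw [h1]
    refine Tuple.monotone_sort hA.eigenvalues₀ ?_
    rw [Fin.le_def]
    show k.val ≤ n - 1
    have := k.2
    omega
  have hnorm : ∀ k, ∑ v, b k v ^ 2 = 1 := by
    intro k
    have := hb.1 k
    have h2 := EuclideanSpace.norm_sq_eq (b k)
    rw [this] at h2
    simpa using h2.symm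
  have hen : ∀ k, ∑ u, ∑ v, (if G.Adj u v then (b k u - b k v) ^ 2 else 0)
      = 2 * hA.eigenvalues (p k) := by
    intro k
    have h1 := SimpleGraph.lapMatrix_toLinearMap₂' ℝ G (b k)
    rw [Matrix.toLinearMap₂'_apply', hA.mulVec_eigenvectorBasis, dotProduct_smul] at h1
    have h2 : (b k).ofLp ⬝ᵥ (b k).ofLp = 1 := by
      rw [← hnorm k]
      exact Finset.sum_congr rfl fun v _ => (sq _).symm
    have h3 : (b k).ofLp ⬝ᵥ (hA.eigenvectorBasis (p k)).ofLp = 1 := h2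
    rw [h3, smul_eq_mul, mul_one] at h1
    linarith
  refine ⟨fun v => WithLp.toLp 2 (fun k => b k v), ?_, ?_, ?_⟩
  · intro x
    have h1 : ∀ v, inner ℝ x (WithLp.toLp 2 (fun k => b k v) : EuclideanSpace ℝ (Fin n))
        = (∑ k, x k • b k) v := by
      intro v
      simp [PiLp.inner_apply, mul_comm]
    simp_rw [h1]
    have h2 := EuclideanSpace.norm_sq_eq (∑ k, x k • b k)
    have h3 : ‖∑ k, x k • b k‖ ^ 2 = ‖x‖ ^ 2 := by
      rw [← real_inner_self_eq_norm_sq, hb.inner_sum, EuclideanSpace.norm_sq_eq]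
      simp [sq]
    rw [← h3, h2]
    simp
  · simp_rw [EuclideanSpace.norm_sq_eq]
    rw [Finset.sum_comm]
    simp [hnorm]
  · have h1 : ∀ u v, (if G.Adj u v then ‖(WithLp.toLp 2 (fun k => b k u) : EuclideanSpace ℝ (Fin n))
        - WithLp.toLp 2 (fun k => b k v)‖ ^ 2 else 0)
        = ∑ k, (if G.Adj u v then (b k u - b k v) ^ 2 else 0) := by
      intro u v
      split_ifs
      · rw [EuclideanSpace.norm_sq_eq]; simp
      · simp
    simp_rw [h1]
    calc _ = ∑ k, ∑ u, ∑ v, (if G.Adj u v then (b k u - b k v) ^ 2 else 0) := by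
          conv_rhs => rw [Finset.sum_comm]
          exact Finset.sum_congr rfl fun u _ => Finset.sum_comm
      _ = ∑ k, 2 * hA.eigenvalues (p k) := Finset.sum_congr rfl fun k _ => hen k
      _ ≤ ∑ k : Fin n, 2 * lapEigenSorted G ⟨n - 1, by omega⟩ :=
          Finset.sum_le_sum fun k _ => mul_le_mul_of_nonneg_left (hev k) zero_le_two
      _ = _ := by
          rw [Finset.sum_const, Finset.card_univ, Fintype.card_fin, nsmul_eq_mul]; ring

theorem higher_order_BHT_tilde :
    ∃ C : ℝ, 0 < C ∧ ∀ (V : Type*) [Fintype V] [DecidableEq V] (G : SimpleGraph V)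
      [DecidableRel G.Adj] (d : ℕ), G.IsRegularOfDegree d →
      ∀ (n : ℕ) (hn : 2 ≤ n) (hcard : n ≤ Fintype.card V),
        C * (n : ℝ) ^ 6 * lapEigenSorted G ⟨n - 1, by omega⟩
          ≥ (Real.sqrt (tildeIota G n + 1) - 1) ^ 2 := by


  refine ⟨204832, by norm_num, ?_⟩
  intro V _ _ G _ d _ n hn hcard
  have hn1 : 1 ≤ n := by omega
  have hn' : (1 : ℝ) ≤ n := by exact_mod_cast hn1
  haveI : Nonempty (Fin n) := ⟨⟨0, by omega⟩⟩
  set lam := lapEigenSorted G ⟨n - 1, by omega⟩ with hlam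
  obtain ⟨F, hF, hm, hE⟩ := eigen G n hn1 hcard
  rw [← hlam] at hE
  obtain ⟨g, hg0, hgd, hgm, hge⟩ := core_s10 G hn1 F hF hm _ rfl
  set E := ∑ u, ∑ v, (if G.Adj u v then ‖F u - F v‖ ^ 2 else 0) with hEdef
  have hE0 : 0 ≤ E :=
    Finset.sum_nonneg fun _ _ => Finset.sum_nonneg fun _ _ => by split_ifs <;> positivity
  set r := Real.sqrt (2 * ((2 + 12800 * (n : ℝ) ^ 5) * E)) with hr
  have hr0 : 0 ≤ r := Real.sqrt_nonneg _
  have hr2 : r ^ 2 = 2 * ((2 + 12800 * (n : ℝ) ^ 5) * E) := Real.sq_sqrt (by positivity)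
  have hS : ∀ i, ∃ S : Set V, S.Nonempty ∧ (∀ x ∈ S, 0 < g i x) ∧
      ((vertBdry G S).ncard : ℝ) ≤ ((1 + 2 * r) ^ 2 - 1) * (S.ncard : ℝ) := by
    intro i
    have h1 := hgm i
    refine bht G (g i) (hg0 i) r hr0 (by linarith) ((hge i).trans ?_)
    nlinarith [mul_le_mul_of_nonneg_left h1 (sq_nonneg r)]
  choose S hSne hSpos hSb using hS
  have hti : tildeIota G n ≤ (1 + 2 * r) ^ 2 - 1 := by
    have hbdd : BddBelow {r | ∃ S : Fin n → Set V, (∀ i, (S i).Nonempty) ∧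
        (∀ i j, i ≠ j → Disjoint (S i) (S j)) ∧ r = vertRatioMax G S} := by
      refine ⟨0, ?_⟩
      rintro _ ⟨S, _, _, rfl⟩
      exact Real.iSup_nonneg fun i => by positivity
    refine (csInf_le hbdd ⟨S, hSne, ?_, rfl⟩).trans ?_
    · intro i j hij
      rw [Set.disjoint_left]
      intro x hx hx'
      exact hgd i j hij x (hSpos i x hx) (hSpos j x hx')
    · refine ciSup_le fun i => ?_
      have : (0 : ℝ) < (S i).ncard := by
        exact_mod_cast (Set.ncard_pos (Set.toFinite _)).2 (hSne i)
      rw [div_le_iff₀ this]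
      exact hSb i
  have hti0 : 0 ≤ tildeIota G n := by
    refine Real.sInf_nonneg ?_
    rintro _ ⟨S, _, _, rfl⟩
    exact Real.iSup_nonneg fun i => by positivity
  have h1 : Real.sqrt (tildeIota G n + 1) ≤ 1 + 2 * r := by
    rw [Real.sqrt_le_left (by linarith)]
    linarith
  have h2 : 1 ≤ Real.sqrt (tildeIota G n + 1) := by
    rw [Real.one_le_sqrt]; linarith
  have h3 : (Real.sqrt (tildeIota G n + 1) - 1) ^ 2 ≤ (2 * r) ^ 2 :=
    pow_le_pow_left₀ (by linarith) (by linarith) 2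
  refine h3.trans ?_
  have h4 : (2 * r) ^ 2 = 8 * (2 + 12800 * (n : ℝ) ^ 5) * E := by rw [mul_pow, hr2]; ring
  rw [h4]
  have hlam0 : 0 ≤ (n : ℝ) * lam := by linarith
  have h5 : (1 : ℝ) ≤ (n : ℝ) ^ 5 := one_le_pow₀ hn'
  calc 8 * (2 + 12800 * (n : ℝ) ^ 5) * E ≤ 8 * (2 + 12800 * (n : ℝ) ^ 5) * (2 * n * lam) :=
        mul_le_mul_of_nonneg_left hE (by positivity)
    _ = 16 * (2 + 12800 * (n : ℝ) ^ 5) * (n * lam) := by ring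
    _ ≤ 16 * (12802 * (n : ℝ) ^ 5) * (n * lam) :=
        mul_le_mul_of_nonneg_right (by linarith) hlam0
    _ = _ := by ring

end Multiway
end
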